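/- arXiv:1212.0397 — 2 statements merged into one kernel-verified Lean document; each statement's English description precedes it below -/
import Mathlib

section
/- For every h in H, the limit lim_{n→∞} ρ^{−kn} P(M = n, Y = h) exists and equals a strictly positive constant c_h; that is, the stationary distribution of the minimum queue length jointly with the vector of differences has an exactly geometric tail with decay rate ρ^k. -/
open Filter Topology
open scoped ENNReal

noncomputable section

/-- Traffic intensity ρ = λ / Σ μᵢ. -/
def rho (k : ℕ) (lam : ℝ) (μ : Fin k → ℝ) : ℝ := lam / ∑ i, μ i

/-- Index set of the shortest queues: the zero coordinates of the difference vector. -/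
def zeroSet (k : ℕ) (y : Fin k → ℕ) : Finset (Fin k) :=
  Finset.univ.filter (fun i => y i = 0)

/-- One-step transition probability of the uniformized JSQ chain `Z = (M, Y)` on
`ℕ × (Fin k → ℕ)`, where `M` is the minimum queue length and `Y` the vector of
differences from the minimum. -/
def jsqP (k : ℕ) (lam : ℝ) (μ : Fin k → ℝ) (s s' : ℕ × (Fin k → ℕ)) : ℝ :=
  (if (zeroSet k s.2).card = 1 then
      (if s' = (s.1 + 1, fun j => s.2 j - 1) then lam else 0)
    else
      ∑ i ∈ zeroSet k s.2,
        (if s' = (s.1, Function.update s.2 i 1) then lam / (zeroSet k s.2).card else 0))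
  + (∑ j ∈ (zeroSet k s.2)ᶜ,
      (if s' = (s.1, Function.update s.2 j (s.2 j - 1)) then μ j else 0))
  + (∑ i ∈ zeroSet k s.2,
      (if s' = (if s.1 = 0 then s else (s.1 - 1, fun j => if j = i then 0 else s.2 j + 1))
        then μ i else 0))

/-- The exponential weight `e^{θ·Z}` for `θ ∈ ℝ^{k+1}` and a state `Z = (m, y)`. -/
def expWeight (k : ℕ) (θ : Fin (k + 1) → ℝ) (s : ℕ × (Fin k → ℕ)) : ℝ :=
  Real.exp (θ 0 * (s.1 : ℝ) + ∑ i : Fin k, θ i.succ * (s.2 i : ℝ))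

/-- The stationary moment generating function `φ(θ) = E[e^{θ·Z}] ∈ [0,∞]`. -/
def phi (k : ℕ) (π : ℕ × (Fin k → ℕ) → ℝ) (θ : Fin (k + 1) → ℝ) : ℝ≥0∞ :=
  ∑' s : ℕ × (Fin k → ℕ), ENNReal.ofReal (π s * expWeight k θ s)

/-- `φ_{+U}(θ) = E[e^{θ·Z} 1(Z ∈ S_{+U})]`. -/
def phiPlus (k : ℕ) (π : ℕ × (Fin k → ℕ) → ℝ) (U : Finset (Fin k))
    (θ : Fin (k + 1) → ℝ) : ℝ≥0∞ :=
  ∑' s : ℕ × (Fin k → ℕ),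
    if 1 ≤ s.1 ∧ zeroSet k s.2 = U then ENNReal.ofReal (π s * expWeight k θ s) else 0

/-- `φ_{0U}(θ) = E[e^{θ·Z} 1(Z ∈ S_{0U})]`. -/
def phiZero (k : ℕ) (π : ℕ × (Fin k → ℕ) → ℝ) (U : Finset (Fin k))
    (θ : Fin (k + 1) → ℝ) : ℝ≥0∞ :=
  ∑' s : ℕ × (Fin k → ℕ),
    if s.1 = 0 ∧ zeroSet k s.2 = U then ENNReal.ofReal (π s * expWeight k θ s) else 0

/-- The mgf `γ_{+U}(θ)` of the one-step increment from states in `S_{+U}`. -/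
def gammaPlus (k : ℕ) (lam : ℝ) (μ : Fin k → ℝ) (U : Finset (Fin k))
    (θ : Fin (k + 1) → ℝ) : ℝ :=
  (if U.card = 1 then lam * Real.exp (θ 0 - ∑ j ∈ Uᶜ, θ j.succ)
    else ∑ i ∈ U, (lam / U.card) * Real.exp (θ i.succ))
  + ∑ j ∈ Uᶜ, μ j * Real.exp (-θ j.succ)
  + ∑ i ∈ U, μ i * Real.exp (-θ 0 + ∑ j ∈ Finset.univ.erase i, θ j.succ)

/-- The mgf `γ_{0U}(θ)` of the one-step increment from states in `S_{0U}`. -/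
def gammaZero (k : ℕ) (lam : ℝ) (μ : Fin k → ℝ) (U : Finset (Fin k))
    (θ : Fin (k + 1) → ℝ) : ℝ :=
  (if U.card = 1 then lam * Real.exp (θ 0 - ∑ j ∈ Uᶜ, θ j.succ)
    else ∑ i ∈ U, (lam / U.card) * Real.exp (θ i.succ))
  + ∑ j ∈ Uᶜ, μ j * Real.exp (-θ j.succ)
  + ∑ i ∈ U, μ i

end

/-- The total queue length. -/
def total {k : ℕ} (q : Fin k → ℤ) : ℤ := ∑ i, q i

/-- The set of shortest queues. -/
def shortest {k : ℕ} (q : Fin k → ℤ) : Finset (Fin k) :=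
  Finset.univ.filter (fun i => ∀ j, q i ≤ q j)

/-- The transition operator of the join-the-shortest-queue walk on `ℤ^k` without boundary, with
arrival weight `a` and service weights `m`. -/
noncomputable def freeOp {k : ℕ} (a : ℝ) (m : Fin k → ℝ) (u : (Fin k → ℤ) → ℝ)
    (q : Fin k → ℤ) : ℝ :=
  ∑ i ∈ shortest q, a / (shortest q).card * u (q + Pi.single i 1)
    + ∑ i, m i * u (q - Pi.single i 1)

section FreeWalk

variable {k : ℕ} {a : ℝ} {m : Fin k → ℝ}

lemma shortest_nonempty (hk : 0 < k) (q : Fin k → ℤ) : (shortest q).Nonempty := by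
  have : Nonempty (Fin k) := ⟨⟨0, hk⟩⟩
  obtain ⟨i, hi⟩ := Finite.exists_min q
  exact ⟨i, by simpa [shortest] using hi⟩

lemma total_add_single (q : Fin k → ℤ) (i : Fin k) : total (q + Pi.single i 1) = total q + 1 := by
  simp [total, Finset.sum_add_distrib]

lemma total_sub_single (q : Fin k → ℤ) (i : Fin k) : total (q - Pi.single i 1) = total q - 1 := by
  simp [total, Finset.sum_sub_distrib]

lemma total_sub_const (q : Fin k → ℤ) (n : ℤ) :
    total (fun i => q i - n) = total q - k * n := by
  simp [total, Finset.sum_sub_distrib]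

lemma shortest_sub_const (q : Fin k → ℤ) (n : ℤ) : shortest (fun i => q i - n) = shortest q := by
  simp [shortest]

lemma sum_shortest_weight (hk : 0 < k) (q : Fin k → ℤ) (X : ℝ) :
    ∑ _i ∈ shortest q, a / (shortest q).card * X = a * X := by
  have h : ((shortest q).card : ℝ) ≠ 0 := by
    exact_mod_cast (Finset.card_pos.2 (shortest_nonempty hk q)).ne'
  rw [Finset.sum_const, nsmul_eq_mul]
  field_simp

lemma freeOp_sub_const (u : (Fin k → ℤ) → ℝ) (n : ℤ) (q : Fin k → ℤ) :
    freeOp a m (fun q => u (fun i => q i - n)) q = freeOp a m u (fun i => q i - n) := by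
  have h1 : ∀ i : Fin k, (fun j => (q + Pi.single i 1 : Fin k → ℤ) j - n)
      = (fun j => q j - n) + Pi.single i (1 : ℤ) := by
    intro i; ext j; simp only [Pi.add_apply]; ring
  have h2 : ∀ i : Fin k, (fun j => (q - Pi.single i 1 : Fin k → ℤ) j - n)
      = (fun j => q j - n) - Pi.single i (1 : ℤ) := by
    intro i; ext j; simp only [Pi.sub_apply]; ring
  simp only [freeOp, shortest_sub_const, h1, h2]

lemma freeOp_add (u v : (Fin k → ℤ) → ℝ) (q : Fin k → ℤ) :
    freeOp a m (fun q => u q + v q) q = freeOp a m u q + freeOp a m v q := by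
  simp only [freeOp, mul_add, Finset.sum_add_distrib]; ring

lemma freeOp_sub (u v : (Fin k → ℤ) → ℝ) (q : Fin k → ℤ) :
    freeOp a m (fun q => u q - v q) q = freeOp a m u q - freeOp a m v q := by
  simp only [freeOp, mul_sub, Finset.sum_sub_distrib]; ring

lemma freeOp_const_mul (c : ℝ) (u : (Fin k → ℤ) → ℝ) (q : Fin k → ℤ) :
    freeOp a m (fun q => c * u q) q = c * freeOp a m u q := by
  simp only [freeOp, mul_left_comm _ c, ← Finset.mul_sum, mul_add]

lemma freeOp_total (hk : 0 < k) (g : ℤ → ℝ) (q : Fin k → ℤ) :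
    freeOp a m (fun q => g (total q)) q
      = a * g (total q + 1) + (∑ i, m i) * g (total q - 1) := by
  simp only [freeOp, total_add_single, total_sub_single, ← Finset.sum_mul]
  rw [Finset.sum_mul, sum_shortest_weight hk]

lemma freeOp_const (hk : 0 < k) (hab : a + ∑ i, m i = 1) (c : ℝ) (q : Fin k → ℤ) :
    freeOp a m (fun _ => c) q = c := by
  rw [freeOp_total hk (fun _ => c), ← add_mul, hab, one_mul]

lemma freeOp_mono (ha : 0 ≤ a) (hm : ∀ i, 0 ≤ m i) {u v : (Fin k → ℤ) → ℝ} {q : Fin k → ℤ}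
    (hup : ∀ i ∈ shortest q, u (q + Pi.single i 1) ≤ v (q + Pi.single i 1))
    (hdown : ∀ i, u (q - Pi.single i 1) ≤ v (q - Pi.single i 1)) :
    freeOp a m u q ≤ freeOp a m v q := by
  unfold freeOp
  gcongr with i hi i hi
  · exact hup i hi
  · exact hm i
  · exact hdown i

lemma freeOp_le (hk : 0 < k) (ha : 0 ≤ a) (hm : ∀ i, 0 ≤ m i) {u : (Fin k → ℤ) → ℝ}
    {q : Fin k → ℤ} {X Y : ℝ}
    (hup : ∀ i ∈ shortest q, u (q + Pi.single i 1) ≤ X)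
    (hdown : ∀ i, u (q - Pi.single i 1) ≤ Y) :
    freeOp a m u q ≤ a * X + (∑ i, m i) * Y := by
  rw [← sum_shortest_weight hk q X, Finset.sum_mul]
  unfold freeOp
  gcongr with i hi i hi
  · exact hup i hi
  · exact hm i
  · exact hdown i

lemma tendsto_freeOp {p : ℕ → (Fin k → ℤ) → ℝ} {u : (Fin k → ℤ) → ℝ}
    (h : ∀ q, Tendsto (fun n => p n q) atTop (𝓝 (u q))) (q : Fin k → ℤ) :
    Tendsto (fun n => freeOp a m (p n) q) atTop (𝓝 (freeOp a m u q)) :=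
  (tendsto_finsetSum _ fun _ _ => (h _).const_mul _).add
    (tendsto_finsetSum _ fun _ _ => (h _).const_mul _)

/-- Maximum principle: a bounded subharmonic function on the half-space `total q ≤ l` that is
nonpositive on the boundary is nonpositive. -/
lemma maximum_principle (hk : 0 < k) (hm : ∀ i, 0 < m i)
    (hab : a + ∑ i, m i = 1) (hlt : ∑ i, m i < a) {w : (Fin k → ℤ) → ℝ} {l : ℤ} {B : ℝ}
    (hB : ∀ q, total q ≤ l → w q ≤ B)
    (hsub : ∀ q, total q < l → w q ≤ freeOp a m w q)
    (hbd : ∀ q, total q = l → w q ≤ 0) :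
    ∀ q, total q ≤ l → w q ≤ 0 := by
  have : Nonempty (Fin k) := ⟨⟨0, hk⟩⟩
  set b := ∑ i, m i with hb
  have hb0 : 0 < b := Finset.sum_pos (fun i _ => hm i) Finset.univ_nonempty
  have ha0 : 0 < a := hb0.trans hlt
  have ha1 : a < 1 := by linarith
  set θ := b / a with hθ
  have hθ0 : 0 < θ := by positivity
  have hθ1 : θ < 1 := (div_lt_one ha0).2 hlt
  have hharm : ∀ n : ℤ, a * θ ^ (n + 1) + b * θ ^ (n - 1) = θ ^ n := by
    intro n
    rw [zpow_add_one₀ hθ0.ne', zpow_sub_one₀ hθ0.ne']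
    have : a * θ = b := by rw [hθ]; field_simp
    have h2 : b * θ⁻¹ = a := by rw [hθ]; field_simp
    calc _ = θ ^ n * (a * θ) + θ ^ n * (b * θ⁻¹) := by ring
      _ = θ ^ n := by rw [this, h2, ← mul_add, add_comm b a, hab, mul_one]
  intro q₀ hq₀
  refine le_of_forall_pos_le_add fun ε₀ hε₀ => ?_
  rw [zero_add]
  set ε := ε₀ / θ ^ (total q₀ - l) with hε
  have hεpos : 0 < ε := by positivity
  set v : (Fin k → ℤ) → ℝ := fun q => w q - ε * θ ^ (total q - l) with hv
  have hvw : ∀ q, v q ≤ w q := fun q => by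
    have : 0 < ε * θ ^ (total q - l) := by positivity
    simp only [hv]; linarith
  have hvsub : ∀ q, total q < l → v q ≤ freeOp a m v q := by
    intro q hq
    rw [hv, freeOp_sub, freeOp_const_mul, freeOp_total hk (fun n => θ ^ (n - l))]
    have := hharm (total q - l)
    rw [← hb, show total q + 1 - l = total q - l + 1 by ring,
      show total q - 1 - l = total q - l - 1 by ring, this]
    linarith [hsub q hq]
  obtain ⟨N, hN⟩ : ∃ N : ℕ, B / ε < (θ⁻¹) ^ N :=
    pow_unbounded_of_one_lt _ ((one_lt_inv₀ hθ0).2 hθ1)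
  have hlow : ∀ q, total q ≤ l - N → v q ≤ 0 := by
    intro q hq
    have h1 : w q ≤ B := hB q (by omega)
    have h2 : (θ⁻¹) ^ N ≤ θ ^ (total q - l) := by
      rw [inv_pow, ← zpow_natCast, ← zpow_neg]
      exact zpow_le_zpow_right_of_le_one₀ hθ0 hθ1.le (by omega)
    have h3 : B < ε * (θ⁻¹) ^ N := by rw [div_lt_iff₀ hεpos] at hN; linarith
    have h4 : ε * (θ⁻¹) ^ N ≤ ε * θ ^ (total q - l) := by gcongr
    simp only [hv]; linarith
  have hstep : ∀ S : ℝ, 0 ≤ S → (∀ q, total q ≤ l → v q ≤ S) →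
      ∀ q, total q ≤ l → v q ≤ (1 - a ^ N) * S := by
    intro S hS hSv
    have key : ∀ j : ℕ, ∀ q, total q = l - j → v q ≤ (1 - a ^ j) * S := by
      intro j
      induction j with
      | zero => intro q hq; simpa using (hvw q).trans (hbd q (by simpa using hq))
      | succ j ih =>
        intro q hq
        push_cast at hq
        refine (hvsub q (by omega)).trans ((freeOp_le hk ha0.le (fun i => (hm i).le)
          (X := (1 - a ^ j) * S) (Y := S) (fun i _ => ih _ ?_)
          (fun i => hSv _ ?_)).trans (le_of_eq ?_))
        · rw [total_add_single]; omega
        · rw [total_sub_single]; omega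
        · rw [← hb, show b = 1 - a by linarith]; ring
    intro q hq
    rcases le_or_gt (total q) (l - N) with h | h
    · exact (hlow q h).trans (mul_nonneg (sub_nonneg.2 (pow_le_one₀ ha0.le ha1.le)) hS)
    · obtain ⟨j, hj⟩ : ∃ j : ℕ, total q = l - j := ⟨(l - total q).toNat, by omega⟩
      refine (key j q hj).trans ?_
      have : a ^ N ≤ a ^ j := pow_le_pow_of_le_one ha0.le ha1.le (by omega)
      gcongr
  have hiter : ∀ n : ℕ, ∀ q, total q ≤ l → v q ≤ (1 - a ^ N) ^ n * max B 0 := by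
    intro n
    induction n with
    | zero => intro q hq; simpa using Or.inl ((hvw q).trans (hB q hq))
    | succ n ih =>
      have h0 : 0 ≤ 1 - a ^ N := sub_nonneg.2 (pow_le_one₀ ha0.le ha1.le)
      intro q hq
      rw [pow_succ', mul_assoc]
      exact hstep _ (mul_nonneg (pow_nonneg h0 n) (le_max_right _ _)) ih q hq
  have hlim : Tendsto (fun n : ℕ => (1 - a ^ N) ^ n * max B 0) atTop (𝓝 (0 * max B 0)) :=
    (tendsto_pow_atTop_nhds_zero_of_lt_one (sub_nonneg.2 (pow_le_one₀ ha0.le ha1.le))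
      (by have : 0 < a ^ N := by positivity
          linarith)).mul_const _
  have : v q₀ ≤ 0 := by
    rw [zero_mul] at hlim
    exact ge_of_tendsto' hlim fun n => hiter n q₀ hq₀
  have h5 : ε * θ ^ (total q₀ - l) = ε₀ := by
    rw [hε]; field_simp
  simp only [hv] at this
  linarith

/-- The Green function of the upward drifting free walk. -/
lemma exists_green (hk : 0 < k) (hm : ∀ i, 0 < m i)
    (hab : a + ∑ i, m i = 1) (hlt : ∑ i, m i < a) (t : Fin k → ℤ) :
    ∃ u : (Fin k → ℤ) → ℝ, ∃ D : ℝ, (∀ q, 0 ≤ u q) ∧ (∀ q, u q ≤ D) ∧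
      (∀ q, u q ≤ D * ((∑ i, m i) / a) ^ (total q - total t)) ∧
      ∀ q, u q = freeOp a m u q + if q = t then 1 else 0 := by
  have : Nonempty (Fin k) := ⟨⟨0, hk⟩⟩
  set b := ∑ i, m i with hb
  have hb0 : 0 < b := Finset.sum_pos (fun i _ => hm i) Finset.univ_nonempty
  have ha0 : 0 < a := hb0.trans hlt
  set θ := b / a with hθ
  have hθ0 : 0 < θ := by positivity
  have haθ : a * θ = b := by rw [hθ]; field_simp
  have hθ1 : θ < 1 := (div_lt_one ha0).2 hlt
  have hm0 : ∀ i, 0 ≤ m i := fun i => (hm i).le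
  set D := 1 / (a - b) with hD
  have hD0 : 0 < D := by have := sub_pos.2 hlt; positivity
  have hDeq : a * (D * θ) + b * D + 1 = D := by
    have h1 : a - b ≠ 0 := (sub_pos.2 hlt).ne'
    have h2 : D * (a - b) = 1 := by rw [hD]; field_simp
    have : a * (D * θ) = D * b := by rw [← haθ]; ring
    rw [this, ← h2, show a = 1 - b by linarith]; ring
  set S : (Fin k → ℤ) → ℝ := fun q => D * min 1 (θ ^ (total q - total t)) with hS
  have hSub : ∀ q, freeOp a m S q + (if q = t then 1 else 0) ≤ S q := by
    intro q
    split_ifs with hq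
    · subst hq
      have : S q = D := by simp [hS]
      rw [this, ← hDeq]
      gcongr
      refine freeOp_le hk ha0.le hm0 (fun i _ => ?_) (fun i => ?_)
      · simp only [hS, total_add_single, add_sub_cancel_left, zpow_one]
        gcongr; exact min_le_right _ _
      · simp only [hS]
        exact mul_le_of_le_one_right hD0.le (min_le_left _ _)
    · rw [add_zero, hS, freeOp_const_mul]
      change _ ≤ D * min 1 (θ ^ (total q - total t))
      refine mul_le_mul_of_nonneg_left ?_ hD0.le
      refine le_min ?_ ?_
      · refine (freeOp_mono ha0.le hm0 (v := fun _ => 1) (fun i _ => min_le_left _ _)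
          (fun i => min_le_left _ _)).trans_eq (freeOp_const hk hab 1 q)
      · refine (freeOp_mono ha0.le hm0 (v := fun q => θ ^ (total q - total t))
          (fun i _ => min_le_right _ _) (fun i => min_le_right _ _)).trans_eq ?_
        rw [freeOp_total hk (fun n => θ ^ (n - total t)), ← hb,
          show total q + 1 - total t = total q - total t + 1 by ring,
          show total q - 1 - total t = total q - total t - 1 by ring,
          zpow_add_one₀ hθ0.ne', zpow_sub_one₀ hθ0.ne']
        have h2 : b * θ⁻¹ = a := by rw [hθ]; field_simp
        calc _ = θ ^ (total q - total t) * (a * θ) + θ ^ (total q - total t) * (b * θ⁻¹) := by ring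
          _ = _ := by rw [haθ, h2, ← mul_add, add_comm b a, hab, mul_one]
  let p : ℕ → (Fin k → ℤ) → ℝ := fun n =>
    Nat.rec (fun _ => 0) (fun _ v q => freeOp a m v q + if q = t then 1 else 0) n
  have hp0 : ∀ q, p 0 q = 0 := fun q => rfl
  have hps : ∀ n q, p (n + 1) q = freeOp a m (p n) q + if q = t then 1 else 0 :=
    fun n q => rfl
  have hpS : ∀ n q, p n q ≤ S q := by
    intro n
    induction n with
    | zero => intro q; rw [hp0]; simp only [hS]; positivity
    | succ n ih =>
      intro q
      rw [hps]
      refine le_trans ?_ (hSub q)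
      gcongr
      exact freeOp_mono ha0.le hm0 (fun i _ => ih _) (fun i => ih _)
  have hpmono : ∀ n q, p n q ≤ p (n + 1) q := by
    intro n
    induction n with
    | zero =>
      intro q
      rw [hps, hp0]
      have : freeOp a m (p 0) q = 0 := freeOp_const hk hab 0 q
      rw [this]; split_ifs <;> norm_num
    | succ n ih =>
      intro q
      rw [hps, hps (n + 1)]
      gcongr
      exact freeOp_mono ha0.le hm0 (fun i _ => ih _) (fun i => ih _)
  have hlim : ∀ q, Tendsto (fun n => p n q) atTop (𝓝 (⨆ n, p n q)) := fun q =>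
    tendsto_atTop_ciSup (monotone_nat_of_le_succ fun n => hpmono n q)
      ⟨S q, by rintro _ ⟨n, rfl⟩; exact hpS n q⟩
  have huS : ∀ q, (⨆ n, p n q) ≤ S q := fun q => ciSup_le fun n => hpS n q
  refine ⟨fun q => ⨆ n, p n q, D, fun q => ?_, fun q => (huS q).trans ?_,
    fun q => (huS q).trans ?_, fun q => ?_⟩
  · exact le_ciSup_of_le ⟨S q, by rintro _ ⟨n, rfl⟩; exact hpS n q⟩ 0 (hp0 q).ge
  · exact mul_le_of_le_one_right hD0.le (min_le_left _ _)
  · simp only [hS]; gcongr; exact min_le_right _ _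
  · exact tendsto_nhds_unique ((tendsto_add_atTop_iff_nat 1).2 (hlim q))
      ((tendsto_freeOp hlim q).add_const _)

/-- A parameter for which the exponential imbalance function has negative drift. -/
lemma exists_drift_parameter (hk : 2 ≤ k) {a b : ℝ} (hab : a + b = 1) (hlt : b < a) :
    ∃ x : ℝ, 1 < x ∧
      ((k : ℝ) - 1) * (a * x ^ (2 * k - 1 : ℤ) + b * x ^ (-(2 * k - 1) : ℤ) - 1)
        ≤ a * (x ^ (2 * k - 1 : ℤ) - x ^ (2 * k - 1 - k * (2 * k - 2) : ℤ))
          - b * (x ^ (-(2 * k - 1) + k * (2 * k - 2) : ℤ) - x ^ (-(2 * k - 1) : ℤ)) := by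
  set F : ℝ → ℝ := fun x =>
    (a * (x ^ (2 * k - 1 : ℤ) - x ^ (2 * k - 1 - k * (2 * k - 2) : ℤ))
          - b * (x ^ (-(2 * k - 1) + k * (2 * k - 2) : ℤ) - x ^ (-(2 * k - 1) : ℤ)))
      - ((k : ℝ) - 1) * (a * x ^ (2 * k - 1 : ℤ) + b * x ^ (-(2 * k - 1) : ℤ) - 1) with hF
  have hz : ∀ n : ℤ, HasDerivAt (fun x : ℝ => x ^ n) (n : ℝ) 1 := by
    intro n
    simpa using hasDerivAt_zpow n (1 : ℝ) (Or.inl one_ne_zero)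
  have hk1 : (1 : ℝ) < k := by exact_mod_cast hk
  have hd : HasDerivAt F (((k : ℝ) - 1) * (a - b)) 1 := by
    have := ((((hz (2 * k - 1)).sub (hz (2 * k - 1 - k * (2 * k - 2)))).const_mul a).sub
      (((hz (-(2 * k - 1) + k * (2 * k - 2))).sub (hz (-(2 * k - 1)))).const_mul b)).sub
      ((((hz (2 * k - 1)).const_mul a).add ((hz (-(2 * k - 1))).const_mul b)).sub_const 1
        |>.const_mul ((k : ℝ) - 1))
    refine this.congr_deriv ?_
    push_cast; ring
  have hF1 : F 1 = 0 := by simp [hF, hab]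
  have hpos : 0 < ((k : ℝ) - 1) * (a - b) := mul_pos (by linarith) (by linarith)
  have hev : ∀ᶠ x in 𝓝[>] (1 : ℝ), 0 < slope F 1 x :=
    ((hasDerivAt_iff_tendsto_slope.1 hd).mono_left
      (nhdsWithin_mono _ fun x hx => ne_of_gt hx)).eventually (lt_mem_nhds hpos)
  obtain ⟨x, hx, hx1⟩ := (hev.and self_mem_nhdsWithin).exists
  have hx1 : 1 < x := hx1
  refine ⟨x, hx1, ?_⟩
  rw [slope_def_field, hF1, sub_zero] at hx
  have : 0 < F x := by
    have := mul_pos hx (sub_pos.2 hx1)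
    rwa [div_mul_cancel₀ _ (sub_pos.2 hx1).ne'] at this
  simp only [hF] at this
  linarith

/-- The exponential imbalance of a queue length vector. -/
noncomputable def imbalance (x : ℝ) (q : Fin k → ℤ) : ℝ :=
  ∑ i, x ^ ((2 * k - 2 : ℤ) * (total q - k * q i))

lemma imbalance_sub_const (x : ℝ) (q : Fin k → ℤ) (n : ℤ) :
    imbalance x (fun i => q i - n) = imbalance x q := by
  simp only [imbalance, total_sub_const]
  refine Finset.sum_congr rfl fun i _ => ?_
  congr 2; ring

lemma imbalance_nonneg {x : ℝ} (hx : 1 < x) (q : Fin k → ℤ) : 0 ≤ imbalance x q :=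
  Finset.sum_nonneg fun _ _ => by positivity

lemma imbalance_const (x : ℝ) (n : ℤ) : imbalance x (fun _ : Fin k => n) = k := by
  simp [imbalance, total]

lemma exists_le_of_imbalance_le (hk : 2 ≤ k) {x : ℝ} (hx : 1 < x) (R : ℝ) :
    ∃ B : ℕ, ∀ q : Fin k → ℤ, imbalance x q ≤ R → ∀ i, k * q i ≤ total q + k * B := by
  obtain ⟨B, hB⟩ := pow_unbounded_of_one_lt R hx
  refine ⟨B, fun q hq i => ?_⟩
  have hgap : ∀ j, total q - k * q j ≤ B := by
    intro j
    by_contra! hj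
    have h1 : x ^ ((2 * k - 2 : ℤ) * (total q - k * q j)) ≤ R :=
      (Finset.single_le_sum (f := fun j => x ^ ((2 * k - 2 : ℤ) * (total q - k * q j)))
        (fun _ _ => by positivity) (Finset.mem_univ j)).trans hq
    have h2 : x ^ B ≤ x ^ ((2 * k - 2 : ℤ) * (total q - k * q j)) := by
      rw [← zpow_natCast]
      refine zpow_le_zpow_right₀ hx.le ?_
      have : (2 : ℤ) ≤ 2 * k - 2 := by omega
      nlinarith
    linarith
  have hsum : ∑ j ∈ Finset.univ.erase i, (total q - k * q j)
      ≤ ∑ _j ∈ Finset.univ.erase i, (B : ℤ) := Finset.sum_le_sum fun j _ => hgap j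
  have htot : q i + ∑ j ∈ Finset.univ.erase i, q j = total q :=
    Finset.add_sum_erase _ _ (Finset.mem_univ i)
  rw [Finset.sum_sub_distrib, ← Finset.mul_sum, Finset.sum_const, Finset.sum_const,
    Finset.card_erase_of_mem (Finset.mem_univ i), Finset.card_univ, Fintype.card_fin,
    nsmul_eq_mul, nsmul_eq_mul, Nat.cast_sub (by omega)] at hsum
  rw [show ∑ j ∈ Finset.univ.erase i, q j = total q - q i by linarith] at hsum
  push_cast at hsum
  nlinarith

/-- The expected imbalance on first reaching level `l` is dominated by a superharmonic function. -/
lemma exists_superharmonic (hk : 2 ≤ k) (hm : ∀ i, 0 < m i)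
    (hab : a + ∑ i, m i = 1) (hlt : ∑ i, m i < a) :
    ∃ x C : ℝ, 1 < x ∧ (k : ℝ) ≤ C ∧ ∀ (l : ℤ) (q : Fin k → ℤ),
      freeOp a m (fun q => x ^ (total q - l) * imbalance x q + C * (1 - x ^ (total q - l))) q
        ≤ x ^ (total q - l) * imbalance x q + C * (1 - x ^ (total q - l)) := by
  have hk0 : 0 < k := by omega
  have : Nonempty (Fin k) := ⟨⟨0, hk0⟩⟩
  set b := ∑ i, m i with hb
  have hb0 : 0 < b := Finset.sum_pos (fun i _ => hm i) Finset.univ_nonempty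
  have ha0 : 0 < a := hb0.trans hlt
  obtain ⟨x, hx, hxF⟩ := exists_drift_parameter hk hab hlt
  have hx0 : 0 < x := by linarith
  set c := x ^ (2 * k - 1 : ℤ) with hc
  set c' := x ^ (-(2 * k - 1) : ℤ) with hc'
  set d := x ^ (2 * k - 1 - k * (2 * k - 2) : ℤ) with hd
  set d' := x ^ (-(2 * k - 1) + k * (2 * k - 2) : ℤ) with hd'
  have hk2 : (2 : ℤ) ≤ k := by exact_mod_cast hk
  have hcd : d ≤ c := zpow_le_zpow_right₀ hx.le (by nlinarith)
  have hcd' : c' ≤ d' := zpow_le_zpow_right₀ hx.le (by nlinarith)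
  have hc0 : 0 < c := by positivity
  have hc'0 : 0 < c' := by positivity
  set K := a * c + b * c' - 1 with hK
  have hcc' : c * c' = 1 := by rw [hc, hc', ← zpow_add₀ hx0.ne']; simp
  have hc1 : 1 < c := one_lt_zpow₀ hx (by omega)
  have hK0 : 0 < K := by
    have h1 : c' = 1 / c := by field_simp; linarith
    have : K = (c - 1) * (a - b * c') := by
      rw [hK, show a = 1 - b by linarith]
      linear_combination b * hcc'
    rw [this]
    have : b * c' ≤ b := by
      refine mul_le_of_le_one_right hb0.le ?_
      rw [h1]; exact (div_le_one hc0).2 hc1.le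
    exact mul_pos (by linarith) (by linarith)
  set κ := a * x + b * x⁻¹ - 1 with hκ
  have hκ0 : 0 < κ := by
    have : κ = (x - 1) * (a - b * x⁻¹) := by
      rw [hκ, show a = 1 - b by linarith]
      field_simp; ring
    rw [this]
    have : b * x⁻¹ ≤ b := mul_le_of_le_one_right hb0.le (inv_le_one_of_one_le₀ hx.le)
    exact mul_pos (by linarith) (by linarith)
  refine ⟨x, max k (K / κ), hx, le_max_left _ _, fun l q => ?_⟩
  set C := max (k : ℝ) (K / κ) with hC
  have hCκ : K ≤ C * κ := (div_le_iff₀ hκ0).1 (le_max_right _ _)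
  let g : Fin k → (Fin k → ℤ) → ℝ := fun i q =>
    x ^ (total q - l + (2 * k - 2 : ℤ) * (total q - k * q i))
  have hg0 : ∀ i q, 0 < g i q := fun i q => by simp only [g]; positivity
  have hsum : ∀ q : Fin k → ℤ, x ^ (total q - l) * imbalance x q = ∑ i, g i q := by
    intro q
    rw [imbalance, Finset.mul_sum]
    exact Finset.sum_congr rfl fun i _ => (zpow_add₀ hx0.ne' _ _).symm
  have hgup : ∀ i q, ∑ j, g j (q + Pi.single i 1) = c * ∑ j, g j q - (c - d) * g i q := by
    intro i q
    have h1 : ∀ j ∈ Finset.univ.erase i, g j (q + Pi.single i 1) = c * g j q := by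
      intro j hj
      have : j ≠ i := Finset.ne_of_mem_erase hj
      simp only [g, hc, total_add_single, Pi.add_apply, Pi.single_eq_of_ne this,
        ← zpow_add₀ hx0.ne']
      congr 1; ring
    have h2 : g i (q + Pi.single i 1) = d * g i q := by
      simp only [g, hd, total_add_single, Pi.add_apply, Pi.single_eq_same, ← zpow_add₀ hx0.ne']
      congr 1; ring
    rw [← Finset.add_sum_erase _ _ (Finset.mem_univ i), Finset.sum_congr rfl h1, h2,
      ← Finset.add_sum_erase _ (fun j => g j q) (Finset.mem_univ i), ← Finset.mul_sum]
    ring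
  have hgdown : ∀ i q, ∑ j, g j (q - Pi.single i 1) = c' * ∑ j, g j q + (d' - c') * g i q := by
    intro i q
    have h1 : ∀ j ∈ Finset.univ.erase i, g j (q - Pi.single i 1) = c' * g j q := by
      intro j hj
      have : j ≠ i := Finset.ne_of_mem_erase hj
      simp only [g, hc', total_sub_single, Pi.sub_apply, Pi.single_eq_of_ne this,
        ← zpow_add₀ hx0.ne']
      congr 1; ring
    have h2 : g i (q - Pi.single i 1) = d' * g i q := by
      simp only [g, hd', total_sub_single, Pi.sub_apply, Pi.single_eq_same, ← zpow_add₀ hx0.ne']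
      congr 1; ring
    rw [← Finset.add_sum_erase _ _ (Finset.mem_univ i), Finset.sum_congr rfl h1, h2,
      ← Finset.add_sum_erase _ (fun j => g j q) (Finset.mem_univ i), ← Finset.mul_sum]
    ring
  obtain ⟨i₁, hi₁⟩ := shortest_nonempty hk0 q
  have hgmono : ∀ i j, q i ≤ q j → g j q ≤ g i q := by
    intro i j hij
    refine zpow_le_zpow_right₀ hx.le ?_
    have : (2 * k - 2 : ℤ) * (total q - k * q j) ≤ (2 * k - 2 : ℤ) * (total q - k * q i) := by
      refine mul_le_mul_of_nonneg_left ?_ (by omega)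
      nlinarith
    linarith
  have hi₁' : ∀ j, q i₁ ≤ q j := by simpa [shortest] using hi₁
  have hG : freeOp a m (fun q => ∑ i, g i q) q ≤ a * (c * ∑ j, g j q - (c - d) * g i₁ q)
      + b * (c' * ∑ j, g j q + (d' - c') * g i₁ q) := by
    refine freeOp_le hk0 ha0.le (fun i => (hm i).le) (fun i hi => ?_) (fun i => ?_)
    · rw [hgup]
      have hi' : ∀ j, q i ≤ q j := by simpa [shortest] using hi
      have := hgmono i i₁ (hi' i₁)
      have := mul_le_mul_of_nonneg_left this (sub_nonneg.2 hcd)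
      linarith
    · rw [hgdown]
      have := mul_le_mul_of_nonneg_left (hgmono i₁ i (hi₁' i)) (sub_nonneg.2 hcd')
      linarith
  have hGmax : ∑ j, g j q ≤ (k - 1) * g i₁ q + x ^ (total q - l) := by
    obtain ⟨i₀, hi₀⟩ : ∃ i, total q ≤ k * q i := by
      by_contra! hcon
      have : ∑ i, (k * q i) < ∑ _i : Fin k, total q :=
        Finset.sum_lt_sum_of_nonempty Finset.univ_nonempty fun i _ => hcon i
      rw [← Finset.mul_sum] at this
      simp [total] at this
    have h0 : g i₀ q ≤ x ^ (total q - l) := by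
      refine zpow_le_zpow_right₀ hx.le ?_
      have : (2 * k - 2 : ℤ) * (total q - k * q i₀) ≤ 0 :=
        mul_nonpos_of_nonneg_of_nonpos (by omega) (by linarith)
      linarith
    rw [← Finset.add_sum_erase _ _ (Finset.mem_univ i₀)]
    have h1 : ∑ j ∈ Finset.univ.erase i₀, g j q ≤ ∑ _j ∈ Finset.univ.erase i₀, g i₁ q :=
      Finset.sum_le_sum fun j _ => hgmono _ _ (hi₁' j)
    rw [Finset.sum_const, Finset.card_erase_of_mem (Finset.mem_univ _), Finset.card_univ,
      Fintype.card_fin, nsmul_eq_mul, Nat.cast_sub (by omega), Nat.cast_one] at h1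
    linarith
  have hGK : freeOp a m (fun q => ∑ i, g i q) q ≤ ∑ j, g j q + K * x ^ (total q - l) := by
    have h1 := mul_le_mul_of_nonneg_left hGmax hK0.le
    have h2 := mul_le_mul_of_nonneg_right hxF (hg0 i₁ q).le
    nlinarith
  have hX : freeOp a m (fun q => x ^ (total q - l)) q = (1 + κ) * x ^ (total q - l) := by
    rw [freeOp_total hk0 (fun n => x ^ (n - l)), ← hb,
      show total q + 1 - l = total q - l + 1 by ring,
      show total q - 1 - l = total q - l - 1 by ring,
      zpow_add_one₀ hx0.ne', zpow_sub_one₀ hx0.ne', hκ]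
    ring
  simp only [hsum]
  rw [freeOp_add, freeOp_const_mul, freeOp_sub, freeOp_const hk0 hab, hX]
  have hxp : 0 < x ^ (total q - l) := by positivity
  have := mul_le_mul_of_nonneg_right hCκ hxp.le
  linarith

lemma reach_const (hk : 0 < k) (ha : 0 < a) (hm : ∀ i, 0 ≤ m i) {w : (Fin k → ℤ) → ℝ} {n : ℤ}
    (h0 : ∀ q, total q ≤ k * n → 0 ≤ w q)
    (hsup : ∀ q, total q < k * n → freeOp a m w q ≤ w q) :
    ∀ (N : ℕ) (q : Fin k → ℤ), total q = k * n - N → (∀ i, q i ≤ n) →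
      (a / k) ^ N * w (fun _ => n) ≤ w q := by
  intro N
  induction N with
  | zero =>
    intro q hq hqn
    have : q = fun _ => n := by
      have h1 : ∑ i, (n - q i) = 0 := by
        have : ∑ i, q i = k * n := by simpa [total] using hq
        simp [Finset.sum_sub_distrib, this]
      rw [Finset.sum_eq_zero_iff_of_nonneg fun i _ => sub_nonneg.2 (hqn i)] at h1
      ext i
      have := h1 i (Finset.mem_univ i)
      omega
    simp [this]
  | succ N ih =>
    intro q hq hqn
    push_cast at hq
    obtain ⟨i, hi⟩ := shortest_nonempty hk q
    have hi' : ∀ j, q i ≤ q j := by simpa [shortest] using hi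
    have hin : q i < n := by
      by_contra! hcon
      have : ∑ _j : Fin k, n ≤ ∑ j, q j := Finset.sum_le_sum fun j _ => hcon.trans (hi' j)
      simp only [Finset.sum_const, Finset.card_univ, Fintype.card_fin, nsmul_eq_mul] at this
      simp only [total] at hq
      omega
    have hnext := ih (q + Pi.single i 1) (by rw [total_add_single]; omega) (by
      intro j
      by_cases hj : j = i
      · subst hj; simp; omega
      · simpa [hj] using hqn j)
    have hup : ∀ j, 0 ≤ w (q + Pi.single j 1) :=
      fun j => h0 _ (by rw [total_add_single]; omega)
    have hcard : ((shortest q).card : ℝ) ≤ k := by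
      exact_mod_cast (Finset.card_le_univ _).trans_eq (Fintype.card_fin k)
    have hcard0 : (0 : ℝ) < (shortest q).card := by
      exact_mod_cast Finset.card_pos.2 ⟨i, hi⟩
    calc (a / k) ^ (N + 1) * w (fun _ => n)
        = a / k * ((a / k) ^ N * w (fun _ => n)) := by ring
      _ ≤ a / k * w (q + Pi.single i 1) := by gcongr
      _ ≤ a / (shortest q).card * w (q + Pi.single i 1) := by
          have := hup i
          gcongr
      _ ≤ ∑ j ∈ shortest q, a / (shortest q).card * w (q + Pi.single j 1) :=
          Finset.single_le_sum (f := fun j => a / (shortest q).card * w (q + Pi.single j 1))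
            (fun j _ => mul_nonneg (by positivity) (hup j)) hi
      _ ≤ freeOp a m w q := le_add_of_nonneg_right (Finset.sum_nonneg fun j _ =>
          mul_nonneg (hm j) (h0 _ (by rw [total_sub_single]; omega)))
      _ ≤ w q := hsup q (by omega)

/-- An upper bound for the expected imbalance on first reaching level `l`. -/
noncomputable def barrier (x C : ℝ) (l : ℤ) (q : Fin k → ℤ) : ℝ :=
  x ^ (total q - l) * imbalance x q + C * (1 - x ^ (total q - l))

lemma barrier_of_total_eq (x C : ℝ) {l : ℤ} {q : Fin k → ℤ} (hq : total q = l) :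
    barrier x C l q = imbalance x q := by
  simp [barrier, hq]

lemma barrier_nonneg {x C : ℝ} (hx : 1 < x) (hC : 0 ≤ C) {l : ℤ} {q : Fin k → ℤ}
    (hq : total q ≤ l) : 0 ≤ barrier x C l q := by
  have h1 : x ^ (total q - l) ≤ 1 := zpow_le_one_of_nonpos₀ hx.le (by omega)
  have h2 : 0 ≤ x ^ (total q - l) := by positivity
  have h3 := imbalance_nonneg hx q
  have h4 : 0 ≤ 1 - x ^ (total q - l) := by linarith
  unfold barrier
  positivity

lemma barrier_le {x C y : ℝ} (hx : 1 < x) (hC : 0 ≤ C) {l : ℤ} {q : Fin k → ℤ}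
    (hq : x ^ (total q - l) ≤ y) : barrier x C l q ≤ y * imbalance x q + C := by
  have h2 : 0 ≤ x ^ (total q - l) := by positivity
  have h3 := imbalance_nonneg hx q
  have h4 : C * (1 - x ^ (total q - l)) ≤ C := mul_le_of_le_one_right hC (by linarith)
  unfold barrier
  gcongr

/-- A bounded subharmonic function is controlled by its values on a level. -/
lemma le_barrier_of_level (hk : 0 < k) (hm : ∀ i, 0 < m i)
    (hab : a + ∑ i, m i = 1) (hlt : ∑ i, m i < a) {x C : ℝ} (hx : 1 < x) (hC : 0 ≤ C)
    {l : ℤ} (hsup : ∀ q, freeOp a m (barrier x C l) q ≤ barrier x C l q)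
    {u : (Fin k → ℤ) → ℝ} {D : ℝ} (hD : ∀ q, u q ≤ D)
    (hu : ∀ q, total q < l → u q ≤ freeOp a m u q) {A B : ℝ} (hB : 0 ≤ B)
    (hlev : ∀ q, total q = l → u q ≤ A + B * imbalance x q) :
    ∀ q, total q ≤ l → u q ≤ A + B * barrier x C l q := by
  have key := maximum_principle (w := fun q => u q - (A + B * barrier x C l q)) (l := l)
    (B := D - A) hk hm hab hlt (fun q hq => ?_) (fun q hq => ?_) (fun q hq => ?_)
  · intro q hq
    have := key q hq
    linarith
  · have := mul_nonneg hB (barrier_nonneg (C := C) hx hC hq)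
    have := hD q
    linarith
  · rw [freeOp_sub, freeOp_add, freeOp_const hk hab, freeOp_const_mul]
    have := mul_le_mul_of_nonneg_left (hsup q) hB
    have := hu q hq
    linarith
  · rw [barrier_of_total_eq x C hq]
    have := hlev q hq
    linarith

lemma abs_sub_le_barrier_of_level (hk : 0 < k) (hm : ∀ i, 0 < m i)
    (hab : a + ∑ i, m i = 1) (hlt : ∑ i, m i < a) {x C : ℝ} (hx : 1 < x) (hC : 0 ≤ C)
    {l : ℤ} (hsup : ∀ q, freeOp a m (barrier x C l) q ≤ barrier x C l q)
    {u : (Fin k → ℤ) → ℝ} {D : ℝ} (hD : ∀ q, |u q| ≤ D)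
    (hu : ∀ q, total q < l → u q = freeOp a m u q) {A B c : ℝ} (hB : 0 ≤ B)
    (hlev : ∀ q, total q = l → |u q - c| ≤ A + B * imbalance x q) :
    ∀ q, total q ≤ l → |u q - c| ≤ A + B * barrier x C l q := by
  intro q hq
  rw [abs_le']
  constructor
  · refine le_barrier_of_level (u := fun q => u q - c) (D := D - c) hk hm hab hlt hx hC hsup
      (fun q => ?_) (fun q hq => ?_) hB (fun q hq => (abs_le'.1 (hlev q hq)).1) q hq
    · have := (abs_le.1 (hD q)).2; linarith
    · rw [freeOp_sub, freeOp_const hk hab, ← hu q hq]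
  · rw [neg_sub]
    refine le_barrier_of_level (u := fun q => c - u q) (D := D + c) hk hm hab hlt hx hC hsup
      (fun q => ?_) (fun q hq => ?_) hB (fun q hq => ?_) q hq
    · have := (abs_le.1 (hD q)).1; linarith
    · rw [freeOp_sub, freeOp_const hk hab, ← hu q hq]
    · have := (abs_le'.1 (hlev q hq)).2; rwa [neg_sub] at this

/-- Contraction of the weighted oscillation of bounded harmonic functions from level to level. -/
lemma exists_contraction (hk : 0 < k) (hm : ∀ i, 0 < m i)
    (hab : a + ∑ i, m i = 1) (hlt : ∑ i, m i < a) {x C : ℝ} (hk2 : 2 ≤ k) (hx : 1 < x)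
    (hC : (k : ℝ) ≤ C)
    (hsup : ∀ (l : ℤ) (q : Fin k → ℤ), freeOp a m (barrier x C l) q ≤ barrier x C l q) :
    ∃ (γ β : ℝ) (N : ℕ), 0 ≤ γ ∧ γ < 1 ∧ 0 < β ∧
      ∀ (u : (Fin k → ℤ) → ℝ) (D : ℝ) (n : ℤ) (c A : ℝ), (∀ q, |u q| ≤ D) →
        (∀ q, total q < k * n → u q = freeOp a m u q) → 0 ≤ A →
        (∀ q, total q = k * n → |u q - c| ≤ A * (1 + β * imbalance x q)) →
        ∃ c', ∀ q, total q = k * (n - N) → |u q - c'| ≤ γ * A * (1 + β * imbalance x q) := by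
  have : Nonempty (Fin k) := ⟨⟨0, hk⟩⟩
  have hb0 : 0 < ∑ i, m i := Finset.sum_pos (fun i _ => hm i) Finset.univ_nonempty
  have ha0 : 0 < a := hb0.trans hlt
  have hk1 : (1 : ℝ) ≤ k := by exact_mod_cast hk
  have hC0 : 0 < C := by linarith
  obtain ⟨B, hB⟩ := exists_le_of_imbalance_le hk2 hx (14 * C)
  obtain ⟨N₁, hN₁⟩ := pow_unbounded_of_one_lt 4 hx
  set N := max B N₁ with hN
  set p := (a / k) ^ (k * N) with hp
  have hp0 : 0 < p := by positivity
  have hp1 : p ≤ 1 := by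
    refine pow_le_one₀ (by positivity) ?_
    rw [div_le_one (by positivity)]; linarith
  set β := p / (4 * C) with hβ
  have hβ0 : 0 < β := by positivity
  have hβC : β * C = p / 4 := by rw [hβ]; field_simp
  have hβk : β * k ≤ p / 4 := by rw [← hβC]; gcongr
  refine ⟨1 - p / 4, β, N, by linarith, by linarith, hβ0, ?_⟩
  intro u D n c A hD hu hA hlev
  have hbar : ∀ q, total q ≤ k * n →
      |u q - c| ≤ A + A * β * barrier x C (k * n) q :=
    abs_sub_le_barrier_of_level hk hm hab hlt hx hC0.le (hsup _) hD hu (by positivity)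
      fun q hq => (hlev q hq).trans_eq (by ring)
  set y := u (fun _ => n) - c with hy
  have hf : total (fun _ : Fin k => n) = k * n := by simp [total]
  have hyA : |y| ≤ A * (1 + β * k) := by
    have := hlev _ hf
    rwa [imbalance_const] at this
  refine ⟨c + p * y, fun q hq => ?_⟩
  have hH : barrier x C (k * n) q ≤ 1 / 4 * imbalance x q + C := by
    refine barrier_le hx hC0.le ?_
    have h1 : total q - k * n = -((k * N : ℕ) : ℤ) := by push_cast; linarith
    rw [h1, zpow_neg, zpow_natCast, ← one_div]
    refine one_div_le_one_div_of_le (by norm_num) (hN₁.le.trans ?_)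
    refine pow_le_pow_right₀ hx.le ((le_max_right B N₁).trans ?_)
    exact Nat.le_mul_of_pos_left _ hk
  have hv := mul_nonneg hβ0.le (imbalance_nonneg hx q)
  have hqle : total q ≤ k * n := by
    rw [hq]; nlinarith [Int.natCast_nonneg N, Int.natCast_nonneg k]
  have hH' : A * β * barrier x C (k * n) q ≤ A * (β * imbalance x q / 4 + p / 4) := by
    rw [← hβC, mul_assoc]
    have := mul_le_mul_of_nonneg_left hH hβ0.le
    gcongr
    linarith
  rcases le_or_gt (imbalance x q) (14 * C) with hV | hV
  · have hqn : ∀ i, q i ≤ n := by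
      intro i
      have h1 := hB q hV i
      rw [hq] at h1
      have h2 : (B : ℤ) ≤ N := by exact_mod_cast le_max_left _ _
      have h3 : (k : ℤ) * q i ≤ k * n := by nlinarith [Int.natCast_nonneg k]
      exact le_of_mul_le_mul_left h3 (by exact_mod_cast hk)
    have hq' : total q = k * n - (k * N : ℕ) := by rw [hq]; push_cast; ring
    have hup := reach_const (w := fun q => A + A * β * barrier x C (k * n) q - (u q - c))
      hk ha0 (fun i => (hm i).le) (n := n)
      (fun q hq => by have := (abs_le.1 (hbar q hq)).2; linarith)
      (fun q hq => by
        rw [freeOp_sub, freeOp_add, freeOp_sub, freeOp_const hk hab, freeOp_const hk hab,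
          freeOp_const_mul, ← hu q hq]
        have := mul_le_mul_of_nonneg_left (hsup (k * n) q) (mul_nonneg hA hβ0.le)
        linarith) (k * N) q hq' hqn
    have hdown := reach_const (w := fun q => A + A * β * barrier x C (k * n) q + (u q - c))
      hk ha0 (fun i => (hm i).le) (n := n)
      (fun q hq => by have := (abs_le.1 (hbar q hq)).1; linarith)
      (fun q hq => by
        rw [freeOp_add, freeOp_add, freeOp_sub, freeOp_const hk hab, freeOp_const hk hab,
          freeOp_const_mul, ← hu q hq]
        have := mul_le_mul_of_nonneg_left (hsup (k * n) q) (mul_nonneg hA hβ0.le)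
        linarith) (k * N) q hq' hqn
    simp only [barrier_of_total_eq x C hf, imbalance_const, ← hp, ← hy] at hup hdown
    have h5 : 0 ≤ p * (A * β * k) := by positivity
    have h6 : A * (1 + (β * imbalance x q / 4 + p / 4) - p)
        ≤ (1 - p / 4) * A * (1 + β * imbalance x q) := by
      rw [mul_comm (1 - p / 4) A, mul_assoc]
      gcongr
      nlinarith
    rw [abs_le']
    constructor <;> nlinarith
  · have h1 : 14 * (p / 4) ≤ β * imbalance x q := by
      rw [← hβC]
      have := mul_le_mul_of_nonneg_left hV.le hβ0.le
      linarith
    have h2 : |u q - (c + p * y)| ≤ |u q - c| + p * |y| := by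
      rw [← abs_of_pos hp0, ← abs_mul, abs_of_pos hp0, ← sub_sub]
      exact abs_sub _ _
    have h3 : p * |y| ≤ p * (A * (1 + p / 4)) := by
      gcongr
      exact hyA.trans (by gcongr)
    have h4 : A * (1 + (β * imbalance x q / 4 + p / 4) + p * (1 + p / 4))
        ≤ (1 - p / 4) * A * (1 + β * imbalance x q) := by
      rw [mul_comm (1 - p / 4) A, mul_assoc]
      gcongr
      nlinarith
    have := hbar q hqle
    linarith

/-- A bounded function that is harmonic far below converges along the diagonal, to a limit that
does not depend on the starting point. -/
lemma exists_tendsto_of_harmonic (hk2 : 2 ≤ k) (hm : ∀ i, 0 < m i)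
    (hab : a + ∑ i, m i = 1) (hlt : ∑ i, m i < a) {u : (Fin k → ℤ) → ℝ} {D : ℝ} {n₀ : ℤ}
    (hD : ∀ q, |u q| ≤ D) (hu : ∀ q, total q < k * n₀ → u q = freeOp a m u q) :
    ∃ c, ∀ q : Fin k → ℤ, Tendsto (fun n : ℕ => u (fun i => q i - n)) atTop (𝓝 c) := by
  have hk : 0 < k := by omega
  obtain ⟨x, C, hx, hC, hsup⟩ := exists_superharmonic hk2 hm hab hlt
  obtain ⟨γ, β, N, hγ0, hγ1, hβ, hcon⟩ :=
    exists_contraction hk hm hab hlt hk2 hx hC hsup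
  have hC0 : 0 ≤ C := (Nat.cast_nonneg k).trans hC
  have hD0 : 0 ≤ D := (abs_nonneg _).trans (hD 0)
  have hdec : ∀ j : ℕ, (k : ℤ) * (n₀ - j * N) ≤ k * n₀ := fun j =>
    mul_le_mul_of_nonneg_left (sub_le_self _ (by positivity)) (by positivity)
  have hlev : ∀ j : ℕ, ∃ c, ∀ q, total q = k * (n₀ - j * N) →
      |u q - c| ≤ γ ^ j * D * (1 + β * imbalance x q) := by
    intro j
    induction j with
    | zero =>
      refine ⟨0, fun q _ => ?_⟩
      have := mul_nonneg hD0 (mul_nonneg hβ.le (imbalance_nonneg hx q))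
      have := hD q
      simp only [sub_zero, pow_zero, one_mul]
      linarith
    | succ j ih =>
      obtain ⟨c, hc⟩ := ih
      obtain ⟨c', hc'⟩ := hcon u D (n₀ - j * N) c (γ ^ j * D) hD
        (fun q hq => hu q (hq.trans_le (hdec j))) (by positivity) hc
      refine ⟨c', fun q hq => (hc' q ?_).trans_eq (by ring)⟩
      rw [hq]; push_cast; ring
  have hall : ∀ j : ℕ, ∃ c, ∀ q, total q ≤ k * (n₀ - j * N) →
      |u q - c| ≤ γ ^ j * D * (1 + β * (imbalance x q + C)) := by
    intro j
    obtain ⟨c, hc⟩ := hlev j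
    refine ⟨c, fun q hq => ?_⟩
    have h0 : 0 ≤ γ ^ j * D * β := by positivity
    have h1 := abs_sub_le_barrier_of_level hk hm hab hlt hx hC0 (hsup _) hD
      (fun q hq => hu q (hq.trans_le (hdec j))) h0
      (fun q hq => (hc q hq).trans_eq (by ring : _ = γ ^ j * D + γ ^ j * D * β * imbalance x q))
      q hq
    have h2 : barrier x C (k * (n₀ - j * N)) q ≤ 1 * imbalance x q + C :=
      barrier_le hx hC0 (zpow_le_one_of_nonpos₀ hx.le (by linarith))
    have := mul_le_mul_of_nonneg_left h2 h0
    linarith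
  have hclose : ∀ q q' : Fin k → ℤ, ∀ ε > 0, ∃ n₁ : ℕ, ∀ n ≥ n₁, ∀ n' ≥ n₁,
      |u (fun i => q i - n) - u (fun i => q' i - n')| < ε := by
    intro q q' ε hε
    set W := D * (1 + β * (imbalance x q + C)) + D * (1 + β * (imbalance x q' + C)) with hW
    obtain ⟨j, hj⟩ : ∃ j : ℕ, γ ^ j * W < ε := by
      have : Tendsto (fun j : ℕ => γ ^ j * W) atTop (𝓝 (0 * W)) :=
        (tendsto_pow_atTop_nhds_zero_of_lt_one hγ0 hγ1).mul_const W
      rw [zero_mul] at this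
      exact (this.eventually (gt_mem_nhds hε)).exists
    obtain ⟨c, hc⟩ := hall j
    have hlow : ∀ q : Fin k → ℤ, ∀ n : ℕ, (|total q| + |n₀ - j * N|).toNat ≤ n →
        total (fun i => q i - (n : ℤ)) ≤ k * (n₀ - j * N) := by
      intro q n hn
      rw [total_sub_const]
      have h1 : |total q| + |n₀ - j * N| ≤ n := by omega
      have h2 := le_abs_self (total q)
      have h3 := neg_abs_le (n₀ - j * N)
      have h4 : (1 : ℤ) ≤ k := by exact_mod_cast hk
      nlinarith [abs_nonneg (total q)]
    refine ⟨max (|total q| + |n₀ - j * N|).toNat (|total q'| + |n₀ - j * N|).toNat,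
      fun n hn n' hn' => ?_⟩
    have h1 := hc _ (hlow q n ((le_max_left _ _).trans hn))
    have h2 := hc _ (hlow q' n' ((le_max_right _ _).trans hn'))
    rw [imbalance_sub_const] at h1 h2
    calc _ ≤ |u (fun i => q i - n) - c| + |u (fun i => q' i - n') - c| := by
          rw [abs_sub_comm (u fun i => q' i - n') c]; exact abs_sub_le _ _ _
      _ ≤ γ ^ j * W := by rw [hW]; linarith
      _ < ε := hj
  have hcauchy : CauchySeq (fun n : ℕ => u (fun i => (0 : Fin k → ℤ) i - n)) := by
    refine Metric.cauchySeq_iff.2 fun ε hε => ?_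
    obtain ⟨n₁, h⟩ := hclose 0 0 ε hε
    exact ⟨n₁, fun n hn n' hn' => by rw [Real.dist_eq]; exact h n hn n' hn'⟩
  obtain ⟨c, hc⟩ := cauchySeq_tendsto_of_complete hcauchy
  refine ⟨c, fun q => ?_⟩
  have h0 : Tendsto (fun n : ℕ => u (fun i => q i - n) - u (fun i => (0 : Fin k → ℤ) i - n))
      atTop (𝓝 0) := by
    refine Metric.tendsto_atTop.2 fun ε hε => ?_
    obtain ⟨n₁, h⟩ := hclose q 0 ε hε
    exact ⟨n₁, fun n hn => by rw [Real.dist_eq, sub_zero]; exact h n hn n hn⟩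
  simpa using h0.add hc

lemma pos_of_superharmonic (hm : ∀ i, 0 < m i) {u : (Fin k → ℤ) → ℝ} (ha : 0 ≤ a)
    (h0 : ∀ q, 0 ≤ u q) (hsup : ∀ q, freeOp a m u q ≤ u q) {t : Fin k → ℤ} (ht : 0 < u t) :
    ∀ (N : ℕ) (q : Fin k → ℤ), (∀ i, t i ≤ q i) → total q = total t + N → 0 < u q := by
  intro N
  induction N with
  | zero =>
    intro q hq htot
    have h1 : ∑ i, (q i - t i) = 0 := by
      simp only [total] at htot
      rw [Finset.sum_sub_distrib, htot]; simp
    rw [Finset.sum_eq_zero_iff_of_nonneg fun i _ => sub_nonneg.2 (hq i)] at h1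
    have : q = t := by
      ext i; have := h1 i (Finset.mem_univ i); omega
    rwa [this]
  | succ N ih =>
    intro q hq htot
    push_cast at htot
    obtain ⟨i, hi⟩ : ∃ i, t i < q i := by
      by_contra! hcon
      have : q = t := by ext i; exact le_antisymm (hcon i) (hq i)
      rw [this] at htot; omega
    have hpos := ih (q - Pi.single i 1) (fun j => by
      by_cases hj : j = i
      · subst hj; simp; omega
      · simpa [hj] using hq j) (by rw [total_sub_single]; omega)
    calc 0 < m i * u (q - Pi.single i 1) := mul_pos (hm i) hpos
      _ ≤ ∑ j, m j * u (q - Pi.single j 1) :=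
        Finset.single_le_sum (f := fun j => m j * u (q - Pi.single j 1))
          (fun j _ => mul_nonneg (hm j).le (h0 _)) (Finset.mem_univ i)
      _ ≤ freeOp a m u q := le_add_of_nonneg_left
        (Finset.sum_nonneg fun j _ => mul_nonneg (by positivity) (h0 _))
      _ ≤ u q := hsup q

lemma limit_pos_of_superharmonic (hk2 : 2 ≤ k) (hm : ∀ i, 0 < m i)
    (hab : a + ∑ i, m i = 1) (hlt : ∑ i, m i < a) {u : (Fin k → ℤ) → ℝ} {c : ℝ}
    (h0 : ∀ q, 0 ≤ u q) (hsup : ∀ q, freeOp a m u q ≤ u q) {t : Fin k → ℤ} (ht : 0 < u t)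
    (hc : Tendsto (fun n : ℕ => u (fun i => (0 : Fin k → ℤ) i - n)) atTop (𝓝 c)) : 0 < c := by
  have hk : 0 < k := by omega
  have : Nonempty (Fin k) := ⟨⟨0, hk⟩⟩
  have hb0 : 0 < ∑ i, m i := Finset.sum_pos (fun i _ => hm i) Finset.univ_nonempty
  have ha0 : 0 < a := hb0.trans hlt
  have hk1 : (1 : ℝ) ≤ k := by exact_mod_cast hk
  obtain ⟨x, C, hx, hC, hH⟩ := exists_superharmonic hk2 hm hab hlt
  have hC0 : 0 < C := by linarith
  obtain ⟨B, hB⟩ := exists_le_of_imbalance_le hk2 hx (4 * C)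
  set n : ℤ := ∑ i, |t i| with hn
  have htn : ∀ i, t i ≤ n := fun i => (le_abs_self _).trans
    (Finset.single_le_sum (f := fun i => |t i|) (fun _ _ => abs_nonneg _) (Finset.mem_univ i))
  have hfpos : 0 < u (fun _ => n) := by
    have hle : total t ≤ total (fun _ : Fin k => n) := Finset.sum_le_sum fun i _ => htn i
    exact pos_of_superharmonic hm ha0.le h0 hsup ht
      (total (fun _ : Fin k => n) - total t).toNat _ htn (by omega)
  set δ := (a / k) ^ (k * B) * u (fun _ => n) with hδ
  have hδ0 : 0 < δ := by positivity
  have hlev : ∀ q : Fin k → ℤ, total q = k * (n - B) →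
      -u q ≤ -δ + δ / (4 * C) * imbalance x q := by
    intro q hq
    rcases le_or_gt (imbalance x q) (4 * C) with hV | hV
    · have hqn : ∀ i, q i ≤ n := by
        intro i
        have h1 := hB q hV i
        rw [hq] at h1
        exact le_of_mul_le_mul_left (by linarith : (k : ℤ) * q i ≤ k * n) (by exact_mod_cast hk)
      have := reach_const (n := n) hk ha0 (fun i => (hm i).le) (fun q _ => h0 q)
        (fun q _ => hsup q) (k * B) q (by rw [hq]; push_cast; ring) hqn
      have h2 : 0 ≤ δ / (4 * C) * imbalance x q :=
        mul_nonneg (by positivity) (imbalance_nonneg hx q)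
      linarith
    · have h1 : δ / (4 * C) * (4 * C) ≤ δ / (4 * C) * imbalance x q := by gcongr
      rw [div_mul_cancel₀ _ (by positivity)] at h1
      have := h0 q
      linarith
  have hbelow := le_barrier_of_level (u := fun q => -u q) (D := 0) hk hm hab hlt hx hC0.le
    (hH (k * (n - B))) (fun q => neg_nonpos.2 (h0 q))
    (fun q _ => by
      have h1 := freeOp_const_mul (a := a) (m := m) (-1) u q
      have h2 := hsup q
      simp only [neg_one_mul] at h1
      rw [h1]; linarith)
    (by positivity : 0 ≤ δ / (4 * C)) hlev
  have hhalf : 0 < δ / 2 := by positivity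
  refine hhalf.trans_le (ge_of_tendsto hc ?_)
  filter_upwards [eventually_ge_atTop (n - B).natAbs] with j hj
  have hconst : (fun i => (0 : Fin k → ℤ) i - (j : ℤ)) = fun _ => (-j : ℤ) := by
    ext i; simp
  have htot : total (fun i => (0 : Fin k → ℤ) i - (j : ℤ)) ≤ k * (n - B) := by
    rw [total_sub_const]
    simp only [total, Pi.zero_apply, Finset.sum_const_zero]
    have : -(j : ℤ) ≤ n - B := by omega
    nlinarith [Int.natCast_nonneg k]
  have h1 := hbelow _ htot
  have h2 : barrier x C (k * (n - B)) (fun i => (0 : Fin k → ℤ) i - (j : ℤ))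
      ≤ 1 * imbalance x (fun i => (0 : Fin k → ℤ) i - (j : ℤ)) + C :=
    barrier_le hx hC0.le (zpow_le_one_of_nonpos₀ hx.le (by linarith))
  rw [hconst, imbalance_const] at h2
  rw [hconst] at h1 ⊢
  have h3 : δ / (4 * C) * barrier x C (k * (n - B)) (fun _ : Fin k => (-j : ℤ))
      ≤ δ / (4 * C) * (2 * C) := by
    gcongr; linarith
  have h4 : δ / (4 * C) * (2 * C) = δ / 2 := by field_simp; norm_num
  linarith

end FreeWalk

/-- The action of the transition matrix `jsqP` on a function. -/
noncomputable def stepOp (k : ℕ) (lam : ℝ) (μ : Fin k → ℝ) (g : ℕ × (Fin k → ℕ) → ℝ)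
    (s : ℕ × (Fin k → ℕ)) : ℝ :=
  (if (zeroSet k s.2).card = 1 then lam * g (s.1 + 1, fun j => s.2 j - 1)
    else ∑ i ∈ zeroSet k s.2,
      lam / (zeroSet k s.2).card * g (s.1, Function.update s.2 i 1))
  + (∑ j ∈ (zeroSet k s.2)ᶜ, μ j * g (s.1, Function.update s.2 j (s.2 j - 1)))
  + (∑ i ∈ zeroSet k s.2,
      μ i * g (if s.1 = 0 then s else (s.1 - 1, fun j => if j = i then 0 else s.2 j + 1)))

/-- The vector of queue lengths of a state. -/
def queues {k : ℕ} (s : ℕ × (Fin k → ℕ)) : Fin k → ℤ := fun i => s.1 + s.2 i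

section Stationary

variable {k : ℕ} {lam : ℝ} {μ : Fin k → ℝ}

lemma hasSum_jsqP_mul (g : ℕ × (Fin k → ℕ) → ℝ) (s : ℕ × (Fin k → ℕ)) :
    HasSum (fun s' => jsqP k lam μ s s' * g s') (stepOp k lam μ g s) := by
  have key : ∀ (x : ℕ × (Fin k → ℕ)) (c : ℝ),
      HasSum (fun s' => (if s' = x then c else 0) * g s') (c * g x) := by
    intro x c
    convert hasSum_single (f := fun s' => (if s' = x then c else 0) * g s') x ?_ using 1
    · simp
    · intro s' hs'; simp [hs']
  unfold jsqP stepOp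
  simp only [add_mul, Finset.sum_mul]
  refine (HasSum.add ?_ (hasSum_sum fun j _ => key _ _)).add (hasSum_sum fun j _ => key _ _)
  split_ifs with h
  · exact key _ _
  · simp only [Finset.sum_mul]
    exact hasSum_sum fun j _ => key _ _

lemma jsqP_nonneg (hlam : 0 ≤ lam) (hμ : ∀ i, 0 ≤ μ i) (s s' : ℕ × (Fin k → ℕ)) :
    0 ≤ jsqP k lam μ s s' := by
  unfold jsqP
  refine add_nonneg (add_nonneg ?_ ?_) ?_
  · split_ifs
    · exact hlam
    · exact le_rfl
    · exact Finset.sum_nonneg fun i _ => by split_ifs <;> positivity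
  · exact Finset.sum_nonneg fun i _ => by split_ifs <;> simp [hμ]
  · exact Finset.sum_nonneg fun i _ => by split_ifs <;> simp [hμ]

lemma stepOp_mono (hlam : 0 ≤ lam) (hμ : ∀ i, 0 ≤ μ i) {f g : ℕ × (Fin k → ℕ) → ℝ}
    (h : ∀ s, f s ≤ g s) (s : ℕ × (Fin k → ℕ)) :
    stepOp k lam μ f s ≤ stepOp k lam μ g s :=
  hasSum_le (fun s' => mul_le_mul_of_nonneg_left (h s') (jsqP_nonneg hlam hμ s s'))
    (hasSum_jsqP_mul f s) (hasSum_jsqP_mul g s)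

lemma stepOp_const_le (hlam : 0 ≤ lam) (hnorm : lam + ∑ i, μ i = 1) {c : ℝ} (hc : 0 ≤ c)
    (s : ℕ × (Fin k → ℕ)) : stepOp k lam μ (fun _ => c) s ≤ c := by
  have h1 : (if (zeroSet k s.2).card = 1 then lam * c
      else ∑ i ∈ zeroSet k s.2, lam / (zeroSet k s.2).card * c) ≤ lam * c := by
    split_ifs with h
    · exact le_rfl
    · rw [Finset.sum_const, nsmul_eq_mul]
      rcases eq_or_ne ((zeroSet k s.2).card : ℝ) 0 with h0 | h0
      · rw [h0, zero_mul]; positivity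
      · refine le_of_eq ?_
        field_simp
  have h2 := Finset.sum_add_sum_compl (zeroSet k s.2) μ
  calc _ ≤ lam * c + (∑ i ∈ (zeroSet k s.2)ᶜ, μ i * c) + ∑ i ∈ zeroSet k s.2, μ i * c :=
        add_le_add (add_le_add h1 le_rfl) le_rfl
    _ = (lam + ∑ i, μ i) * c := by rw [← h2, ← Finset.sum_mul, ← Finset.sum_mul]; ring
    _ = c := by rw [hnorm, one_mul]

/-- Invariance of the stationary distribution, tested against bounded functions. -/
lemma stationary_integral (hlam : 0 ≤ lam) (hμ : ∀ i, 0 ≤ μ i) (hnorm : lam + ∑ i, μ i = 1)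
    {π : ℕ × (Fin k → ℕ) → ℝ} (hπnn : ∀ s, 0 ≤ π s) (hπsum : Summable π)
    (hπstat : ∀ s', (∑' s, π s * jsqP k lam μ s s') = π s')
    {g : ℕ × (Fin k → ℕ) → ℝ} {N : ℝ} (hg : ∀ s, |g s| ≤ N) :
    HasSum (fun s => π s * stepOp k lam μ g s) (∑' s, π s * g s) := by
  have hrow : ∀ s, HasSum (fun s' => π s * jsqP k lam μ s s')
      (π s * stepOp k lam μ (fun _ => 1) s) := fun s => by
    simpa using (hasSum_jsqP_mul (lam := lam) (μ := μ) (fun _ => 1) s).mul_left (π s)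
  have h0 : Summable (fun p : (ℕ × (Fin k → ℕ)) × (ℕ × (Fin k → ℕ)) =>
      π p.1 * jsqP k lam μ p.1 p.2) := by
    refine (summable_prod_of_nonneg fun p =>
      mul_nonneg (hπnn _) (jsqP_nonneg hlam hμ _ _)).2 ⟨fun s => (hrow s).summable, ?_⟩
    refine Summable.of_nonneg_of_le
      (fun s => tsum_nonneg fun s' => mul_nonneg (hπnn _) (jsqP_nonneg hlam hμ _ _))
      (fun s => ?_) hπsum
    rw [(hrow s).tsum_eq]
    exact mul_le_of_le_one_right (hπnn s) (stepOp_const_le hlam hnorm zero_le_one s)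
  have h1 : Summable (fun p : (ℕ × (Fin k → ℕ)) × (ℕ × (Fin k → ℕ)) =>
      π p.1 * jsqP k lam μ p.1 p.2 * g p.2) := by
    refine Summable.of_norm_bounded (h0.mul_right N) fun p => ?_
    have := mul_nonneg (hπnn p.1) (jsqP_nonneg hlam hμ p.1 p.2)
    rw [norm_mul, Real.norm_of_nonneg this]
    exact mul_le_mul_of_nonneg_left (hg _) this
  have hrow' : ∀ s, HasSum (fun s' => π s * jsqP k lam μ s s' * g s')
      (π s * stepOp k lam μ g s) := fun s => by
    simpa only [mul_assoc] using (hasSum_jsqP_mul (lam := lam) (μ := μ) g s).mul_left (π s)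
  have h2 := h1.hasSum.prod_fiberwise hrow'
  have h3 : ∑' p : (ℕ × (Fin k → ℕ)) × (ℕ × (Fin k → ℕ)),
      π p.1 * jsqP k lam μ p.1 p.2 * g p.2 = ∑' s, π s * g s := by
    rw [h1.tsum_prod]
    refine (Summable.tsum_comm (f := fun s s' => π s * jsqP k lam μ s s' * g s') h1).symm.trans ?_
    exact tsum_congr fun s' => by rw [tsum_mul_right, hπstat]
  rwa [h3] at h2

/-- Foster's criterion for integrability. -/
lemma summable_of_drift (hlam : 0 ≤ lam) (hμ : ∀ i, 0 ≤ μ i) (hnorm : lam + ∑ i, μ i = 1)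
    {π : ℕ × (Fin k → ℕ) → ℝ} (hπnn : ∀ s, 0 ≤ π s) (hπsum : HasSum π 1)
    (hπstat : ∀ s', (∑' s, π s * jsqP k lam μ s s') = π s')
    {V W : ℕ × (Fin k → ℕ) → ℝ} {b : ℝ} (hb : 0 ≤ b) (hV : ∀ s, 0 ≤ V s) (hW : ∀ s, 0 ≤ W s)
    (hdrift : ∀ s, π s ≠ 0 → stepOp k lam μ V s + W s ≤ V s + b) :
    Summable (fun s => π s * W s) := by
  refine summable_of_sum_le (c := b) (fun s => mul_nonneg (hπnn s) (hW s)) fun F => ?_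
  set N := ∑ s ∈ F, V s with hN
  have hN0 : 0 ≤ N := Finset.sum_nonneg fun s _ => hV s
  set g : ℕ × (Fin k → ℕ) → ℝ := fun s => min (V s) N with hg
  have hgN : ∀ s, |g s| ≤ N := fun s => by
    rw [abs_of_nonneg (le_min (hV s) hN0)]; exact min_le_right _ _
  have hPV : ∀ s, stepOp k lam μ g s ≤ stepOp k lam μ V s :=
    stepOp_mono hlam hμ fun s => min_le_left _ _
  have hPN : ∀ s, stepOp k lam μ g s ≤ N := fun s =>
    (stepOp_mono hlam hμ (fun s => min_le_right _ _) s).trans (stepOp_const_le hlam hnorm hN0 s)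
  have hle : ∀ s, V s ≤ N → π s * W s ≤ π s * g s - π s * stepOp k lam μ g s + π s * b := by
    intro s hs
    rcases eq_or_ne (π s) 0 with h0 | h0
    · simp [h0]
    · have h1 := hdrift s h0
      have h2 := hPV s
      have h3 : g s = V s := min_eq_left hs
      rw [← mul_sub, ← mul_add]
      exact mul_le_mul_of_nonneg_left (by linarith) (hπnn s)
  have hnn : ∀ s, 0 ≤ π s * g s - π s * stepOp k lam μ g s + π s * b := by
    intro s
    rcases le_or_gt (V s) N with hs | hs
    · exact (mul_nonneg (hπnn s) (hW s)).trans (hle s hs)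
    · have h3 : g s = N := min_eq_right hs.le
      rw [← mul_sub, ← mul_add]
      exact mul_nonneg (hπnn s) (by linarith [hPN s])
  have hsum : Summable (fun s => π s * g s) := by
    refine Summable.of_norm_bounded (hπsum.summable.mul_right N) fun s => ?_
    rw [norm_mul, Real.norm_of_nonneg (hπnn s)]
    exact mul_le_mul_of_nonneg_left (hgN s) (hπnn s)
  have htot := (hsum.hasSum.sub
    (stationary_integral hlam hμ hnorm hπnn hπsum.summable hπstat hgN)).add (hπsum.mul_right b)
  calc _ ≤ ∑ s ∈ F, (π s * g s - π s * stepOp k lam μ g s + π s * b) :=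
        Finset.sum_le_sum fun s hs =>
          hle s (Finset.single_le_sum (f := V) (fun s _ => hV s) hs)
    _ ≤ _ := sum_le_hasSum F (fun s _ => hnn s) htot
    _ = b := by ring

lemma shortest_queues {s : ℕ × (Fin k → ℕ)} (hs : ∃ i, s.2 i = 0) :
    shortest (queues s) = zeroSet k s.2 := by
  obtain ⟨i₀, hi₀⟩ := hs
  ext i
  rw [shortest, zeroSet, Finset.mem_filter, Finset.mem_filter]
  simp only [queues, Finset.mem_univ, true_and]
  constructor
  · intro h; have := h i₀; omega
  · intro h j; omega

lemma queues_injOn {s t : ℕ × (Fin k → ℕ)} (hs : ∃ i, s.2 i = 0) (ht : ∃ i, t.2 i = 0)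
    (h : queues s = queues t) : s = t := by
  obtain ⟨i, hi⟩ := hs
  obtain ⟨j, hj⟩ := ht
  have hall : ∀ l, (s.1 : ℤ) + s.2 l = t.1 + t.2 l := fun l => congrFun h l
  have h1 : s.1 = t.1 := by
    have := hall i
    have := hall j
    omega
  refine Prod.ext h1 (funext fun l => ?_)
  have := hall l
  omega

/-- The transition operator in terms of queue lengths. -/
lemma stepOp_queues (G : (Fin k → ℤ) → ℝ) {s : ℕ × (Fin k → ℕ)} (hs : ∃ i, s.2 i = 0) :
    stepOp k lam μ (fun s => G (queues s)) s
      = freeOp lam μ G (queues s) + if s.1 = 0 then ∑ i ∈ zeroSet k s.2,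
          μ i * (G (queues s) - G (queues s - Pi.single i 1)) else 0 := by
  have h1 : (if (zeroSet k s.2).card = 1 then
        lam * G (queues (s.1 + 1, fun j => s.2 j - 1))
      else ∑ i ∈ zeroSet k s.2,
        lam / (zeroSet k s.2).card * G (queues (s.1, Function.update s.2 i 1)))
      = ∑ i ∈ zeroSet k s.2, lam / (zeroSet k s.2).card * G (queues s + Pi.single i 1) := by
    split_ifs with h
    · obtain ⟨i, hi⟩ := Finset.card_eq_one.1 h
      rw [hi, Finset.sum_singleton, Finset.card_singleton, Nat.cast_one, div_one]
      congr 2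
      have hmem : ∀ j, s.2 j = 0 ↔ j = i := fun j => by
        have : j ∈ zeroSet k s.2 ↔ j = i := by rw [hi, Finset.mem_singleton]
        simpa [zeroSet] using this
      ext j
      by_cases hj : j = i
      · subst hj
        simp [queues, (hmem j).2 rfl]
      · have := mt (hmem j).1 hj
        simp only [queues, Pi.add_apply, Pi.single_eq_of_ne hj]
        omega
    · refine Finset.sum_congr rfl fun i hi => ?_
      have hi0 : s.2 i = 0 := by simpa [zeroSet] using hi
      congr 2
      ext j
      by_cases hj : j = i
      · subst hj; simp [queues, hi0]
      · simp [queues, hj]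
  have h2 : ∑ j ∈ (zeroSet k s.2)ᶜ, μ j * G (queues (s.1, Function.update s.2 j (s.2 j - 1)))
      = ∑ j ∈ (zeroSet k s.2)ᶜ, μ j * G (queues s - Pi.single j 1) := by
    refine Finset.sum_congr rfl fun i hi => ?_
    have hi0 : s.2 i ≠ 0 := by simpa [zeroSet] using hi
    congr 2
    ext j
    by_cases hj : j = i
    · subst hj; simp [queues]; omega
    · simp [queues, hj]
  have h3 : ∑ i ∈ zeroSet k s.2, μ i * G (queues
        (if s.1 = 0 then s else (s.1 - 1, fun j => if j = i then 0 else s.2 j + 1)))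
      = ∑ i ∈ zeroSet k s.2, μ i * G (queues s - Pi.single i 1)
        + if s.1 = 0 then ∑ i ∈ zeroSet k s.2,
          μ i * (G (queues s) - G (queues s - Pi.single i 1)) else 0 := by
    split_ifs with h
    · rw [← Finset.sum_add_distrib]
      exact Finset.sum_congr rfl fun i _ => by ring
    · rw [add_zero]
      refine Finset.sum_congr rfl fun i hi => ?_
      have hi0 : s.2 i = 0 := by simpa [zeroSet] using hi
      congr 2
      ext j
      by_cases hj : j = i
      · subst hj; simp [queues, hi0]; omega
      · simp [queues, hj]; omega
  have h4 := Finset.sum_add_sum_compl (zeroSet k s.2)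
    (fun i => μ i * G (queues s - Pi.single i 1))
  unfold stepOp freeOp
  rw [h1, h2, h3, shortest_queues hs, ← h4]
  ring

/-- A product Lyapunov function that dominates `r ^ total q`. -/
noncomputable def prodWeight {k : ℕ} (r C : ℝ) (q : Fin k → ℤ) : ℝ := ∏ i, (C + r ^ q i)

/-- The relative weight of the exponential part of a factor of `prodWeight`. -/
noncomputable def expShare (r C : ℝ) (n : ℤ) : ℝ := r ^ n / (C + r ^ n)

lemma prodWeight_pos {r C : ℝ} (hr : 0 < r) (hC : 0 < C) (q : Fin k → ℤ) :
    0 < prodWeight r C q :=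
  Finset.prod_pos fun _ _ => by positivity

lemma zpow_total_le_prodWeight {r C : ℝ} (hr : 0 < r) (hC : 0 < C) (q : Fin k → ℤ) :
    r ^ total q ≤ prodWeight r C q := by
  have : r ^ total q = ∏ i, r ^ q i := by
    unfold total
    induction (Finset.univ : Finset (Fin k)) using Finset.induction_on with
    | empty => simp
    | insert i t hi ih => rw [Finset.sum_insert hi, Finset.prod_insert hi, zpow_add₀ hr.ne', ih]
  rw [this]
  exact Finset.prod_le_prod (fun _ _ => by positivity) fun _ _ => by linarith

lemma prodWeight_add_single {r C : ℝ} (hr : 0 < r) (hC : 0 < C) (q : Fin k → ℤ) (i : Fin k)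
    (d : ℤ) : prodWeight r C (q + Pi.single i d)
      = prodWeight r C q * (1 + (r ^ d - 1) * expShare r C (q i)) := by
  have h0 : C + r ^ q i ≠ 0 := by positivity
  unfold prodWeight expShare
  rw [← Finset.mul_prod_erase _ _ (Finset.mem_univ i),
    ← Finset.mul_prod_erase _ (fun j => C + r ^ q j) (Finset.mem_univ i)]
  have h1 : ∏ j ∈ Finset.univ.erase i, (C + r ^ (q + Pi.single i d : Fin k → ℤ) j)
      = ∏ j ∈ Finset.univ.erase i, (C + r ^ q j) :=
    Finset.prod_congr rfl fun j hj => by simp [Finset.ne_of_mem_erase hj]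
  rw [h1, Pi.add_apply, Pi.single_eq_same, zpow_add₀ hr.ne']
  field_simp
  ring

lemma expShare_nonneg {r C : ℝ} (hr : 0 < r) (hC : 0 < C) (n : ℤ) : 0 ≤ expShare r C n := by
  unfold expShare; positivity

lemma expShare_mono {r C : ℝ} (hr : 1 < r) (hC : 0 < C) {n n' : ℤ} (h : n ≤ n') :
    expShare r C n ≤ expShare r C n' := by
  have hr0 : 0 < r := by linarith
  have h1 : r ^ n ≤ r ^ n' := zpow_le_zpow_right₀ hr.le h
  unfold expShare
  rw [div_le_div_iff₀ (by positivity) (by positivity)]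
  nlinarith

lemma expShare_zero (r C : ℝ) : expShare r C 0 = 1 / (C + 1) := by simp [expShare]

lemma half_le_expShare {r C : ℝ} (hr : 0 < r) (hC : 0 < C) {n : ℤ} (h : C ≤ r ^ n) :
    1 / 2 ≤ expShare r C n := by
  unfold expShare
  rw [div_le_div_iff₀ (by positivity) (by positivity)]
  linarith

lemma freeOp_prodWeight (hnorm : lam + ∑ i, μ i = 1) {r C : ℝ} (hr : 1 < r) (hC : 0 < C)
    (hlamr : lam * r = ∑ i, μ i) {s : ℕ × (Fin k → ℕ)} (hs : ∃ i, s.2 i = 0) :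
    freeOp lam μ (prodWeight r C) (queues s) = prodWeight r C (queues s) *
      (1 + (1 - r⁻¹) * ∑ i, μ i * (expShare r C s.1 - expShare r C (queues s i))) := by
  have hr0 : 0 < r := by linarith
  have hk : 0 < k := by obtain ⟨i, -⟩ := hs; exact i.pos
  have h1 : ∀ i ∈ shortest (queues s), lam / (shortest (queues s)).card *
      prodWeight r C (queues s + Pi.single i 1) = lam / (shortest (queues s)).card *
        (prodWeight r C (queues s) * (1 + (r - 1) * expShare r C s.1)) := by
    intro i hi
    rw [shortest_queues hs] at hi
    have hi0 : s.2 i = 0 := by simpa [zeroSet] using hi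
    have : queues s i = s.1 := by simp [queues, hi0]
    rw [prodWeight_add_single hr0 hC, this, zpow_one]
  have h2 : ∀ i, μ i * prodWeight r C (queues s - Pi.single i 1)
      = prodWeight r C (queues s) * (μ i - (1 - r⁻¹) * (μ i * expShare r C (queues s i))) := by
    intro i
    rw [sub_eq_add_neg, ← Pi.single_neg, prodWeight_add_single hr0 hC, zpow_neg_one]
    ring
  unfold freeOp
  rw [Finset.sum_congr rfl h1, sum_shortest_weight hk, Finset.sum_congr rfl fun i _ => h2 i,
    ← Finset.mul_sum, Finset.sum_sub_distrib, ← Finset.mul_sum]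
  simp only [mul_sub, Finset.sum_sub_distrib, ← Finset.sum_mul]
  have h3 : lam * (r - 1) = (∑ i, μ i) * (1 - r⁻¹) := by
    rw [← hlamr]; field_simp
  linear_combination prodWeight r C (queues s) * hnorm
    + prodWeight r C (queues s) * expShare r C s.1 * h3

lemma stepOp_prodWeight_of_pos (hμ : ∀ i, 0 ≤ μ i) (hnorm : lam + ∑ i, μ i = 1) {r C : ℝ}
    (hr : 1 < r) (hC : 0 < C) (hlamr : lam * r = ∑ i, μ i) {s : ℕ × (Fin k → ℕ)}
    (hs : ∃ i, s.2 i = 0) (hs0 : s.1 ≠ 0) :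
    stepOp k lam μ (fun s => prodWeight r C (queues s)) s ≤ prodWeight r C (queues s) := by
  have hr0 : 0 < r := by linarith
  rw [stepOp_queues _ hs, if_neg hs0, add_zero, freeOp_prodWeight hnorm hr hC hlamr hs]
  refine mul_le_of_le_one_right (prodWeight_pos hr0 hC _).le ?_
  have h1 : ∑ i, μ i * (expShare r C s.1 - expShare r C (queues s i)) ≤ 0 := by
    refine Finset.sum_nonpos fun i _ => mul_nonpos_of_nonneg_of_nonpos (hμ i) ?_
    exact sub_nonpos.2 (expShare_mono hr hC (by simp [queues]))
  have h2 : 0 ≤ 1 - r⁻¹ := sub_nonneg.2 (inv_le_one_of_one_le₀ hr.le)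
  linarith [mul_nonpos_of_nonneg_of_nonpos h2 h1]

lemma stepOp_prodWeight_of_zero (hnorm : lam + ∑ i, μ i = 1) {r C : ℝ}
    (hr : 1 < r) (hC : 0 < C) (hlamr : lam * r = ∑ i, μ i) {s : ℕ × (Fin k → ℕ)}
    (hs : ∃ i, s.2 i = 0) (hs0 : s.1 = 0) :
    stepOp k lam μ (fun s => prodWeight r C (queues s)) s = prodWeight r C (queues s) *
      (1 + (1 - r⁻¹) * ((∑ i, μ i) / (C + 1)
        - ∑ i ∈ (zeroSet k s.2)ᶜ, μ i * expShare r C (s.2 i))) := by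
  have hr0 : 0 < r := by linarith
  have hq : ∀ i, queues s i = s.2 i := fun i => by simp [queues, hs0]
  have h1 : ∀ i ∈ zeroSet k s.2, μ i * (prodWeight r C (queues s)
      - prodWeight r C (queues s - Pi.single i 1))
      = prodWeight r C (queues s) * (1 - r⁻¹) * (μ i * expShare r C (s.2 i)) := by
    intro i _
    rw [sub_eq_add_neg (queues s), ← Pi.single_neg, prodWeight_add_single hr0 hC, zpow_neg_one,
      hq]
    ring
  have h2 := Finset.sum_add_sum_compl (zeroSet k s.2) (fun i => μ i * expShare r C (s.2 i))
  rw [stepOp_queues _ hs, if_pos hs0, freeOp_prodWeight hnorm hr hC hlamr hs,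
    Finset.sum_congr rfl h1, ← Finset.mul_sum]
  simp only [mul_sub, Finset.sum_sub_distrib, ← Finset.sum_mul, hq, ← h2, hs0, Nat.cast_zero,
    expShare_zero]
  ring

/-- Under the stationary distribution, `r ^ total` is integrable on the boundary. -/
lemma summable_boundary (hlam : 0 < lam) (hμ : ∀ i, 0 < μ i) (hnorm : lam + ∑ i, μ i = 1)
    {r : ℝ} (hr : 1 < r) (hlamr : lam * r = ∑ i, μ i)
    {π : ℕ × (Fin k → ℕ) → ℝ} (hπnn : ∀ s, 0 ≤ π s) (hπsum : HasSum π 1)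
    (hπsupp : ∀ s, π s ≠ 0 → ∃ i, s.2 i = 0)
    (hπstat : ∀ s', (∑' s, π s * jsqP k lam μ s s') = π s') :
    Summable (fun s => π s * if s.1 = 0 then r ^ total (queues s) else 0) := by
  have hr0 : 0 < r := by linarith
  have hΛ : 0 < ∑ i, μ i := by rw [← hlamr]; positivity
  have : Nonempty (Fin k) := by
    by_contra h
    rw [not_nonempty_iff] at h
    simp at hΛ
  obtain ⟨i₀, hi₀⟩ := Finite.exists_min μ
  set η := μ i₀ with hη
  have hη0 : 0 < η := hμ i₀
  set Λ := ∑ i, μ i with hΛdef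
  set C := 4 * Λ / η with hC
  have hC0 : 0 < C := by positivity
  have hΛC : Λ / (C + 1) ≤ η / 4 := by
    have : η * C = 4 * Λ := by rw [hC]; field_simp
    rw [div_le_div_iff₀ (by positivity) (by norm_num)]
    linarith
  obtain ⟨K, hK⟩ := pow_unbounded_of_one_lt C hr
  have hρ : 0 < 1 - r⁻¹ := sub_pos.2 (inv_lt_one_of_one_lt₀ hr)
  have hρ1 : 1 - r⁻¹ ≤ 1 := by have := inv_pos.2 hr0; linarith
  set ε := (1 - r⁻¹) * (η / 4) with hε
  have hε0 : 0 < ε := by positivity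
  set B := (C + r ^ K) ^ k with hB
  have hB0 : 0 < B := by positivity
  have hdrift : ∀ s, π s ≠ 0 → stepOp k lam μ (fun s => prodWeight r C (queues s)) s
      + (if s.1 = 0 then ε * prodWeight r C (queues s) else 0)
        ≤ prodWeight r C (queues s) + (Λ + ε) * B := by
    intro s hs
    have hz := hπsupp s hs
    have hV := prodWeight_pos (k := k) hr0 hC0 (queues s)
    have hb : 0 ≤ (Λ + ε) * B := by positivity
    split_ifs with h0
    · rw [stepOp_prodWeight_of_zero hnorm hr hC0 hlamr hz h0, ← hΛdef]
      have hnn : ∀ i ∈ (zeroSet k s.2)ᶜ, 0 ≤ μ i * expShare r C (s.2 i) := fun i _ =>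
        mul_nonneg (hμ i).le (expShare_nonneg hr0 hC0 _)
      by_cases hbig : ∃ i, K ≤ s.2 i ∧ s.2 i ≠ 0
      · obtain ⟨i, hiK, hi0⟩ := hbig
        have h1 : η * (1 / 2) ≤ ∑ i ∈ (zeroSet k s.2)ᶜ, μ i * expShare r C (s.2 i) := by
          refine le_trans ?_ (Finset.single_le_sum hnn
            (show i ∈ (zeroSet k s.2)ᶜ by simpa [zeroSet] using hi0))
          refine mul_le_mul (hi₀ i) (half_le_expShare hr0 hC0 ?_) (by norm_num) (hμ i).le
          rw [zpow_natCast]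
          exact hK.le.trans (pow_le_pow_right₀ hr.le hiK)
        have h2 := mul_le_mul_of_nonneg_left (a := 1 - r⁻¹)
          (by linarith : Λ / (C + 1) - ∑ i ∈ (zeroSet k s.2)ᶜ, μ i * expShare r C (s.2 i)
            ≤ -(η / 4)) hρ.le
        rw [mul_neg, ← hε] at h2
        have h3 := mul_le_mul_of_nonneg_left h2 hV.le
        linarith
      · push Not at hbig
        have hVB : prodWeight r C (queues s) ≤ B := by
          have : ∀ i, C + r ^ queues s i ≤ C + r ^ K := by
            intro i
            have h1 : s.2 i ≤ K := by
              by_contra! hcon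
              have := hbig i hcon.le
              omega
            have h2 : queues s i = (s.2 i : ℤ) := by simp [queues, h0]
            rw [h2, zpow_natCast]
            gcongr
            exact hr.le
          refine (Finset.prod_le_prod (fun i _ => by positivity) fun i _ => this i).trans_eq ?_
          simp [hB]
        have h1 := Finset.sum_nonneg hnn
        have h2 : (1 - r⁻¹) * (Λ / (C + 1)
            - ∑ i ∈ (zeroSet k s.2)ᶜ, μ i * expShare r C (s.2 i)) ≤ 1 * Λ := by
          have h3 : Λ / (C + 1) ≤ Λ := div_le_self hΛ.le (by linarith)
          calc _ ≤ (1 - r⁻¹) * Λ := mul_le_mul_of_nonneg_left (by linarith) hρ.le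
            _ ≤ 1 * Λ := mul_le_mul_of_nonneg_right hρ1 hΛ.le
        have h3 := mul_le_mul_of_nonneg_left h2 hV.le
        have h4 := mul_le_mul_of_nonneg_left hVB (by positivity : 0 ≤ Λ + ε)
        linarith
    · have := stepOp_prodWeight_of_pos (fun i => (hμ i).le) hnorm hr hC0 hlamr hz h0
      linarith
  have hsum := summable_of_drift hlam.le (fun i => (hμ i).le) hnorm hπnn hπsum hπstat
    (by positivity : 0 ≤ (Λ + ε) * B) (fun s => (prodWeight_pos (k := k) hr0 hC0 (queues s)).le)
    (fun s => by
      have := prodWeight_pos (k := k) hr0 hC0 (queues s)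
      split_ifs <;> positivity) hdrift
  refine Summable.of_nonneg_of_le
    (fun s => mul_nonneg (hπnn s) (by split_ifs <;> positivity)) (fun s => ?_) (hsum.mul_left ε⁻¹)
  rw [mul_left_comm]
  refine mul_le_mul_of_nonneg_left ?_ (hπnn s)
  split_ifs
  · rw [inv_mul_cancel_left₀ hε0.ne']
    exact zpow_total_le_prodWeight hr0 hC0 _
  · simp

/-- The free walk tilted by `r ^ total` is the free walk with the weights exchanged. -/
lemma freeOp_zpow_total_mul {a : ℝ} {m : Fin k → ℝ} {r : ℝ} (hr : 0 < r)
    (u : (Fin k → ℤ) → ℝ) (q : Fin k → ℤ) :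
    freeOp a m (fun q => r ^ total q * u q) q
      = r ^ total q * freeOp (a * r) (fun i => r⁻¹ * m i) u q := by
  unfold freeOp
  rw [mul_add, Finset.mul_sum, Finset.mul_sum]
  congr 1
  · refine Finset.sum_congr rfl fun i _ => ?_
    simp only [total_add_single, zpow_add_one₀ hr.ne']
    ring
  · refine Finset.sum_congr rfl fun i _ => ?_
    simp only [total_sub_single, zpow_sub_one₀ hr.ne']
    ring

/-- The flux of `u` through the boundary out of a state. -/
noncomputable def boundaryFlux (k : ℕ) (μ : Fin k → ℝ) (r : ℝ) (u : (Fin k → ℤ) → ℝ)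
    (s : ℕ × (Fin k → ℕ)) : ℝ :=
  if s.1 = 0 then r ^ total (queues s) * ∑ i ∈ zeroSet k s.2,
    μ i * (u (queues s) - r⁻¹ * u (queues s - Pi.single i 1)) else 0

/-- The stationary distribution expressed through its boundary values and a Green function. -/
lemma stationary_representation (hlam : 0 < lam) (hμ : ∀ i, 0 < μ i)
    (hnorm : lam + ∑ i, μ i = 1) {r : ℝ} (hr : 0 < r)
    {π : ℕ × (Fin k → ℕ) → ℝ} (hπnn : ∀ s, 0 ≤ π s) (hπsum : HasSum π 1)
    (hπsupp : ∀ s, π s ≠ 0 → ∃ i, s.2 i = 0)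
    (hπstat : ∀ s', (∑' s, π s * jsqP k lam μ s s') = π s')
    {t : ℕ × (Fin k → ℕ)} (ht : ∃ i, t.2 i = 0) {u : (Fin k → ℤ) → ℝ} {D : ℝ}
    (hu0 : ∀ q, 0 ≤ u q) (huD : ∀ q, r ^ total q * u q ≤ D)
    (hu : ∀ q, u q = freeOp (lam * r) (fun i => r⁻¹ * μ i) u q
      + if q = queues t then 1 else 0) :
    π t * r ^ total (queues t) = ∑' s, π s * boundaryFlux k μ r u s := by
  set G : (Fin k → ℤ) → ℝ := fun q => r ^ total q * u q with hG
  have hGD : ∀ s : ℕ × (Fin k → ℕ), |G (queues s)| ≤ D := fun s => by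
    rw [abs_of_nonneg (mul_nonneg (by positivity) (hu0 _))]
    exact huD _
  have hinv := stationary_integral hlam.le (fun i => (hμ i).le) hnorm hπnn hπsum.summable hπstat
    (g := fun s => G (queues s)) hGD
  have hsum : Summable (fun s => π s * G (queues s)) := by
    refine Summable.of_norm_bounded (hπsum.summable.mul_right D) fun s => ?_
    rw [norm_mul, Real.norm_of_nonneg (hπnn s)]
    exact mul_le_mul_of_nonneg_left (hGD s) (hπnn s)
  have hpt : HasSum (fun s => if s = t then π t * r ^ total (queues t) else 0)
      (π t * r ^ total (queues t)) := hasSum_ite_eq t _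
  have hdiff := (hinv.sub hsum.hasSum).add hpt
  rw [sub_self, zero_add] at hdiff
  rw [← hdiff.tsum_eq]
  refine tsum_congr fun s => ?_
  rcases eq_or_ne (π s) 0 with h0 | h0
  · rw [h0]
    split_ifs with hst
    · rw [← hst, h0]; ring
    · ring
  · have hs := hπsupp s h0
    have h1 : freeOp lam μ G (queues s) = G (queues s)
        - if s = t then r ^ total (queues t) else 0 := by
      rw [hG, freeOp_zpow_total_mul hr]
      have h2 := hu (queues s)
      by_cases hst : s = t
      · subst hst
        rw [if_pos rfl] at h2
        simp only [if_true]
        linear_combination (-(r ^ total (queues s))) * h2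
      · rw [if_neg fun h => hst (queues_injOn hs ht h)] at h2
        simp only [if_neg hst]
        linear_combination (-(r ^ total (queues s))) * h2
    have h3 : (if s.1 = 0 then ∑ i ∈ zeroSet k s.2,
          μ i * (G (queues s) - G (queues s - Pi.single i 1)) else 0)
        = boundaryFlux k μ r u s := by
      unfold boundaryFlux
      split_ifs
      · rw [Finset.mul_sum]
        refine Finset.sum_congr rfl fun i _ => ?_
        rw [hG]
        simp only [total_sub_single, zpow_sub_one₀ hr.ne']
        ring
      · rfl
    rw [stepOp_queues _ hs, h1, h3]
    by_cases hst : s = t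
    · subst hst; simp only [if_true]; ring
    · simp only [if_neg hst]; ring

lemma abs_boundaryFlux_le (hμ : ∀ i, 0 ≤ μ i) {r : ℝ} (hr : 1 < r) {u : (Fin k → ℤ) → ℝ} {D : ℝ}
    (hu : ∀ q, |u q| ≤ D) (s : ℕ × (Fin k → ℕ)) :
    |boundaryFlux k μ r u s|
      ≤ (if s.1 = 0 then r ^ total (queues s) else 0) * ((∑ i, μ i) * (2 * D)) := by
  have hr0 : 0 < r := by linarith
  have hD : 0 ≤ D := (abs_nonneg _).trans (hu 0)
  unfold boundaryFlux
  split_ifs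
  · rw [abs_mul, abs_of_pos (zpow_pos hr0 _)]
    refine mul_le_mul_of_nonneg_left ?_ (by positivity)
    refine (Finset.abs_sum_le_sum_abs _ _).trans ?_
    rw [Finset.sum_mul]
    refine (Finset.sum_le_sum fun i _ => ?_).trans (Finset.sum_le_sum_of_subset_of_nonneg
      (Finset.subset_univ _) fun i _ _ => mul_nonneg (hμ i) (by positivity))
    rw [abs_mul, abs_of_nonneg (hμ i)]
    refine mul_le_mul_of_nonneg_left ?_ (hμ i)
    refine (abs_sub _ _).trans ?_
    rw [abs_mul, abs_of_pos (inv_pos.2 hr0)]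
    have h1 := mul_le_mul (inv_le_one_of_one_le₀ hr.le) (hu (queues s - Pi.single i 1))
      (abs_nonneg _) zero_le_one
    linarith [hu (queues s)]
  · simp

lemma tendsto_boundaryFlux {r : ℝ} {u : ℕ → (Fin k → ℤ) → ℝ} {c : ℝ}
    (hu : ∀ q, Tendsto (fun n => u n q) atTop (𝓝 c)) (s : ℕ × (Fin k → ℕ)) :
    Tendsto (fun n => boundaryFlux k μ r (u n) s) atTop
      (𝓝 (boundaryFlux k μ r (fun _ => c) s)) := by
  unfold boundaryFlux
  split_ifs
  · exact (tendsto_finsetSum _ fun i _ =>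
      ((hu _).sub ((hu _).const_mul _)).const_mul _).const_mul _
  · exact tendsto_const_nhds

lemma boundaryFlux_const_pos (hμ : ∀ i, 0 < μ i) {r : ℝ} (hr : 1 < r) {c : ℝ} (hc : 0 < c)
    {s : ℕ × (Fin k → ℕ)} (hs0 : s.1 = 0) (hs : ∃ i, s.2 i = 0) :
    0 < boundaryFlux k μ r (fun _ => c) s := by
  have hr0 : 0 < r := by linarith
  have h1 : 0 < c - r⁻¹ * c := by
    rw [← one_sub_mul]
    exact mul_pos (sub_pos.2 (inv_lt_one_of_one_lt₀ hr)) hc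
  obtain ⟨i, hi⟩ := hs
  rw [boundaryFlux, if_pos hs0]
  exact mul_pos (by positivity) (Finset.sum_pos (fun i _ => mul_pos (hμ i) h1)
    ⟨i, by simpa [zeroSet] using hi⟩)

lemma total_queues (n : ℕ) (h : Fin k → ℕ) :
    total (queues (n, h)) = k * n + total (queues (0, h)) := by
  simp [total, queues, Finset.sum_add_distrib]

lemma exists_pos_tendsto (hk : 2 ≤ k) (hlam : 0 < lam) (hμ : ∀ i, 0 < μ i)
    (hnorm : lam + ∑ i, μ i = 1) {r : ℝ} (hr : 1 < r) (hlamr : lam * r = ∑ i, μ i)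
    {π : ℕ × (Fin k → ℕ) → ℝ} (hπnn : ∀ s, 0 ≤ π s) (hπsum : HasSum π 1)
    (hπsupp : ∀ s, π s ≠ 0 → ∃ i, s.2 i = 0)
    (hπstat : ∀ s', (∑' s, π s * jsqP k lam μ s s') = π s')
    {h : Fin k → ℕ} (hh : ∃ i, h i = 0) :
    ∃ c : ℝ, 0 < c ∧ Tendsto (fun n : ℕ => r ^ (k * n) * π (n, h)) atTop (𝓝 c) := by
  have hr0 : 0 < r := by linarith
  have hk0 : 0 < k := by omega
  set a := lam * r with ha
  set m : Fin k → ℝ := fun i => r⁻¹ * μ i with hmdef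
  have hm : ∀ i, 0 < m i := fun i => mul_pos (inv_pos.2 hr0) (hμ i)
  have hmsum : ∑ i, m i = lam := by
    rw [hmdef, ← Finset.mul_sum, ← hlamr, ha]; field_simp
  have hab : a + ∑ i, m i = 1 := by rw [hmsum, hlamr, add_comm]; exact hnorm
  have hlt : ∑ i, m i < a := by
    rw [hmsum, ha]; exact lt_mul_of_one_lt_right hlam hr
  -- the Green functions of the target states
  have hrep : ∀ g : Fin k → ℕ, (∃ i, g i = 0) → ∃ (u : (Fin k → ℤ) → ℝ) (D : ℝ),
      (∀ q, 0 ≤ u q) ∧ (∀ q, u q ≤ D) ∧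
      (∀ q, u q = freeOp a m u q + if q = queues (0, g) then 1 else 0) ∧
      ∀ n : ℕ, π (n, g) * r ^ total (queues (n, g))
        = ∑' s, π s * boundaryFlux k μ r (fun q => u (fun i => q i - n)) s := by
    intro g hg
    obtain ⟨u, D, hu0, huD, huD', hu⟩ := exists_green hk0 hm hab hlt (queues (0, g))
    refine ⟨u, D, hu0, huD, hu, fun n => ?_⟩
    refine stationary_representation hlam hμ hnorm hr0 hπnn hπsum hπsupp hπstat hg
      (D := D * r ^ total (queues (n, g))) (fun q => hu0 _) (fun q => ?_) fun q => ?_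
    · have h1 : (∑ i, m i) / a = r⁻¹ := by rw [hmsum, ha]; field_simp
      have h2 := mul_le_mul_of_nonneg_left (huD' (fun i => q i - n))
        (by positivity : 0 ≤ r ^ total q)
      refine h2.trans_eq ?_
      rw [h1, inv_zpow', total_sub_const, total_queues n g, mul_left_comm, ← zpow_add₀ hr0.ne']
      congr 2
      ring
    · rw [freeOp_sub_const]
      have h1 : (fun i => q i - (n : ℤ)) = queues (0, g) ↔ q = queues (n, g) := by
        simp only [funext_iff, queues]
        refine forall_congr' fun i => ?_
        push_cast
        constructor <;> intro h <;> linarith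
      rw [hu (fun i => q i - n)]
      simp only [h1]
      rfl
  -- the boundary carries mass
  obtain ⟨s₀, hs₀, hs₀π⟩ : ∃ s : ℕ × (Fin k → ℕ), s.1 = 0 ∧ π s ≠ 0 := by
    by_contra! hcon
    have hzero : ∀ s, π s = 0 := by
      intro s
      by_contra hs
      obtain ⟨u, D, -, -, -, hu⟩ := hrep s.2 (hπsupp s hs)
      have h1 := hu s.1
      rw [tsum_congr (g := fun _ => (0 : ℝ)) fun s => ?_, tsum_zero] at h1
      · rcases mul_eq_zero.1 h1 with h2 | h2
        · exact hs h2
        · exact (zpow_pos hr0 _).ne' h2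
      · by_cases hs0 : s.1 = 0
        · rw [hcon s hs0, zero_mul]
        · rw [boundaryFlux, if_neg hs0, mul_zero]
    rw [show π = fun _ => 0 from funext hzero] at hπsum
    exact zero_ne_one (hasSum_zero.unique hπsum)
  obtain ⟨u, D, hu0, huD, hu, hrepu⟩ := hrep h hh
  have hsup : ∀ q, freeOp a m u q ≤ u q := fun q => by
    conv_rhs => rw [hu q]
    have : (0 : ℝ) ≤ if q = queues (0, h) then 1 else 0 := by split_ifs <;> norm_num
    linarith
  have huD' : ∀ q, |u q| ≤ D := fun q => by rw [abs_of_nonneg (hu0 q)]; exact huD q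
  obtain ⟨c, hc⟩ := exists_tendsto_of_harmonic hk hm hab hlt (n₀ := 0) huD' fun q hq => by
    conv_lhs => rw [hu q]
    rw [if_neg, add_zero]
    rintro rfl
    rw [mul_zero] at hq
    refine absurd hq (not_lt.2 (Finset.sum_nonneg fun i _ => ?_))
    simp [queues]
  have hc0 : 0 < c := by
    refine limit_pos_of_superharmonic hk hm hab hlt hu0 hsup (t := queues (0, h)) ?_ (hc 0)
    rw [hu, if_pos rfl]
    have : 0 ≤ freeOp a m u (queues (0, h)) := by
      have := freeOp_mono (a := a) (m := m) (u := fun _ => 0) (v := u) (q := queues (0, h))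
        (by positivity) (fun i => (hm i).le) (fun i _ => hu0 _) fun i => hu0 _
      rwa [freeOp_const hk0 hab] at this
    linarith
  have hbd := summable_boundary hlam hμ hnorm hr hlamr hπnn hπsum hπsupp hπstat
  have hbound : ∀ v : (Fin k → ℤ) → ℝ, (∀ q, |v q| ≤ D) → ∀ s,
      ‖π s * boundaryFlux k μ r v s‖
        ≤ π s * (if s.1 = 0 then r ^ total (queues s) else 0) * ((∑ i, μ i) * (2 * D)) := by
    intro v hv s
    rw [norm_mul, Real.norm_of_nonneg (hπnn s), mul_assoc]
    exact mul_le_mul_of_nonneg_left (abs_boundaryFlux_le (fun i => (hμ i).le) hr hv s) (hπnn s)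
  have hlim := tendsto_tsum_of_dominated_convergence
    (f := fun (n : ℕ) s => π s * boundaryFlux k μ r (fun q => u (fun i => q i - n)) s)
    (hbd.mul_right ((∑ i, μ i) * (2 * D)))
    (fun s => (tendsto_boundaryFlux (μ := μ) (r := r) hc s).const_mul (π s))
    (Eventually.of_forall fun n s => hbound _ (fun q => huD' _) s)
  have hcD : |c| ≤ D := le_of_tendsto (hc 0).abs (Eventually.of_forall fun n => huD' _)
  have hpos : 0 < ∑' s, π s * boundaryFlux k μ r (fun _ => c) s := by
    refine Summable.tsum_pos
      (Summable.of_norm_bounded (hbd.mul_right _) (hbound _ fun _ => hcD)) (fun s => ?_) s₀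
      (mul_pos ((hπnn s₀).lt_of_ne' hs₀π)
        (boundaryFlux_const_pos hμ hr hc0 hs₀ (hπsupp s₀ hs₀π)))
    rcases eq_or_ne (π s) 0 with h0 | h0
    · rw [h0, zero_mul]
    · by_cases hs : s.1 = 0
      · exact mul_nonneg (hπnn s) (boundaryFlux_const_pos hμ hr hc0 hs (hπsupp s h0)).le
      · rw [boundaryFlux, if_neg hs, mul_zero]
  refine ⟨r ^ (-total (queues (0, h))) * ∑' s, π s * boundaryFlux k μ r (fun _ => c) s,
    by positivity, (hlim.const_mul _).congr fun n => ?_⟩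
  rw [← hrepu n, total_queues n h, mul_left_comm, ← zpow_add₀ hr0.ne', mul_comm, ← zpow_natCast]
  congr 2
  push_cast
  ring

end Stationary

/-- **Exactly geometric tail asymptotics for the M/M-JSQ with k parallel queues.**
For every background state `h ∈ H`, the limit
`lim_{n→∞} ρ^{−kn} P(M = n, Y = h)` exists and is a strictly positive constant `c_h`. -/
theorem jsq_exact_geometric_tail
    (k : ℕ) (hk : 2 ≤ k) (lam : ℝ) (μ : Fin k → ℝ)
    (hlam : 0 < lam) (hμ : ∀ i, 0 < μ i)
    (hnorm : lam + ∑ i, μ i = 1)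
    (hρ : rho k lam μ < 1)
    (π : ℕ × (Fin k → ℕ) → ℝ)
    (hπnn : ∀ s, 0 ≤ π s)
    (hπsupp : ∀ s, π s ≠ 0 → ∃ i : Fin k, s.2 i = 0)
    (hπsum : HasSum π 1)
    (hπstat : ∀ s', (∑' s, π s * jsqP k lam μ s s') = π s') :
    ∀ h : Fin k → ℕ, (∃ i, h i = 0) →
      ∃ c : ℝ, 0 < c ∧
        Tendsto (fun n : ℕ => (rho k lam μ ^ (k * n))⁻¹ * π (n, h)) atTop (𝓝 c) := by
  intro h hh
  have : Nonempty (Fin k) := ⟨⟨0, by omega⟩⟩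
  have hΛ : 0 < ∑ i, μ i := Finset.sum_pos (fun i _ => hμ i) Finset.univ_nonempty
  have hρ0 : 0 < rho k lam μ := div_pos hlam hΛ
  have hlamr : lam * (rho k lam μ)⁻¹ = ∑ i, μ i := by
    rw [rho]; field_simp
  simpa only [inv_pow] using exists_pos_tendsto hk hlam hμ hnorm
    ((one_lt_inv₀ hρ0).2 hρ) hlamr hπnn hπsum hπsupp hπstat hh
end

section
/- The stationary minimum queue length satisfies lim_{n→∞} (1/n) log P(M = n) = log ρ^k = k log ρ. -/
open Filter Topology
open scoped ENNReal

namespace JSQ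

variable {k : ℕ}

/-- The vector of queue lengths of the state `(m, y)`. -/
def queue (s : ℕ × (Fin k → ℕ)) : Fin k → ℕ := fun i => s.1 + s.2 i

/-- The set of shortest queues. -/
def shortest (q : Fin k → ℕ) : Finset (Fin k) :=
  Finset.univ.filter fun i => ∀ j, q i ≤ q j

/-- The transition operator of the uniformized chain, in terms of queue lengths. -/
noncomputable def step (lam : ℝ) (μ : Fin k → ℝ) (f : (Fin k → ℕ) → ℝ) (q : Fin k → ℕ) : ℝ :=
  ∑ i ∈ shortest q, lam / (shortest q).card * f (Function.update q i (q i + 1))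
    + ∑ j, μ j * f (Function.update q j (q j - 1))

lemma mem_shortest {q : Fin k → ℕ} {i : Fin k} : i ∈ shortest q ↔ ∀ j, q i ≤ q j := by
  simp [shortest]

lemma mem_zeroSet {y : Fin k → ℕ} {i : Fin k} : i ∈ zeroSet k y ↔ y i = 0 := by
  simp [zeroSet]

lemma shortest_queue {s : ℕ × (Fin k → ℕ)} (hs : ∃ i, s.2 i = 0) :
    shortest (queue s) = zeroSet k s.2 := by
  obtain ⟨i₀, hi₀⟩ := hs
  ext i
  rw [mem_shortest, mem_zeroSet]
  simp only [queue]
  constructor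
  · intro h
    have := h i₀
    omega
  · intro h j
    omega

lemma hasSum_ite_mul {α : Type*} [DecidableEq α] (t : α) (w : ℝ) (F : α → ℝ) :
    HasSum (fun s' => (if s' = t then w else 0) * F s') (w * F t) := by
  have := hasSum_single (f := fun s' => (if s' = t then w else 0) * F s') t
    (fun s' hs' => by simp [hs'])
  simpa using this

lemma hasSum_jsqP_mul (lam : ℝ) (μ : Fin k → ℝ) (f : (Fin k → ℕ) → ℝ)
    {s : ℕ × (Fin k → ℕ)} (hs : ∃ i, s.2 i = 0) :
    HasSum (fun s' => jsqP k lam μ s s' * f (queue s')) (step lam μ f (queue s)) := by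
  have hA : HasSum (fun s' : ℕ × (Fin k → ℕ) => (if (zeroSet k s.2).card = 1 then
      (if s' = (s.1 + 1, fun j => s.2 j - 1) then lam else 0)
    else
      ∑ i ∈ zeroSet k s.2,
        (if s' = (s.1, Function.update s.2 i 1) then lam / (zeroSet k s.2).card else 0))
        * f (queue s'))
      (∑ i ∈ zeroSet k s.2, lam / (zeroSet k s.2).card
        * f (Function.update (queue s) i (queue s i + 1))) := by
    by_cases hc : (zeroSet k s.2).card = 1
    · simp only [hc, if_true]
      obtain ⟨i, hi⟩ := Finset.card_eq_one.mp hc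
      convert hasSum_ite_mul (s.1 + 1, fun j => s.2 j - 1) lam (fun s' => f (queue s')) using 1
      rw [hi, Finset.sum_singleton]
      have : Function.update (queue s) i (queue s i + 1)
          = queue (s.1 + 1, fun j => s.2 j - 1) := by
        funext j
        have hj : j ∈ zeroSet k s.2 ↔ j = i := by rw [hi, Finset.mem_singleton]
        rw [mem_zeroSet] at hj
        by_cases hji : j = i
        · subst hji
          have := hj.2 rfl
          simp [queue, this]
        · have : s.2 j ≠ 0 := fun h => hji (hj.1 h)
          simp only [queue, Function.update_of_ne hji]
          omega
      rw [this]
      simp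
    · simp only [hc, if_false, Finset.sum_mul]
      refine hasSum_sum fun i hi => ?_
      convert hasSum_ite_mul (s.1, Function.update s.2 i 1) (lam / (zeroSet k s.2).card)
        (fun s' => f (queue s')) using 3
      funext j
      rw [mem_zeroSet] at hi
      by_cases hji : j = i
      · subst hji
        simp [queue, hi]
      · simp [queue, hji]
  have hB : HasSum (fun s' : ℕ × (Fin k → ℕ) => (∑ j ∈ (zeroSet k s.2)ᶜ,
      (if s' = (s.1, Function.update s.2 j (s.2 j - 1)) then μ j else 0)) * f (queue s'))
      (∑ j ∈ (zeroSet k s.2)ᶜ, μ j * f (Function.update (queue s) j (queue s j - 1))) := by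
    simp only [Finset.sum_mul]
    refine hasSum_sum fun i hi => ?_
    convert hasSum_ite_mul (s.1, Function.update s.2 i (s.2 i - 1)) (μ i)
      (fun s' => f (queue s')) using 3
    funext j
    rw [Finset.mem_compl, mem_zeroSet] at hi
    by_cases hji : j = i
    · subst hji
      simp only [queue, Function.update_self]
      omega
    · simp [queue, hji]
  have hC : HasSum (fun s' : ℕ × (Fin k → ℕ) => (∑ i ∈ zeroSet k s.2,
      (if s' = (if s.1 = 0 then s else (s.1 - 1, fun j => if j = i then 0 else s.2 j + 1))
        then μ i else 0)) * f (queue s'))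
      (∑ j ∈ zeroSet k s.2, μ j * f (Function.update (queue s) j (queue s j - 1))) := by
    simp only [Finset.sum_mul]
    refine hasSum_sum fun i hi => ?_
    convert hasSum_ite_mul
      (if s.1 = 0 then s else (s.1 - 1, fun j => if j = i then 0 else s.2 j + 1)) (μ i)
      (fun s' => f (queue s')) using 3
    funext j
    rw [mem_zeroSet] at hi
    by_cases hm : s.1 = 0
    · by_cases hji : j = i
      · subst hji
        simp [queue, hi, hm]
      · simp [queue, hji, hm]
    · by_cases hji : j = i
      · subst hji
        simp [queue, hi, hm]
      · simp only [queue, hm, if_false, Function.update_of_ne hji, hji]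
        omega
  have h := (hA.add hB).add hC
  convert h using 1
  · funext s'
    simp only [jsqP]
    ring
  · rw [step, shortest_queue hs, add_assoc, add_comm (∑ j ∈ (zeroSet k s.2)ᶜ, _),
      Finset.sum_add_sum_compl]

lemma jsqP_nonneg {lam : ℝ} {μ : Fin k → ℝ} (hlam : 0 ≤ lam) (hμ : ∀ i, 0 ≤ μ i)
    (s s' : ℕ × (Fin k → ℕ)) : 0 ≤ jsqP k lam μ s s' := by
  unfold jsqP
  refine add_nonneg (add_nonneg ?_ ?_) ?_
  · split_ifs
    · exact hlam
    · exact le_rfl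
    · exact Finset.sum_nonneg fun i _ => by split_ifs <;> positivity
  · exact Finset.sum_nonneg fun i _ => by split_ifs <;> first | exact hμ i | exact le_rfl
  · exact Finset.sum_nonneg fun i _ => by split_ifs <;> first | exact hμ i | exact le_rfl

lemma shortest_nonempty [NeZero k] (q : Fin k → ℕ) : (shortest q).Nonempty := by
  obtain ⟨i, hi⟩ := Finite.exists_min q
  exact ⟨i, mem_shortest.2 hi⟩

lemma step_mono {lam : ℝ} {μ : Fin k → ℝ} (hlam : 0 ≤ lam) (hμ : ∀ i, 0 ≤ μ i)
    {f g : (Fin k → ℕ) → ℝ} (hfg : ∀ q, f q ≤ g q) (q : Fin k → ℕ) :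
    step lam μ f q ≤ step lam μ g q := by
  unfold step
  refine add_le_add (Finset.sum_le_sum fun i _ => ?_) (Finset.sum_le_sum fun j _ => ?_)
  · exact mul_le_mul_of_nonneg_left (hfg _) (by positivity)
  · exact mul_le_mul_of_nonneg_left (hfg _) (hμ j)

lemma step_const [NeZero k] {lam : ℝ} {μ : Fin k → ℝ} (hnorm : lam + ∑ i, μ i = 1) (c : ℝ)
    (q : Fin k → ℕ) : step lam μ (fun _ => c) q = c := by
  have hcard : ((shortest q).card : ℝ) ≠ 0 := by
    exact_mod_cast (Finset.card_pos.2 (shortest_nonempty q)).ne'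
  simp only [step, Finset.sum_const, nsmul_eq_mul, ← Finset.sum_mul]
  rw [← mul_assoc, mul_div_cancel₀ _ hcard, ← add_mul, hnorm, one_mul]

/-- The hypotheses on the stationary distribution. -/
structure Stationary (lam : ℝ) (μ : Fin k → ℝ) (π : ℕ × (Fin k → ℕ) → ℝ) : Prop where
  lam_pos : 0 < lam
  mu_pos : ∀ i, 0 < μ i
  norm : lam + ∑ i, μ i = 1
  nonneg : ∀ s, 0 ≤ π s
  supp : ∀ s, π s ≠ 0 → ∃ i : Fin k, s.2 i = 0
  sum : HasSum π 1
  stat : ∀ s', (∑' s, π s * jsqP k lam μ s s') = π s'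

variable {lam : ℝ} {μ : Fin k → ℝ} {π : ℕ × (Fin k → ℕ) → ℝ}

lemma Stationary.summable_mul (h : Stationary lam μ π) {f : ℕ × (Fin k → ℕ) → ℝ} {B : ℝ}
    (hf0 : ∀ s, 0 ≤ f s) (hfB : ∀ s, f s ≤ B) : Summable fun s => π s * f s :=
  Summable.of_nonneg_of_le (fun s => mul_nonneg (h.nonneg s) (hf0 s))
    (fun s => mul_le_mul_of_nonneg_left (hfB s) (h.nonneg s)) (h.sum.summable.mul_right B)

lemma step_nonneg {lam : ℝ} {μ : Fin k → ℝ} (hlam : 0 ≤ lam) (hμ : ∀ i, 0 ≤ μ i)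
    {f : (Fin k → ℕ) → ℝ} (hf : ∀ q, 0 ≤ f q) (q : Fin k → ℕ) : 0 ≤ step lam μ f q :=
  add_nonneg (Finset.sum_nonneg fun i _ => mul_nonneg (by positivity) (hf _))
    (Finset.sum_nonneg fun j _ => mul_nonneg (hμ j) (hf _))

lemma step_le [NeZero k] {lam : ℝ} {μ : Fin k → ℝ} (hlam : 0 ≤ lam) (hμ : ∀ i, 0 ≤ μ i)
    (hnorm : lam + ∑ i, μ i = 1) {f : (Fin k → ℕ) → ℝ} {B : ℝ} (hf : ∀ q, f q ≤ B)
    (q : Fin k → ℕ) : step lam μ f q ≤ B :=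
  (step_mono hlam hμ hf q).trans_eq (step_const hnorm B q)

lemma Stationary.tsum_step [NeZero k] (h : Stationary lam μ π) {f : (Fin k → ℕ) → ℝ} {B : ℝ}
    (hf0 : ∀ q, 0 ≤ f q) (hfB : ∀ q, f q ≤ B) :
    ∑' s, π s * step lam μ f (queue s) = ∑' s, π s * f (queue s) := by
  have hμ := fun i => (h.mu_pos i).le
  have hlam := h.lam_pos.le
  have hin : ∀ s, HasSum (fun s' => π s * jsqP k lam μ s s' * f (queue s'))
      (π s * step lam μ f (queue s)) := by
    intro s
    by_cases hs : π s = 0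
    · simp [hs]
    · simpa only [mul_assoc] using (hasSum_jsqP_mul lam μ f (h.supp s hs)).mul_left (π s)
  have hsum : Summable (Function.uncurry fun s s' : ℕ × (Fin k → ℕ) =>
      π s * jsqP k lam μ s s' * f (queue s')) := by
    rw [summable_prod_of_nonneg]
    · refine ⟨fun s => (hin s).summable, ?_⟩
      simp only [Function.uncurry, (hin _).tsum_eq]
      exact h.summable_mul (fun s => step_nonneg hlam hμ hf0 _)
        (fun s => step_le hlam hμ h.norm hfB _)
    · rintro ⟨s, s'⟩
      exact mul_nonneg (mul_nonneg (h.nonneg s) (jsqP_nonneg hlam hμ s s')) (hf0 _)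
  calc ∑' s, π s * step lam μ f (queue s)
      = ∑' s, ∑' s', π s * jsqP k lam μ s s' * f (queue s') :=
        tsum_congr fun s => (hin s).tsum_eq.symm
    _ = ∑' s', ∑' s, π s * jsqP k lam μ s s' * f (queue s') := hsum.tsum_comm.symm
    _ = ∑' s, π s * f (queue s) := tsum_congr fun s' => by rw [tsum_mul_right, h.stat]

/-- Foster–Lyapunov moment bound. -/
lemma Stationary.moment_bound [NeZero k] (h : Stationary lam μ π) {V : (Fin k → ℕ) → ℝ} {c K : ℝ}
    (hc : 0 < c) (hK : 0 ≤ K) (hV : ∀ q, 0 ≤ V q)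
    (hdrift : ∀ q, step lam μ V q ≤ (1 - c) * V q + K) :
    Summable (fun s => π s * V (queue s)) := by
  have hμ := fun i => (h.mu_pos i).le
  have hlam := h.lam_pos.le
  have key : ∀ N : ℝ, 0 ≤ N →
      ∑' s, π s * (if V (queue s) ≤ N then V (queue s) else 0) ≤ K / c := by
    intro N hN
    have hf0 : ∀ q, 0 ≤ min (V q) N := fun q => le_min (hV q) hN
    have hfN : ∀ q, min (V q) N ≤ N := fun q => min_le_right _ _
    have h1 := h.tsum_step hf0 hfN
    have s1 : Summable fun s => π s * step lam μ (fun q => min (V q) N) (queue s) :=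
      h.summable_mul (fun s => step_nonneg hlam hμ hf0 _) (fun s => step_le hlam hμ h.norm hfN _)
    have s2 : Summable fun s => π s * min (V (queue s)) N :=
      h.summable_mul (fun s => hf0 _) (fun s => hfN _)
    have s3 : Summable fun s => π s * (if V (queue s) ≤ N then V (queue s) else 0) :=
      h.summable_mul (B := N) (fun s => by split_ifs; exacts [hV _, le_rfl])
        (fun s => by split_ifs with hh; exacts [hh, hN])
    have hle : ∑' s, (c * (π s * (if V (queue s) ≤ N then V (queue s) else 0))
        + π s * step lam μ (fun q => min (V q) N) (queue s))
        ≤ ∑' s, (π s * min (V (queue s)) N + π s * K) := by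
      refine Summable.tsum_le_tsum (fun s => ?_) ((s3.mul_left c).add s1)
        (s2.add (h.sum.summable.mul_right K))
      have e1 := (step_mono hlam hμ (f := fun q => min (V q) N) (g := V)
        (fun q => min_le_left _ _) (queue s)).trans (hdrift _)
      have e2 := step_le hlam hμ h.norm hfN (queue s)
      have e3 : c * (if V (queue s) ≤ N then V (queue s) else 0)
          + step lam μ (fun q => min (V q) N) (queue s) ≤ min (V (queue s)) N + K := by
        split_ifs with hh
        · rw [min_eq_left hh]; linarith
        · rw [min_eq_right (not_le.1 hh).le]; linarith
      have := mul_le_mul_of_nonneg_left e3 (h.nonneg s)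
      linarith
    rw [(s3.mul_left c).tsum_add s1, s2.tsum_add (h.sum.summable.mul_right K), tsum_mul_left,
      tsum_mul_right, h.sum.tsum_eq, h1] at hle
    rw [le_div_iff₀ hc]
    linarith
  refine summable_of_sum_le (c := K / c) (fun s => mul_nonneg (h.nonneg s) (hV _)) fun F => ?_
  have hN : ∀ s ∈ F, V (queue s) ≤ ∑ s ∈ F, V (queue s) := fun s hs =>
    Finset.single_le_sum (f := fun s => V (queue s)) (fun s _ => hV _) hs
  have hN0 : 0 ≤ ∑ s ∈ F, V (queue s) := Finset.sum_nonneg fun s _ => hV _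
  refine le_trans ?_ (key _ hN0)
  rw [Finset.sum_congr rfl fun s hs => by
    rw [← if_pos (hN s hs) (t := V (queue s)) (e := (0 : ℝ))]]
  refine Summable.sum_le_tsum F (fun s _ => mul_nonneg (h.nonneg s) ?_) ?_
  · split_ifs; exacts [hV _, le_rfl]
  · exact h.summable_mul (B := ∑ s ∈ F, V (queue s))
      (fun s => by split_ifs; exacts [hV _, le_rfl])
      (fun s => by split_ifs with hh; exacts [hh, hN0])

lemma step_le_of [NeZero k] {lam : ℝ} {μ : Fin k → ℝ} (hlam : 0 ≤ lam) (hμ : ∀ i, 0 ≤ μ i)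
    {f : (Fin k → ℕ) → ℝ} {q : Fin k → ℕ} {A : ℝ} {D : Fin k → ℝ}
    (hA : ∀ i ∈ shortest q, f (Function.update q i (q i + 1)) ≤ A)
    (hD : ∀ j, f (Function.update q j (q j - 1)) ≤ D j) :
    step lam μ f q ≤ lam * A + ∑ j, μ j * D j := by
  have hcard : ((shortest q).card : ℝ) ≠ 0 := by
    exact_mod_cast (Finset.card_pos.2 (shortest_nonempty q)).ne'
  refine add_le_add ?_ (Finset.sum_le_sum fun j _ => mul_le_mul_of_nonneg_left (hD j) (hμ j))
  calc ∑ i ∈ shortest q, lam / (shortest q).card * f (Function.update q i (q i + 1))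
      ≤ ∑ i ∈ shortest q, lam / (shortest q).card * A :=
        Finset.sum_le_sum fun i hi => mul_le_mul_of_nonneg_left (hA i hi) (by positivity)
    _ = lam * A := by
        rw [Finset.sum_const, nsmul_eq_mul, ← mul_assoc, mul_div_cancel₀ _ hcard]

lemma sum_update_add (q : Fin k → ℕ) (i : Fin k) (a : ℕ) :
    ∑ j, Function.update q i a j + q i = ∑ j, q j + a := by
  rw [Finset.sum_update_of_mem (Finset.mem_univ i),
    ← Finset.add_sum_erase Finset.univ q (Finset.mem_univ i), Finset.sdiff_singleton_eq_erase]
  ring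

lemma Stationary.summable_indicator (h : Stationary lam μ π) (p : (Fin k → ℕ) → Prop)
    [DecidablePred p] : Summable fun s => π s * (if p (queue s) then 1 else 0) :=
  h.summable_mul (B := 1) (fun s => by split_ifs <;> norm_num)
    (fun s => by split_ifs <;> norm_num)

open Classical in
/-- The stationary probability that the vector of queue lengths satisfies `p`. -/
noncomputable def prob (π : ℕ × (Fin k → ℕ) → ℝ) (p : (Fin k → ℕ) → Prop) : ℝ :=
  ∑' s, π s * (if p (queue s) then 1 else 0)

open Classical in
lemma Stationary.prob_le_of_step [NeZero k] (h : Stationary lam μ π)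
    {f : (Fin k → ℕ) → ℝ} {p₁ p₂ : (Fin k → ℕ) → Prop} {α β : ℝ}
    (hf0 : ∀ q, 0 ≤ f q) (hf1 : ∀ q, f q ≤ 1)
    (hstep : ∀ q, step lam μ f q + α * (if p₁ q then 1 else 0)
      ≤ f q + β * (if p₂ q then 1 else 0)) :
    α * prob π p₁ ≤ β * prob π p₂ := by
  have hμ := fun i => (h.mu_pos i).le
  have hlam := h.lam_pos.le
  have h1 := h.tsum_step hf0 hf1
  have s1 : Summable fun s => π s * step lam μ f (queue s) :=
    h.summable_mul (fun s => step_nonneg hlam hμ hf0 _) (fun s => step_le hlam hμ h.norm hf1 _)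
  have hle := Summable.tsum_le_tsum (fun s => by
      have := mul_le_mul_of_nonneg_left (hstep (queue s)) (h.nonneg s)
      rw [mul_add, mul_add, mul_left_comm, mul_left_comm _ β] at this
      exact this)
    (s1.add ((h.summable_indicator p₁).mul_left α))
    ((h.summable_mul (fun s => hf0 _) (fun s => hf1 _)).add ((h.summable_indicator p₂).mul_left β))
  rw [s1.tsum_add ((h.summable_indicator p₁).mul_left α),
    (h.summable_mul (fun s => hf0 (queue s)) (fun s => hf1 _)).tsum_add ((h.summable_indicator p₂).mul_left β), tsum_mul_left,
    tsum_mul_left, h1] at hle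
  simpa only [prob] using (add_le_add_iff_left _).1 hle

/-- `n` is the length of a shortest queue. -/
def IsMin (q : Fin k → ℕ) (n : ℕ) : Prop := (∀ i, n ≤ q i) ∧ ∃ i, q i = n

lemma Stationary.total_cut [NeZero k] (h : Stationary lam μ π) (m : ℕ) :
    lam * prob π (fun q => ∑ i, q i = m) ≤ (∑ i, μ i) * prob π (fun q => ∑ i, q i = m + 1) := by
  classical
  have hμ := fun i => (h.mu_pos i).le
  have hμs : 0 ≤ ∑ i, μ i := Finset.sum_nonneg fun i _ => hμ i
  have hlam := h.lam_pos.le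
  refine h.prob_le_of_step (f := fun q => if ∑ i, q i ≤ m then 1 else 0)
    (fun q => by split_ifs <;> norm_num) (fun q => by split_ifs <;> norm_num) fun q => ?_
  have hup : ∀ i, ∑ j, Function.update q i (q i + 1) j = ∑ j, q j + 1 := fun i => by
    have := sum_update_add q i (q i + 1)
    omega
  have hdown : ∀ i, ∑ j, Function.update q i (q i - 1) j ≤ ∑ j, q j ∧
      ∑ j, q j ≤ ∑ j, Function.update q i (q i - 1) j + 1 := fun i => by
    have := sum_update_add q i (q i - 1)
    omega
  have hb := step_le_of hlam hμ (f := fun q => if ∑ i, q i ≤ m then 1 else 0) (q := q)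
    (A := if ∑ i, q i + 1 ≤ m then 1 else 0) (D := fun _ => if ∑ i, q i ≤ m + 1 then 1 else 0)
    (fun i _ => by simp only [hup]; exact le_rfl)
    (fun j => by
      have := hdown j
      split_ifs <;> first | omega | norm_num)
  have hn := h.norm
  rw [← Finset.sum_mul] at hb
  refine (add_le_add hb le_rfl).trans ?_
  split_ifs <;> first | omega | linarith

lemma Stationary.min_cut [NeZero k] (h : Stationary lam μ π) {m₀ : ℝ} (hm₀ : ∀ i, m₀ ≤ μ i)
    (n : ℕ) : m₀ * prob π (fun q => IsMin q (n + 1)) ≤ lam * prob π (fun q => IsMin q n) := by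
  classical
  have hμ := fun i => (h.mu_pos i).le
  have hμs : 0 ≤ ∑ i, μ i := Finset.sum_nonneg fun i _ => hμ i
  have hlam := h.lam_pos.le
  have hn := h.norm
  refine h.prob_le_of_step (f := fun q => if ∀ i, n + 1 ≤ q i then 1 else 0)
    (fun q => by split_ifs <;> norm_num) (fun q => by split_ifs <;> norm_num) fun q => ?_
  by_cases hq : ∀ i, n + 1 ≤ q i
  · rw [if_pos hq]
    have hnot : ¬ IsMin q n := by
      rintro ⟨-, i, hi⟩
      have := hq i
      omega
    rw [if_neg hnot]
    by_cases hq' : IsMin q (n + 1)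
    · rw [if_pos hq']
      obtain ⟨-, i₀, hi₀⟩ := hq'
      have hb := step_le_of hlam hμ (f := fun q => if ∀ i, n + 1 ≤ q i then 1 else 0) (q := q)
        (A := 1) (D := fun j => 1 - if j = i₀ then 1 else 0)
        (fun i _ => by split_ifs <;> norm_num)
        (fun j => by
          by_cases hj : j = i₀
          · subst hj
            rw [if_neg]
            · simp
            · intro hall
              have := hall j
              simp [hi₀] at this
          · rw [if_neg hj]
            split_ifs <;> norm_num)
      simp only [mul_sub, mul_one, Finset.sum_sub_distrib, mul_ite, mul_zero, Finset.sum_ite_eq',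
        Finset.mem_univ, if_true] at hb
      have := hm₀ i₀
      linarith
    · rw [if_neg hq']
      have := step_le hlam hμ hn (f := fun q => if ∀ i, n + 1 ≤ q i then 1 else 0) (B := 1)
        (fun q => by split_ifs <;> norm_num) q
      linarith
  · rw [if_neg hq]
    have hnot : ¬ IsMin q (n + 1) := fun hh => hq hh.1
    rw [if_neg hnot]
    have hb := step_le_of hlam hμ (f := fun q => if ∀ i, n + 1 ≤ q i then 1 else 0) (q := q)
        (A := if IsMin q n then 1 else 0) (D := fun _ => 0)
        (fun i hi => by
          split_ifs with h1 h2
          · exact le_rfl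
          · exfalso
            rw [mem_shortest] at hi
            push Not at hq
            obtain ⟨j, hj⟩ := hq
            have hi' := hi j
            have hii := h1 i
            rw [Function.update_self] at hii
            have hqi : q i = n := by omega
            exact h2 ⟨fun l => hqi ▸ hi l, i, hqi⟩
          · norm_num
          · norm_num)
        (fun j => by
          rw [if_neg]
          intro hall
          apply hq
          intro i
          have := hall i
          by_cases hij : i = j
          · subst hij
            rw [Function.update_self] at this
            omega
          · rwa [Function.update_of_ne hij] at this)
    simp only [mul_zero, Finset.sum_const_zero, add_zero] at hb ⊢
    linarith

/-- The ratio of successive values of the truncated exponential `expo`. -/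
noncomputable def slope (a ε : ℝ) (l : ℕ) : ℝ := min (1 + ε * l) a

/-- A function growing like `a ^ n` whose ratio of successive values increases slowly from
`1` to `a`. -/
noncomputable def expo (a ε : ℝ) (n : ℕ) : ℝ := ∏ l ∈ Finset.range n, slope a ε l

section expo

variable {a ε : ℝ}

lemma one_le_slope (ha : 1 ≤ a) (hε : 0 ≤ ε) (l : ℕ) : 1 ≤ slope a ε l :=
  le_min (by have : 0 ≤ ε * l := by positivity
             linarith) ha

lemma slope_le (l : ℕ) : slope a ε l ≤ a := min_le_right _ _

lemma slope_mono (hε : 0 ≤ ε) : Monotone (slope a ε) := fun l l' hl =>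
  min_le_min_right a (by gcongr)

lemma slope_zero (ha : 1 ≤ a) : slope a ε 0 = 1 := by simp [slope, ha]

lemma slope_le_pred_add (hε : 0 ≤ ε) (l : ℕ) : slope a ε l ≤ slope a ε (l - 1) + ε := by
  rcases l with _ | l
  · simp [hε]
  · simp only [slope, Nat.add_sub_cancel]
    rw [← min_add_add_right]
    refine min_le_min ?_ (by linarith)
    push_cast
    linarith

lemma exists_slope_eq (hε : 0 < ε) : ∃ L : ℕ, ∀ l, L ≤ l → slope a ε l = a := by
  obtain ⟨L, hL⟩ := exists_nat_ge ((a - 1) / ε)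
  refine ⟨L, fun l hl => min_eq_right ?_⟩
  rw [div_le_iff₀ hε] at hL
  have : ε * L ≤ ε * l := by gcongr
  linarith

lemma expo_pos (ha : 1 ≤ a) (hε : 0 ≤ ε) (n : ℕ) : 0 < expo a ε n :=
  Finset.prod_pos fun l _ => zero_lt_one.trans_le (one_le_slope ha hε l)

lemma expo_succ (n : ℕ) : expo a ε (n + 1) = expo a ε n * slope a ε n :=
  Finset.prod_range_succ _ _

lemma expo_pred_mul (ha : 1 ≤ a) (n : ℕ) :
    expo a ε (n - 1) * slope a ε (n - 1) = expo a ε n := by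
  rcases n with _ | n
  · simp [slope_zero ha]
  · simp [expo_succ]

lemma expo_le (ha : 1 ≤ a) (hε : 0 ≤ ε) (n : ℕ) : expo a ε n ≤ a ^ n := by
  refine (Finset.prod_le_prod (fun l _ => zero_le_one.trans (one_le_slope ha hε l))
    fun l _ => slope_le l).trans_eq ?_
  simp

lemma pow_le_expo (ha : 1 ≤ a) (hε : 0 ≤ ε) {L : ℕ} (hL : ∀ l, L ≤ l → slope a ε l = a)
    (n : ℕ) : a ^ n ≤ a ^ L * expo a ε n := by
  have hone : ∀ n, 1 ≤ expo a ε n := fun n => by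
    induction n with
    | zero => simp [expo]
    | succ n ih =>
      rw [expo_succ]
      exact one_le_mul_of_one_le_of_one_le ih (one_le_slope ha hε n)
  rcases le_total n L with hn | hn
  · calc a ^ n ≤ a ^ L := pow_le_pow_right₀ ha hn
      _ ≤ a ^ L * expo a ε n := le_mul_of_one_le_right (by positivity) (hone n)
  · induction n, hn using Nat.le_induction with
    | base => exact le_mul_of_one_le_right (by positivity) (hone L)
    | succ n hn ih =>
      rw [expo_succ, hL n hn, pow_succ, ← mul_assoc]
      gcongr

end expo

lemma prod_update_mul (F : ℕ → ℝ) (q : Fin k → ℕ) (i : Fin k) (c : ℕ) :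
    (∏ j, F (Function.update q i c j)) * F (q i) = (∏ j, F (q j)) * F c := by
  rw [← Finset.mul_prod_erase Finset.univ _ (Finset.mem_univ i),
    ← Finset.mul_prod_erase Finset.univ (fun j => F (q j)) (Finset.mem_univ i),
    Function.update_self, Finset.prod_congr rfl fun j hj => by
      rw [Function.update_of_ne (Finset.ne_of_mem_erase hj)]]
  ring

lemma sum_update_add_real (F : ℕ → ℝ) (q : Fin k → ℕ) (i : Fin k) (c : ℕ) :
    (∑ j, F (Function.update q i c j)) + F (q i) = (∑ j, F (q j)) + F c := by
  rw [← Finset.add_sum_erase Finset.univ _ (Finset.mem_univ i),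
    ← Finset.add_sum_erase Finset.univ (fun j => F (q j)) (Finset.mem_univ i),
    Function.update_self, Finset.sum_congr rfl fun j hj => by
      rw [Function.update_of_ne (Finset.ne_of_mem_erase hj)]]
  ring

/-- The Lyapunov function. -/
noncomputable def lyap (a b ε : ℝ) (q : Fin k → ℕ) : ℝ :=
  (∏ j, expo a ε (q j)) * ∑ i, b ^ q i

lemma step_lyap_le [NeZero k] (hlam : 0 ≤ lam) (hμ : ∀ i, 0 ≤ μ i) {a b ε : ℝ} (ha : 1 ≤ a)
    (hb : 0 < b) (hb1 : b ≤ 1) (hε : 0 ≤ ε) {q : Fin k → ℕ} {M : ℕ} (hM : IsMin q M) :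
    step lam μ (lyap a b ε) q ≤ (∏ j, expo a ε (q j)) *
      (lam * slope a ε M * (∑ i, b ^ q i - (1 - b) * b ^ M)
        + (∑ j, μ j * (slope a ε (q j - 1))⁻¹) * (∑ i, b ^ q i + (b⁻¹ - 1) * b ^ M)) := by
  have hpos : ∀ n, 0 < expo a ε n := expo_pos ha hε
  have hs : ∀ n, 0 < slope a ε n := fun n => zero_lt_one.trans_le (one_le_slope ha hε n)
  have hW : 0 < ∏ j, expo a ε (q j) := Finset.prod_pos fun j _ => hpos _
  refine (step_le_of hlam hμ
    (A := (∏ j, expo a ε (q j)) * slope a ε M * (∑ i, b ^ q i - (1 - b) * b ^ M))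
    (D := fun j => (∏ j, expo a ε (q j)) * (slope a ε (q j - 1))⁻¹ *
      (∑ i, b ^ q i + (b⁻¹ - 1) * b ^ M)) ?_ ?_).trans_eq ?_
  · intro i hi
    have hqi : q i = M := by
      obtain ⟨h1, i₀, h2⟩ := hM
      have h3 := mem_shortest.1 hi i₀
      have h4 := h1 i
      omega
    have e1 := prod_update_mul (expo a ε) q i (q i + 1)
    have e2 := sum_update_add_real (fun n => b ^ n) q i (q i + 1)
    rw [expo_succ, mul_comm (expo a ε (q i)), ← mul_assoc] at e1
    have e1' := mul_right_cancel₀ (hpos _).ne' e1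
    rw [lyap, e1', hqi] at *
    refine le_of_eq ?_
    congr 1
    rw [pow_succ] at e2
    linarith
  · intro j
    have e1 := prod_update_mul (expo a ε) q j (q j - 1)
    have e2 := sum_update_add_real (fun n => b ^ n) q j (q j - 1)
    rw [← expo_pred_mul ha (q j), mul_comm (expo a ε (q j - 1)), ← mul_assoc] at e1
    have e1' := mul_right_cancel₀ (hpos _).ne' e1
    rw [lyap, (eq_mul_inv_iff_mul_eq₀ (hs _).ne').2 e1']
    refine mul_le_mul_of_nonneg_left ?_ (mul_nonneg hW.le (inv_nonneg.2 (hs _).le))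
    have hbi : 1 ≤ b⁻¹ := (one_le_inv₀ hb).2 hb1
    have hvM : 0 < b ^ M := by positivity
    have : b ^ (q j - 1) - b ^ q j ≤ (b⁻¹ - 1) * b ^ M := by
      rcases hq : q j with _ | n
      · simp only [Nat.zero_sub, sub_self]
        exact mul_nonneg (by linarith) hvM.le
      · have hv : b ^ (n + 1) ≤ b ^ M := pow_le_pow_of_le_one hb.le hb1 (hq ▸ hM.1 j)
        have : b ^ n = b⁻¹ * b ^ (n + 1) := by
          rw [pow_succ]; field_simp
        rw [Nat.add_sub_cancel, this]
        calc b⁻¹ * b ^ (n + 1) - b ^ (n + 1) = (b⁻¹ - 1) * b ^ (n + 1) := by ring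
          _ ≤ _ := mul_le_mul_of_nonneg_left hv (by linarith)
    linarith
  · rw [mul_add, Finset.sum_mul, Finset.mul_sum]
    congr 1
    · ring
    · exact Finset.sum_congr rfl fun j _ => by ring

/-- The function `x ↦ P x + R / x + T` is convex. -/
lemma affine_add_inv_le {P R T a x δ : ℝ} (ha : 1 < a) (hx1 : 1 ≤ x) (hxa : x ≤ a) (hR : 0 ≤ R)
    (h1 : P + R + T ≤ -δ) (h2 : P * a + R * a⁻¹ + T ≤ -δ) : P * x + R * x⁻¹ + T ≤ -δ := by
  have hia : a * a⁻¹ = 1 := mul_inv_cancel₀ (by linarith)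
  have hx0 : 0 < x := by linarith
  have ha0 : 0 < a⁻¹ := inv_pos.2 (by linarith)
  have hinv : x⁻¹ ≤ 1 + a⁻¹ - x * a⁻¹ := by
    rw [inv_le_iff_one_le_mul₀ hx0]
    have := mul_nonneg (mul_nonneg (sub_nonneg.2 hx1) (sub_nonneg.2 hxa)) ha0.le
    have e : (x - 1) * (a - x) * a⁻¹ = (a * a⁻¹) * (x - 1) - x * (x - 1) * a⁻¹ := by ring
    rw [e, hia] at this
    linarith
  have h3 : P * x + R * x⁻¹ + T ≤ P * x + R * (1 + a⁻¹ - x * a⁻¹) + T := by gcongr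
  refine h3.trans (le_of_mul_le_mul_left ?_ (sub_pos.2 ha))
  have e : (a - 1) * (P * x + R * (1 + a⁻¹ - x * a⁻¹) + T)
      = (a - x) * (P + R + T) + (x - 1) * (P * a + R * a⁻¹ + T) := by
    linear_combination (R * (1 - x)) * hia
  rw [e]
  have h4 := mul_le_mul_of_nonneg_left h1 (sub_nonneg.2 hxa)
  have h5 := mul_le_mul_of_nonneg_left h2 (sub_nonneg.2 hx1)
  linarith

lemma drift_algebra {l m m₀ a b ε δ κ x D S v : ℝ} (hm₀ : 0 ≤ m₀) (hm : m₀ ≤ m)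
    (hlm : l + m = 1) (ha : 1 < a) (hb : 0 < b) (hb1 : b < 1) (hκ : 1 ≤ κ) (hε : 0 ≤ ε)
    (h1 : κ * (l * a + m * a⁻¹ - 1) - (1 - b) * (l * a) + (b⁻¹ - 1) * (m * a⁻¹) ≤ -δ)
    (h2 : (b⁻¹ - 1) * m - (1 - b) * l - m₀ * (1 - a⁻¹) ≤ -δ)
    (h3 : 0 ≤ l * a + m * a⁻¹ - 1)
    (h4 : κ * (m * ε) + m * ε * (b⁻¹ - 1) ≤ δ / 2)
    (hx1 : 1 ≤ x) (hxa : x ≤ a) (hD : D ≤ m * (x⁻¹ + ε) - m₀ * (x⁻¹ - a⁻¹))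
    (hv : 0 ≤ v) (hvS : v ≤ S) (hSv : S ≤ κ * v) :
    l * x * (S - (1 - b) * v) + D * (S + (b⁻¹ - 1) * v) ≤ S - δ / 2 * v := by
  have hbi : 0 < b⁻¹ - 1 := sub_pos.2 ((one_lt_inv₀ hb).2 hb1)
  have hg : 0 ≤ m₀ * (x⁻¹ - a⁻¹) :=
    mul_nonneg hm₀ (sub_nonneg.2 (inv_anti₀ (by linarith) hxa))
  have hm' : 0 ≤ m := hm₀.trans hm
  have hD' := mul_le_mul_of_nonneg_right hD (add_nonneg (hv.trans hvS) (mul_nonneg hbi.le hv))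
  have hψ : ∀ c, 1 ≤ c → c ≤ κ → c * (l * x + m * x⁻¹ - 1) - (1 - b) * (l * x)
      + (b⁻¹ - 1) * (m * x⁻¹) - m₀ * (x⁻¹ - a⁻¹) ≤ -δ := by
    intro c hc hcκ
    have := affine_add_inv_le (P := c * l - (1 - b) * l) (R := c * m + (b⁻¹ - 1) * m - m₀)
      (T := m₀ * a⁻¹ - c) (δ := δ) ha hx1 hxa ?_ ?_ ?_
    · linarith
    · have : 0 ≤ (c - 1) * m := mul_nonneg (by linarith) hm'
      have := mul_nonneg hbi.le hm'
      linarith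
    · have : c * (l + m) = c := by rw [hlm, mul_one]
      linarith
    · have := mul_le_mul_of_nonneg_right hcκ h3
      linarith
  have hF : (l * x + m * x⁻¹ - 1) * S - (1 - b) * (l * x) * v + (b⁻¹ - 1) * (m * x⁻¹) * v
      - m₀ * (x⁻¹ - a⁻¹) * v ≤ -δ * v := by
    rcases le_total 0 (l * x + m * x⁻¹ - 1) with hF | hF
    · have e1 := mul_le_mul_of_nonneg_right (hψ κ hκ le_rfl) hv
      have e2 := mul_le_mul_of_nonneg_left hSv hF
      linarith
    · have e1 := mul_le_mul_of_nonneg_right (hψ 1 le_rfl hκ) hv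
      have e2 := mul_le_mul_of_nonpos_left hvS hF
      linarith
  have e3 := mul_le_mul_of_nonneg_right h4 hv
  have e4 := mul_le_mul_of_nonneg_left hSv (mul_nonneg hm' hε)
  have e5 := mul_le_mul_of_nonneg_left hvS hg
  have e6 := mul_nonneg (mul_nonneg hg hbi.le) hv
  linarith

lemma exists_isMin [NeZero k] (q : Fin k → ℕ) : ∃ n, IsMin q n := by
  obtain ⟨i, hi⟩ := Finite.exists_min q
  exact ⟨q i, hi, i, rfl⟩

lemma pow_le_sum_pow {b : ℝ} (hb : 0 < b) {q : Fin k → ℕ} {M : ℕ} (hM : IsMin q M) :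
    b ^ M ≤ ∑ i, b ^ q i := by
  obtain ⟨-, i, rfl⟩ := hM
  exact Finset.single_le_sum (f := fun i => b ^ q i) (fun i _ => by positivity)
    (Finset.mem_univ i)

lemma sum_pow_le {b : ℝ} (hb : 0 < b) (hb1 : b ≤ 1) {q : Fin k → ℕ} {M : ℕ} (hM : IsMin q M) :
    ∑ i, b ^ q i ≤ k * b ^ M := by
  refine (Finset.sum_le_sum fun i _ =>
    pow_le_pow_of_le_one hb.le hb1 (hM.1 i)).trans_eq ?_
  simp

lemma Stationary.summable_lyap [NeZero k] (h : Stationary lam μ π) {m₀ a b ε δ : ℝ}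
    (hm₀ : 0 ≤ m₀) (hm : ∀ i, m₀ ≤ μ i) (ha : 1 < a) (hb : 0 < b) (hb1 : b < 1) (hε : 0 < ε)
    (hδ : 0 < δ)
    (h1 : k * (lam * a + (∑ i, μ i) * a⁻¹ - 1) - (1 - b) * (lam * a)
      + (b⁻¹ - 1) * ((∑ i, μ i) * a⁻¹) ≤ -δ)
    (h2 : (b⁻¹ - 1) * (∑ i, μ i) - (1 - b) * lam - m₀ * (1 - a⁻¹) ≤ -δ)
    (h3 : 0 ≤ lam * a + (∑ i, μ i) * a⁻¹ - 1)
    (h4 : k * ((∑ i, μ i) * ε) + (∑ i, μ i) * ε * (b⁻¹ - 1) ≤ δ / 2) :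
    Summable fun s => π s * lyap a b ε (queue s) := by
  have hμ := fun i => (h.mu_pos i).le
  have hlam := h.lam_pos.le
  have hk1 : (1 : ℝ) ≤ k := by exact_mod_cast Nat.one_le_iff_ne_zero.2 (NeZero.ne k)
  have hms : ∀ i, μ i ≤ ∑ i, μ i := fun i =>
    Finset.single_le_sum (fun i _ => hμ i) (Finset.mem_univ i)
  have hmm : m₀ ≤ ∑ i, μ i := (hm 0).trans (hms 0)
  have hmnn : 0 ≤ ∑ i, μ i := hm₀.trans hmm
  have hbi : 0 < b⁻¹ - 1 := sub_pos.2 ((one_lt_inv₀ hb).2 hb1)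
  have hs1 : ∀ n, 1 ≤ slope a ε n := one_le_slope ha.le hε.le
  have hs : ∀ n, 0 < slope a ε n := fun n => zero_lt_one.trans_le (hs1 n)
  have hW : ∀ q : Fin k → ℕ, 0 < ∏ j, expo a ε (q j) := fun q =>
    Finset.prod_pos fun j _ => expo_pos ha.le hε.le _
  have hV : ∀ q : Fin k → ℕ, 0 ≤ lyap a b ε q := fun q =>
    mul_nonneg (hW q).le (Finset.sum_nonneg fun i _ => by positivity)
  obtain ⟨L, hL⟩ := exists_slope_eq (a := a) hε
  set c := min (δ / (2 * k)) 1 with hc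
  have hc0 : 0 < c := lt_min (by positivity) one_pos
  set K := (a ^ L) ^ k * (lam * a * k + (∑ i, μ i) * (k + (b⁻¹ - 1))) with hKdef
  have hK : 0 ≤ K := by positivity
  refine h.moment_bound hc0 hK hV fun q => ?_
  obtain ⟨M, hM⟩ := exists_isMin q
  have hvS := pow_le_sum_pow hb hM
  have hSv := sum_pow_le hb hb1.le hM
  have hv : 0 < b ^ M := by positivity
  have hv1 : b ^ M ≤ 1 := pow_le_one₀ hb.le hb1.le
  refine (step_lyap_le hlam hμ ha.le hb hb1.le hε.le hM).trans ?_
  by_cases hq : ∃ j, L ≤ q j - 1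
  · obtain ⟨j₀, hj₀⟩ := hq
    have hD : ∑ j, μ j * (slope a ε (q j - 1))⁻¹
        ≤ (∑ i, μ i) * ((slope a ε M)⁻¹ + ε) - m₀ * ((slope a ε M)⁻¹ - a⁻¹) := by
      have hinv : ∀ j, (slope a ε (q j - 1))⁻¹ ≤ (slope a ε M)⁻¹ + ε := by
        intro j
        have h5 : slope a ε (M - 1) ≤ slope a ε (q j - 1) :=
          slope_mono hε.le (Nat.sub_le_sub_right (hM.1 j) 1)
        refine (inv_anti₀ (hs _) h5).trans ?_
        have h6 := slope_le_pred_add (a := a) hε.le M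
        rw [inv_le_iff_one_le_mul₀ (hs _)]
        have h7 : slope a ε M * (slope a ε M)⁻¹ = 1 := mul_inv_cancel₀ (hs _).ne'
        have h8 : (slope a ε M)⁻¹ ≤ 1 := inv_le_one_of_one_le₀ (hs1 M)
        have h9 := inv_pos.2 (hs M)
        nlinarith [hs1 (M - 1), mul_le_mul_of_nonneg_right h6 h9.le]
      have hterm : ∀ j, μ j * (slope a ε (q j - 1))⁻¹ ≤ μ j * ((slope a ε M)⁻¹ + ε)
          - if j = j₀ then m₀ * ((slope a ε M)⁻¹ - a⁻¹) else 0 := by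
        intro j
        split_ifs with hj
        · subst hj
          rw [hL _ hj₀]
          have e1 : 0 ≤ (slope a ε M)⁻¹ - a⁻¹ :=
            sub_nonneg.2 (inv_anti₀ (hs M) (slope_le M))
          have e2 := mul_le_mul_of_nonneg_right (hm j) e1
          have e3 := mul_nonneg (hμ j) hε.le
          linarith
        · rw [sub_zero]
          exact mul_le_mul_of_nonneg_left (hinv j) (hμ j)
      refine (Finset.sum_le_sum fun j _ => hterm j).trans_eq ?_
      simp [Finset.sum_sub_distrib, Finset.sum_mul]
    have hdr := drift_algebra hm₀ hmm h.norm ha hb hb1 hk1 hε.le h1 h2 h3 h4 (hs1 M)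
      (slope_le M) hD hv.le hvS hSv
    have hcS : c * ∑ i, b ^ q i ≤ δ / 2 * b ^ M := by
      calc c * ∑ i, b ^ q i ≤ δ / (2 * k) * (k * b ^ M) :=
            mul_le_mul (min_le_left _ _) hSv (hv.le.trans hvS) (by positivity)
        _ = δ / 2 * b ^ M := by field_simp
    have hfin := mul_le_mul_of_nonneg_left (hdr.trans (sub_le_sub_left hcS _)) (hW q).le
    refine hfin.trans ?_
    rw [lyap]
    linarith
  · push Not at hq
    have hqL : ∀ j, q j ≤ L := fun j => by have := hq j; omega
    have hWL : ∏ j, expo a ε (q j) ≤ (a ^ L) ^ k := by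
      refine (Finset.prod_le_prod (fun j _ => (expo_pos ha.le hε.le _).le) fun j _ =>
        (expo_le ha.le hε.le (q j)).trans (pow_le_pow_right₀ ha.le (hqL j))).trans_eq ?_
      simp
    have hD : ∑ j, μ j * (slope a ε (q j - 1))⁻¹ ≤ ∑ i, μ i :=
      Finset.sum_le_sum fun j _ => mul_le_of_le_one_right (hμ j) (inv_le_one_of_one_le₀ (hs1 _))
    have hSk : ∑ i, b ^ q i ≤ k := hSv.trans (mul_le_of_le_one_right (by positivity) hv1)
    have hbr : lam * slope a ε M * (∑ i, b ^ q i - (1 - b) * b ^ M)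
        + (∑ j, μ j * (slope a ε (q j - 1))⁻¹) * (∑ i, b ^ q i + (b⁻¹ - 1) * b ^ M)
        ≤ lam * a * k + (∑ i, μ i) * (k + (b⁻¹ - 1)) := by
      have e0 : (1 - b) * b ^ M ≤ b ^ M := mul_le_of_le_one_left hv.le (by linarith)
      have e1 : 0 ≤ (1 - b) * b ^ M := mul_nonneg (by linarith) hv.le
      have e2 : (b⁻¹ - 1) * b ^ M ≤ b⁻¹ - 1 := mul_le_of_le_one_right hbi.le hv1
      have e3 : 0 ≤ (b⁻¹ - 1) * b ^ M := mul_nonneg hbi.le hv.le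
      refine add_le_add (mul_le_mul (mul_le_mul_of_nonneg_left (slope_le M) hlam) ?_ ?_ ?_)
        (mul_le_mul hD ?_ ?_ hmnn)
      · linarith
      · linarith
      · positivity
      · linarith
      · linarith
    have hbig : (∏ j, expo a ε (q j)) * (lam * slope a ε M * (∑ i, b ^ q i - (1 - b) * b ^ M)
        + (∑ j, μ j * (slope a ε (q j - 1))⁻¹) * (∑ i, b ^ q i + (b⁻¹ - 1) * b ^ M)) ≤ K := by
      refine (mul_le_mul_of_nonneg_left hbr (hW q).le).trans ?_
      exact mul_le_mul_of_nonneg_right hWL (by positivity)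
    have : 0 ≤ (1 - c) * lyap a b ε q :=
      mul_nonneg (sub_nonneg.2 (min_le_right _ _)) (hV q)
    linarith

lemma Stationary.exists_markov_bound [NeZero k] (h : Stationary lam μ π) {m₀ a b : ℝ}
    (hm₀ : 0 ≤ m₀) (hm : ∀ i, m₀ ≤ μ i) (ha : 1 < a) (hb : 0 < b) (hb1 : b < 1)
    (h1 : k * (lam * a + (∑ i, μ i) * a⁻¹ - 1) <
      (1 - b) * (lam * a) - (b⁻¹ - 1) * ((∑ i, μ i) * a⁻¹))
    (h2 : (b⁻¹ - 1) * (∑ i, μ i) - (1 - b) * lam < m₀ * (1 - a⁻¹))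
    (h3 : 0 ≤ lam * a + (∑ i, μ i) * a⁻¹ - 1) :
    ∃ C : ℝ, 0 < C ∧ ∀ (p : (Fin k → ℕ) → Prop) (w : ℝ), 0 ≤ w →
      (∀ q M, IsMin q M → p q → w ≤ a ^ (∑ i, q i) * b ^ M) → prob π p * w ≤ C := by
  classical
  have hbi : 0 < b⁻¹ - 1 := sub_pos.2 ((one_lt_inv₀ hb).2 hb1)
  have hmpos : 0 < ∑ i, μ i :=
    Finset.sum_pos (fun i _ => h.mu_pos i) ⟨0, Finset.mem_univ _⟩
  have hk : (0 : ℝ) < k := by exact_mod_cast Nat.pos_of_ne_zero (NeZero.ne k)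
  obtain ⟨δ, hδ, hδ1, hδ2⟩ : ∃ δ : ℝ, 0 < δ ∧
      δ ≤ (1 - b) * (lam * a) - (b⁻¹ - 1) * ((∑ i, μ i) * a⁻¹)
        - k * (lam * a + (∑ i, μ i) * a⁻¹ - 1) ∧
      δ ≤ m₀ * (1 - a⁻¹) - ((b⁻¹ - 1) * (∑ i, μ i) - (1 - b) * lam) :=
    ⟨min _ _, lt_min (sub_pos.2 h1) (sub_pos.2 h2), min_le_left _ _, min_le_right _ _⟩
  set Q := k * (∑ i, μ i) + (∑ i, μ i) * (b⁻¹ - 1) with hQ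
  have hQpos : 0 < Q := by positivity
  have hε : 0 < δ / 2 / Q := by positivity
  have hsum := h.summable_lyap hm₀ hm ha hb hb1 hε hδ (by linarith) (by linarith) h3 (by
    have : Q * (δ / 2 / Q) = δ / 2 := mul_div_cancel₀ _ hQpos.ne'
    rw [hQ] at this ⊢
    linarith)
  obtain ⟨L, hL⟩ := exists_slope_eq (a := a) hε
  have hlyap : ∀ (q : Fin k → ℕ) M, IsMin q M →
      a ^ (∑ i, q i) * b ^ M ≤ (a ^ L) ^ k * lyap a b (δ / 2 / Q) q := by
    intro q M hM
    rw [lyap, ← mul_assoc, ← Finset.prod_pow_eq_pow_sum]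
    refine mul_le_mul ?_ (pow_le_sum_pow hb hM) (by positivity) ?_
    · refine (Finset.prod_le_prod (fun j _ => by positivity)
        fun j _ => pow_le_expo ha.le hε.le hL (q j)).trans_eq ?_
      simp [Finset.prod_mul_distrib]
    · exact mul_nonneg (by positivity)
        (Finset.prod_nonneg fun j _ => (expo_pos ha.le hε.le _).le)
  have hlnn : ∀ q : Fin k → ℕ, 0 ≤ lyap a b (δ / 2 / Q) q := fun q =>
    mul_nonneg (Finset.prod_nonneg fun j _ => (expo_pos ha.le hε.le _).le)
      (Finset.sum_nonneg fun i _ => by positivity)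
  have hs' := hsum.mul_left ((a ^ L) ^ k)
  have hnn : 0 ≤ ∑' s, (a ^ L) ^ k * (π s * lyap a b (δ / 2 / Q) (queue s)) :=
    tsum_nonneg fun s => mul_nonneg (by positivity) (mul_nonneg (h.nonneg s) (hlnn _))
  refine ⟨∑' s, (a ^ L) ^ k * (π s * lyap a b (δ / 2 / Q) (queue s)) + 1, by linarith,
    fun p w hw hp => ?_⟩
  rw [prob, ← tsum_mul_right]
  refine (Summable.tsum_le_tsum (fun s => ?_) ((h.summable_indicator p).mul_right w)
    hs').trans (by linarith)
  rw [mul_assoc, mul_left_comm ((a ^ L) ^ k)]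
  refine mul_le_mul_of_nonneg_left ?_ (h.nonneg s)
  split_ifs with hps
  · obtain ⟨M, hM⟩ := exists_isMin (queue s)
    rw [one_mul]
    exact (hp _ M hM hps).trans (hlyap _ M hM)
  · rw [zero_mul]
    exact mul_nonneg (by positivity) (hlnn _)

lemma eventually_pos_of_hasDerivAt {G : ℝ → ℝ} {d : ℝ} (hG : HasDerivAt G d 0) (h0 : G 0 = 0)
    (hd : 0 < d) : ∀ᶠ η in 𝓝[>] (0 : ℝ), 0 < G η := by
  have h1 := (hasDerivAt_iff_tendsto_slope.1 hG).mono_left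
    (nhdsWithin_mono (0 : ℝ) (fun x (hx : 0 < x) => hx.ne'))
  filter_upwards [h1.eventually (lt_mem_nhds hd), self_mem_nhdsWithin] with η h2 (hη : 0 < η)
  rw [slope_def_field, h0, sub_zero, sub_zero] at h2
  exact (div_pos_iff_of_pos_right hη).1 h2

lemma exists_small_exponent {l m m₀ c κ : ℝ} (hl : 0 < l) (hlm : l < m) (hm₀ : 0 < m₀)
    (hcκ : c * κ < 1) : ∃ η : ℝ, 0 < η ∧ η ≤ 1 ∧
      c * (m * (Real.exp (κ * η) - 1) + l * (Real.exp (-(κ * η)) - 1)) <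
        (1 - Real.exp (-η)) * (m * Real.exp (κ * η))
          - (Real.exp η - 1) * (l * Real.exp (-(κ * η))) ∧
      (Real.exp η - 1) * m - (1 - Real.exp (-η)) * l
        < m₀ * (1 - l / m * Real.exp (-(κ * η))) := by
  have hE : HasDerivAt (fun η : ℝ => Real.exp (κ * η)) κ 0 := by
    simpa using ((hasDerivAt_id (0 : ℝ)).const_mul κ).exp
  have hE' : HasDerivAt (fun η : ℝ => Real.exp (-(κ * η))) (-κ) 0 := by
    simpa using ((hasDerivAt_id (0 : ℝ)).const_mul κ).neg.exp
  have hF : HasDerivAt (fun η : ℝ => Real.exp η) 1 0 := by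
    simpa using Real.hasDerivAt_exp 0
  have hF' : HasDerivAt (fun η : ℝ => Real.exp (-η)) (-1) 0 := by
    simpa using (hasDerivAt_id (0 : ℝ)).neg.exp
  have hG := (((hF'.const_sub 1).mul (hE.const_mul m)).sub
    ((hF.sub_const 1).mul (hE'.const_mul l))).sub
    ((((hE.sub_const 1).const_mul m).add ((hE'.sub_const 1).const_mul l)).const_mul c)
  have ev1 := eventually_pos_of_hasDerivAt hG (by simp) (by
    have : 0 < (m - l) * (1 - c * κ) := mul_pos (by linarith) (by linarith)
    simp
    linarith)
  have hcont : ContinuousAt (fun η : ℝ => m₀ * (1 - l / m * Real.exp (-(κ * η)))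
      - ((Real.exp η - 1) * m - (1 - Real.exp (-η)) * l)) 0 := by fun_prop
  have ev2 : ∀ᶠ η : ℝ in 𝓝[>] 0, 0 < m₀ * (1 - l / m * Real.exp (-(κ * η)))
      - ((Real.exp η - 1) * m - (1 - Real.exp (-η)) * l) := by
    refine (hcont.eventually (lt_mem_nhds ?_)).filter_mono nhdsWithin_le_nhds
    simp only [mul_zero, neg_zero, Real.exp_zero, sub_self, zero_mul, mul_one, sub_zero]
    exact mul_pos hm₀ (sub_pos.2 ((div_lt_one (by linarith)).2 hlm))
  have ev3 : ∀ᶠ η : ℝ in 𝓝[>] 0, η ≤ 1 :=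
    (eventually_le_nhds one_pos).filter_mono nhdsWithin_le_nhds
  obtain ⟨η, ⟨⟨h1, h2⟩, h3⟩, h4⟩ :=
    (((ev1.and ev2).and ev3).and self_mem_nhdsWithin).exists
  simp only [Pi.sub_apply, Pi.mul_apply, Pi.add_apply] at h1
  exact ⟨η, h4, h3, by linarith, by linarith⟩

lemma Stationary.exists_exp_bound [NeZero k] (h : Stationary lam μ π)
    (hρ : lam < ∑ i, μ i) {δ : ℝ} (hδ : 0 < δ) (hδ1 : δ < 1) :
    ∃ η C : ℝ, 0 < η ∧ η ≤ 1 ∧ 0 < C ∧ ∀ (p : (Fin k → ℕ) → Prop) (w : ℝ),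
      (∀ q M, IsMin q M → p q →
        w ≤ ((1 - δ) / k * η - Real.log (lam / ∑ i, μ i)) * (∑ i, q i : ℕ) - η * M) →
      prob π p * Real.exp w ≤ C := by
  obtain ⟨i₀, hi₀⟩ := Finite.exists_min μ
  have hl := h.lam_pos
  have hn := h.norm
  have hk : (0 : ℝ) < k := by exact_mod_cast Nat.pos_of_ne_zero (NeZero.ne k)
  set m := ∑ i, μ i with hmdef
  have hm : 0 < m := hl.trans hρ
  set κ := (1 - δ) / k with hκ
  have hκ0 : 0 < κ := div_pos (by linarith) hk
  obtain ⟨η, hη, hη1, e1, e2⟩ := exists_small_exponent (c := k) (κ := κ) hl hρ (h.mu_pos i₀)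
    (by rw [hκ, mul_div_cancel₀ _ hk.ne']; linarith)
  have hE1 : 1 < Real.exp (κ * η) := Real.one_lt_exp_iff.2 (by positivity)
  have hE0 := Real.exp_pos (κ * η)
  set a := m / lam * Real.exp (κ * η) with hadef
  have hla : lam * a = m * Real.exp (κ * η) := by rw [hadef]; field_simp
  have hia : a⁻¹ = lam / m * Real.exp (-(κ * η)) := by
    rw [hadef, mul_inv, Real.exp_neg, inv_div]
  have hma : m * a⁻¹ = lam * Real.exp (-(κ * η)) := by rw [hia]; field_simp
  have hbinv : (Real.exp (-η))⁻¹ = Real.exp η := by rw [Real.exp_neg, inv_inv]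
  have ha : 1 < a := one_lt_mul_of_lt_of_le ((one_lt_div hl).2 hρ) hE1.le
  obtain ⟨C, hC, hb⟩ := h.exists_markov_bound (m₀ := μ i₀) (a := a) (b := Real.exp (-η))
    (h.mu_pos i₀).le hi₀ ha (Real.exp_pos _) (Real.exp_lt_one_iff.2 (by linarith))
    (by
      rw [← hmdef, hla, hma, hbinv]
      have : m * Real.exp (κ * η) + lam * Real.exp (-(κ * η)) - 1
          = m * (Real.exp (κ * η) - 1) + lam * (Real.exp (-(κ * η)) - 1) := by linarith
      rwa [this])
    (by rw [← hmdef, hbinv, hia]; exact e2)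
    (by
      rw [← hmdef, hla, hma, Real.exp_neg]
      have hEi : Real.exp (κ * η) * (Real.exp (κ * η))⁻¹ = 1 := mul_inv_cancel₀ hE0.ne'
      have hEi1 : (Real.exp (κ * η))⁻¹ ≤ 1 := inv_le_one_of_one_le₀ hE1.le
      have hmul : 0 ≤ (Real.exp (κ * η) - 1) * (m - lam * (Real.exp (κ * η))⁻¹) :=
        mul_nonneg (by linarith) (by
          have := mul_le_mul_of_nonneg_left hEi1 hl.le
          linarith)
      have : (Real.exp (κ * η) - 1) * (m - lam * (Real.exp (κ * η))⁻¹)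
          = m * Real.exp (κ * η) + lam * (Real.exp (κ * η))⁻¹ - (m + lam) := by
        linear_combination (-lam) * hEi
      linarith)
  refine ⟨η, C, hη, hη1, hC, fun p w hw => hb p _ (Real.exp_pos w).le fun q M hM hp => ?_⟩
  have hlog : a = Real.exp (κ * η - Real.log (lam / m)) := by
    rw [Real.exp_sub, Real.exp_log (by positivity), hadef]
    field_simp
  rw [hlog, ← Real.exp_nat_mul, ← Real.exp_nat_mul, ← Real.exp_add]
  refine Real.exp_le_exp.2 ((hw q M hM hp).trans_eq ?_)
  ring

lemma Stationary.prob_nonneg (h : Stationary lam μ π) (p : (Fin k → ℕ) → Prop) :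
    0 ≤ prob π p :=
  tsum_nonneg fun s => mul_nonneg (h.nonneg s) (by split_ifs <;> norm_num)

lemma Stationary.prob_le_add_sum (h : Stationary lam μ π) {p p₁ : (Fin k → ℕ) → Prop}
    {P : ℕ → (Fin k → ℕ) → Prop} {J : ℕ} (hp : ∀ q, p q → p₁ q ∨ ∃ j < J, P j q) :
    prob π p ≤ prob π p₁ + ∑ j ∈ Finset.range J, prob π (P j) := by
  classical
  simp only [prob]
  rw [← Summable.tsum_finsetSum fun j _ => h.summable_indicator (P j),
    ← (h.summable_indicator p₁).tsum_add (summable_sum fun j _ => h.summable_indicator (P j))]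
  refine Summable.tsum_le_tsum (fun s => ?_) (h.summable_indicator p)
    ((h.summable_indicator p₁).add (summable_sum fun j _ => h.summable_indicator (P j)))
  rw [← Finset.mul_sum, ← mul_add]
  refine mul_le_mul_of_nonneg_left ?_ (h.nonneg s)
  have h0 : ∀ j ∈ Finset.range J, (0 : ℝ) ≤ if P j (queue s) then 1 else 0 := fun j _ => by
    split_ifs <;> norm_num
  have h1 : (0 : ℝ) ≤ if p₁ (queue s) then 1 else 0 := by split_ifs <;> norm_num
  by_cases hps : p (queue s)
  · rw [if_pos hps]
    rcases hp _ hps with h2 | ⟨j, hj, h2⟩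
    · rw [if_pos h2]
      linarith [Finset.sum_nonneg h0]
    · have := Finset.single_le_sum h0 (Finset.mem_range.2 hj)
      rw [if_pos h2] at this
      linarith
  · rw [if_neg hps]
    exact add_nonneg h1 (Finset.sum_nonneg h0)

lemma isMin_queue {s : ℕ × (Fin k → ℕ)} (hs : ∃ i, s.2 i = 0) (n : ℕ) :
    IsMin (queue s) n ↔ s.1 = n := by
  obtain ⟨i, hi⟩ := hs
  constructor
  · rintro ⟨h1, j, h2⟩
    have := h1 i
    simp only [queue] at this h2
    omega
  · rintro rfl
    exact ⟨fun j => Nat.le_add_right _ _, i, by simp [queue, hi]⟩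

lemma Stationary.le_prob (h : Stationary lam μ π) {p : (Fin k → ℕ) → Prop}
    {s : ℕ × (Fin k → ℕ)} (hp : p (queue s)) : π s ≤ prob π p := by
  classical
  have := (h.summable_indicator p).le_tsum s
    (fun s' _ => mul_nonneg (h.nonneg s') (by split_ifs <;> norm_num))
  rw [if_pos hp, mul_one] at this
  rw [prob]
  convert this

lemma Stationary.tsum_eq_prob (h : Stationary lam μ π) (n : ℕ) :
    ∑' y : Fin k → ℕ, π (n, y) = prob π (fun q => IsMin q n) := by
  classical
  have hsum := h.summable_indicator (fun q => IsMin q n)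
  have hterm : ∀ s, π s * (if IsMin (queue s) n then 1 else 0)
      = if s.1 = n then π s else 0 := by
    intro s
    by_cases hs : π s = 0
    · simp [hs]
    · simp only [isMin_queue (h.supp s hs)]
      simp
  simp only [prob, hterm] at hsum ⊢
  rw [hsum.tsum_prod, tsum_eq_single n]
  · simp
  · intro m hm
    simp [hm]

lemma Stationary.exists_total_lower [NeZero k] (h : Stationary lam μ π) :
    ∃ c : ℝ, 0 < c ∧ ∃ m₁ : ℕ, ∀ m, m₁ ≤ m →
      c * Real.exp (Real.log (lam / ∑ i, μ i) * m) ≤ prob π (fun q => ∑ i, q i = m) := by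
  classical
  have hl := h.lam_pos
  have hmpos : 0 < ∑ i, μ i :=
    Finset.sum_pos (fun i _ => h.mu_pos i) ⟨0, Finset.mem_univ _⟩
  have hρ : 0 < lam / ∑ i, μ i := div_pos hl hmpos
  obtain ⟨s, hs⟩ : ∃ s, π s ≠ 0 := by
    by_contra! hall
    have h1 := h.sum.tsum_eq
    simp [hall] at h1
  have hs0 : 0 < π s := lt_of_le_of_ne (h.nonneg s) hs.symm
  set m₁ := ∑ i, queue s i with hm₁
  have hbase : π s ≤ prob π (fun q => ∑ i, q i = m₁) := h.le_prob rfl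
  refine ⟨π s * Real.exp (-(Real.log (lam / ∑ i, μ i) * m₁)), by positivity, m₁,
    fun m hm => ?_⟩
  induction m, hm using Nat.le_induction with
  | base => rwa [mul_assoc, ← Real.exp_add, neg_add_cancel, Real.exp_zero, mul_one]
  | succ m hm ih =>
    have hcut := h.total_cut m
    rw [Nat.cast_succ, mul_add, mul_one, Real.exp_add, Real.exp_log hρ, ← mul_assoc]
    calc _ ≤ prob π (fun q => ∑ i, q i = m) * (lam / ∑ i, μ i) :=
          mul_le_mul_of_nonneg_right ih hρ.le
      _ ≤ _ := by
        rw [mul_div_assoc', div_le_iff₀ hmpos]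
        linarith

lemma Stationary.log_upper [NeZero k] (h : Stationary lam μ π) (hρ : lam < ∑ i, μ i) {δ : ℝ}
    (hδ : 0 < δ) (hδ1 : δ < 1) : ∃ K : ℝ, ∀ n : ℕ, 0 < prob π (fun q => IsMin q n) →
      Real.log (prob π (fun q => IsMin q n))
        ≤ K + n * (k * Real.log (lam / ∑ i, μ i) + δ) := by
  obtain ⟨η, C, hη, hη1, hC, hb⟩ := h.exists_exp_bound hρ hδ hδ1
  have hk : (0 : ℝ) < k := by exact_mod_cast Nat.pos_of_ne_zero (NeZero.ne k)
  have hlog : Real.log (lam / ∑ i, μ i) < 0 :=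
    Real.log_neg (div_pos h.lam_pos (h.lam_pos.trans hρ))
      ((div_lt_one (h.lam_pos.trans hρ)).2 hρ)
  set ℓ := Real.log (lam / ∑ i, μ i) with hℓ
  refine ⟨Real.log C, fun n hn => ?_⟩
  have h1 := hb (fun q => IsMin q n) (((1 - δ) / k * η - ℓ) * (k * n : ℕ) - η * n) (by
    intro q M hM hq
    have hMn : M = n := by
      obtain ⟨a1, i, a2⟩ := hM
      obtain ⟨b1, j, b2⟩ := hq
      have := a1 j
      have := b1 i
      omega
    subst hMn
    have hT : k * M ≤ ∑ i, q i := by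
      have := Finset.card_nsmul_le_sum Finset.univ q M fun i _ => hM.1 i
      simpa using this
    have : 0 ≤ (1 - δ) / k * η - ℓ := by
      have : 0 ≤ (1 - δ) / k * η := mul_nonneg (div_nonneg (by linarith) hk.le) hη.le
      linarith
    have hT' : ((k * M : ℕ) : ℝ) ≤ (∑ i, q i : ℕ) := by exact_mod_cast hT
    have := mul_le_mul_of_nonneg_left hT' this
    linarith)
  have h2 := Real.log_le_log (mul_pos hn (Real.exp_pos _)) h1
  rw [Real.log_mul hn.ne' (Real.exp_pos _).ne', Real.log_exp, Nat.cast_mul] at h2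
  have e : ((1 - δ) / k * η - ℓ) * (k * n : ℝ) - η * n = -(n * (k * ℓ)) - n * (δ * η) := by
    field_simp
    ring
  rw [e] at h2
  have : n * (δ * η) ≤ n * δ :=
    mul_le_mul_of_nonneg_left (mul_le_of_le_one_right hδ.le hη1) (Nat.cast_nonneg n)
  linarith

lemma Stationary.exists_min_ratio [NeZero k] (h : Stationary lam μ π) : ∃ B : ℝ, 1 ≤ B ∧
    ∀ n j : ℕ, prob π (fun q => IsMin q (n + j)) ≤ B ^ j * prob π (fun q => IsMin q n) := by
  obtain ⟨i₀, hi₀⟩ := Finite.exists_min μ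
  have hpos := h.mu_pos i₀
  refine ⟨max (lam / μ i₀) 1, le_max_right _ _, fun n j => ?_⟩
  induction j with
  | zero => simp
  | succ j ih =>
    have hcut := h.min_cut hi₀ (n + j)
    have hnn := h.prob_nonneg (fun q => IsMin q (n + j))
    have h1 : prob π (fun q => IsMin q (n + (j + 1)))
        ≤ lam / μ i₀ * prob π (fun q => IsMin q (n + j)) := by
      rw [div_mul_eq_mul_div, le_div_iff₀ hpos, ← add_assoc]
      linarith
    refine h1.trans ((mul_le_mul_of_nonneg_right (le_max_left _ 1) hnn).trans ?_)
    rw [pow_succ', mul_assoc]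
    exact mul_le_mul_of_nonneg_left ih (by positivity)

/-- On the event that the total queue length is `m`, the minimum is close to `m / k` with
non-negligible probability. -/
lemma Stationary.exists_balanced_lower [NeZero k] (h : Stationary lam μ π)
    (hρ : lam < ∑ i, μ i) {δ : ℝ} (hδ : 0 < δ) (hδ1 : δ < 1) :
    ∃ c : ℝ, 0 < c ∧ ∃ m₁ : ℕ, ∀ m, m₁ ≤ m → ∀ n J : ℕ, k * n ≤ (1 - 2 * δ) * m →
      m < k * (n + J) →
      c * Real.exp (Real.log (lam / ∑ i, μ i) * m)
        ≤ ∑ j ∈ Finset.range J, prob π (fun q => IsMin q (n + j)) := by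
  obtain ⟨η, C, hη, hη1, hC, hb⟩ := h.exists_exp_bound hρ hδ hδ1
  obtain ⟨c, hc, m₁, hlow⟩ := h.exists_total_lower
  have hk : (0 : ℝ) < k := by exact_mod_cast Nat.pos_of_ne_zero (NeZero.ne k)
  set ℓ := Real.log (lam / ∑ i, μ i) with hℓ
  set d := δ * η / k with hd
  have hd0 : 0 < d := by positivity
  have htend : Tendsto (fun m : ℕ => C * Real.exp (-(d * m))) atTop (𝓝 (C * 0)) := by
    refine Tendsto.const_mul C (Real.tendsto_exp_neg_atTop_nhds_zero.comp ?_)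
    exact tendsto_natCast_atTop_atTop.const_mul_atTop hd0
  rw [mul_zero] at htend
  obtain ⟨m₂, hm₂⟩ := eventually_atTop.1 (htend.eventually (gt_mem_nhds (half_pos hc)))
  refine ⟨c / 2, half_pos hc, max m₁ m₂, fun m hm n J hn hJ => ?_⟩
  have h1 := hlow m (le_of_max_le_left hm)
  have h2 := hm₂ m (le_of_max_le_right hm)
  have h3 := h.prob_le_add_sum (p := fun q => ∑ i, q i = m)
    (p₁ := fun q => ∑ i, q i = m ∧ ∀ M, IsMin q M → (k * M : ℝ) ≤ (1 - 2 * δ) * m)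
    (P := fun j q => IsMin q (n + j)) (J := J) (by
      intro q hq
      obtain ⟨M, hM⟩ := exists_isMin q
      by_cases hle : (k * M : ℝ) ≤ (1 - 2 * δ) * m
      · refine Or.inl ⟨hq, fun M' hM' => ?_⟩
        have hMM : M' = M := by
          obtain ⟨a1, i, a2⟩ := hM
          obtain ⟨b1, j, b2⟩ := hM'
          have := a1 j
          have := b1 i
          omega
        rwa [hMM]
      · refine Or.inr ?_
        push Not at hle
        have hlt : (k * n : ℝ) < k * M := hn.trans_lt hle
        have hnM : n < M := by exact_mod_cast lt_of_mul_lt_mul_left hlt hk.le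
        have hT : k * M ≤ m := by
          have := Finset.card_nsmul_le_sum Finset.univ q M fun i _ => hM.1 i
          simpa [hq] using this
        have hMJ : M < n + J := lt_of_mul_lt_mul_left (hT.trans_lt hJ) (Nat.zero_le k)
        refine ⟨M - n, by omega, ?_⟩
        rwa [Nat.add_sub_cancel' hnM.le])
  have h4 := hb (fun q => ∑ i, q i = m ∧ ∀ M, IsMin q M → (k * M : ℝ) ≤ (1 - 2 * δ) * m)
    (-(ℓ * m) + d * m) (by
      rintro q M hM ⟨hq, hq'⟩
      rw [hq]
      have e1 := mul_le_mul_of_nonneg_left (hq' M hM) (div_pos hη hk).le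
      have e2 : η / k * (k * M : ℝ) = η * M := by field_simp
      have e3 : ((1 - δ) / k * η - ℓ) * m - η / k * ((1 - 2 * δ) * m) = -(ℓ * m) + d * m := by
        rw [hd]
        field_simp
        ring
      linarith)
  have h5 : prob π (fun q => ∑ i, q i = m ∧ ∀ M, IsMin q M → (k * M : ℝ) ≤ (1 - 2 * δ) * m)
      ≤ c / 2 * Real.exp (ℓ * m) := by
    have e1 := mul_le_mul_of_nonneg_right h4 (Real.exp_pos (ℓ * m + -(d * m))).le
    rw [mul_assoc, ← Real.exp_add] at e1
    have e2 : -(ℓ * m) + d * m + (ℓ * m + -(d * m)) = 0 := by ring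
    rw [e2, Real.exp_zero, mul_one, Real.exp_add] at e1
    have e3 := mul_le_mul_of_nonneg_right h2.le (Real.exp_pos (ℓ * m)).le
    linarith
  linarith

lemma Stationary.log_lower [NeZero k] (h : Stationary lam μ π) (hρ : lam < ∑ i, μ i) :
    ∃ Q : ℝ, 0 < Q ∧ ∀ δ : ℝ, 0 < δ → δ < 1 / 2 → ∃ K : ℝ, ∀ᶠ n : ℕ in atTop,
      0 < prob π (fun q => IsMin q n) ∧
      n * (k * Real.log (lam / ∑ i, μ i) - 2 * δ / (1 - 2 * δ) * Q) - K
        ≤ Real.log (prob π (fun q => IsMin q n)) := by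
  obtain ⟨B, hB1, hB⟩ := h.exists_min_ratio
  have hk : (0 : ℝ) < k := by exact_mod_cast Nat.pos_of_ne_zero (NeZero.ne k)
  have hk1 : (1 : ℝ) ≤ k := by exact_mod_cast Nat.one_le_iff_ne_zero.2 (NeZero.ne k)
  have hlog : Real.log (lam / ∑ i, μ i) < 0 :=
    Real.log_neg (div_pos h.lam_pos (h.lam_pos.trans hρ))
      ((div_lt_one (h.lam_pos.trans hρ)).2 hρ)
  have hlB : 0 ≤ Real.log B := Real.log_nonneg hB1
  refine ⟨-(k * Real.log (lam / ∑ i, μ i)) + (1 + Real.log B), by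
    have := mul_neg_of_pos_of_neg hk hlog
    linarith, fun δ hδ hδ2 => ?_⟩
  obtain ⟨c, hc, m₁, hbal⟩ := h.exists_balanced_lower hρ hδ (by linarith)
  set ℓ := Real.log (lam / ∑ i, μ i) with hℓ
  have hσ : 0 < 1 - 2 * δ := by linarith
  set σ := 2 * δ / (1 - 2 * δ) with hσdef
  have hσ1 : 1 / (1 - 2 * δ) = 1 + σ := by
    rw [hσdef]
    field_simp
    ring
  refine ⟨-Real.log c - ℓ + 3 * (1 + Real.log B), ?_⟩
  filter_upwards [eventually_ge_atTop m₁] with n hn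
  have hnk : (n : ℝ) ≤ n * k := le_mul_of_one_le_right (Nat.cast_nonneg n) hk1
  set m := ⌈(n * k) * (1 + σ)⌉₊ with hm
  have hσ0 : 0 ≤ σ := by positivity
  have hmge : (n * k) * (1 + σ) ≤ m := Nat.le_ceil _
  have hmle : (m : ℝ) < (n * k) * (1 + σ) + 1 := Nat.ceil_lt_add_one (by positivity)
  set J := m / k - n + 1 with hJ
  have hkm : (k * n : ℝ) ≤ (1 - 2 * δ) * m := by
    have := mul_le_mul_of_nonneg_left hmge hσ.le
    rw [← hσ1] at this
    have e : (1 - 2 * δ) * (n * k * (1 / (1 - 2 * δ))) = k * n := by field_simp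
    linarith
  have hmnR : (n * k : ℝ) ≤ m := by
    have : 0 ≤ (n * k : ℝ) * σ := by positivity
    linarith
  have hmn : m₁ ≤ m := by
    have : (n : ℝ) ≤ m := hnk.trans hmnR
    exact hn.trans (by exact_mod_cast this)
  have hndiv : n ≤ m / k := by
    rw [Nat.le_div_iff_mul_le (Nat.pos_of_ne_zero (NeZero.ne k))]
    exact_mod_cast hmnR
  have hmJ : m < k * (n + J) := by
    have : n + J = m / k + 1 := by omega
    rw [this, mul_add, mul_one]
    have := Nat.div_add_mod m k
    have := Nat.mod_lt m (Nat.pos_of_ne_zero (NeZero.ne k))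
    omega
  have hJle : (J : ℝ) ≤ n * σ + 2 := by
    have e1 : ((m / k : ℕ) : ℝ) ≤ m / k := Nat.cast_div_le
    have e2 : (m : ℝ) / k ≤ n * (1 + σ) + 1 := by
      rw [div_le_iff₀ hk]
      linarith
    rw [hJ, Nat.cast_add, Nat.cast_sub hndiv, Nat.cast_one]
    linarith
  have h1 := hbal m hmn n J hkm hmJ
  set A := prob π (fun q => IsMin q n) with hA
  have hAnn : 0 ≤ A := h.prob_nonneg _
  have h2 : ∑ j ∈ Finset.range J, prob π (fun q => IsMin q (n + j)) ≤ J * (B ^ J * A) := by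
    calc _ ≤ ∑ j ∈ Finset.range J, B ^ J * A := Finset.sum_le_sum fun j hj =>
          (hB n j).trans (mul_le_mul_of_nonneg_right
            (pow_le_pow_right₀ hB1 (Finset.mem_range.1 hj).le) hAnn)
      _ = J * (B ^ J * A) := by simp
  have h3 : 0 < c * Real.exp (ℓ * m) := by positivity
  have h4 := h1.trans h2
  have hApos : 0 < A := by
    rcases hAnn.eq_or_lt with h0 | h0
    · rw [← h0, mul_zero, mul_zero] at h4
      linarith
    · exact h0
  have hJpos : (0 : ℝ) < J := by rw [hJ]; positivity
  have hBJ : 0 < B ^ J := by positivity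
  refine ⟨hApos, ?_⟩
  have h5 := Real.log_le_log h3 h4
  rw [Real.log_mul hc.ne' (Real.exp_pos _).ne', Real.log_exp,
    Real.log_mul hJpos.ne' (by positivity), Real.log_mul hBJ.ne' hApos.ne', Real.log_pow] at h5
  have h6 : Real.log J ≤ J := (Real.log_le_sub_one_of_pos hJpos).trans (by linarith)
  have h7 := mul_le_mul_of_nonneg_right hJle (by linarith : 0 ≤ 1 + Real.log B)
  have h8 := mul_le_mul_of_nonpos_left hmle.le hlog.le
  linarith

end JSQ

/-- **Rough (logarithmic) tail asymptotics of the stationary minimum queue length:**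
`lim_{n→∞} (1/n) log P(M = n) = k log ρ`. -/
theorem jsq_rough_marginal_decay
    (k : ℕ) (hk : 2 ≤ k) (lam : ℝ) (μ : Fin k → ℝ)
    (hlam : 0 < lam) (hμ : ∀ i, 0 < μ i)
    (hnorm : lam + ∑ i, μ i = 1)
    (hρ : rho k lam μ < 1)
    (π : ℕ × (Fin k → ℕ) → ℝ)
    (hπnn : ∀ s, 0 ≤ π s)
    (hπsupp : ∀ s, π s ≠ 0 → ∃ i : Fin k, s.2 i = 0)
    (hπsum : HasSum π 1)
    (hπstat : ∀ s', (∑' s, π s * jsqP k lam μ s s') = π s') :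
    Tendsto (fun n : ℕ => (n : ℝ)⁻¹ * Real.log (∑' h : Fin k → ℕ, π (n, h)))
      atTop (𝓝 ((k : ℝ) * Real.log (rho k lam μ))) := by
  have : NeZero k := ⟨by omega⟩
  have h : JSQ.Stationary lam μ π := ⟨hlam, hμ, hnorm, hπnn, hπsupp, hπsum, hπstat⟩
  have hmpos : 0 < ∑ i, μ i :=
    Finset.sum_pos (fun i _ => hμ i) ⟨0, Finset.mem_univ _⟩
  unfold rho at hρ ⊢
  have hlt : lam < ∑ i, μ i := (div_lt_one hmpos).1 hρ
  simp only [h.tsum_eq_prob]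
  obtain ⟨Q, hQ, hlow⟩ := h.log_lower hlt
  set ℓ := Real.log (lam / ∑ i, μ i)
  rw [Metric.tendsto_atTop']
  intro ε hε
  set δ := min (1 / 4) (min (ε / 2) (ε / (8 * Q))) with hδdef
  have hδ : 0 < δ := by positivity
  have hδ4 : δ ≤ 1 / 4 := min_le_left _ _
  have hδε : δ ≤ ε / 2 := (min_le_right _ _).trans (min_le_left _ _)
  have hδQ : δ * (8 * Q) ≤ ε :=
    (le_div_iff₀ (by positivity)).1 ((min_le_right _ _).trans (min_le_right _ _))
  have hσ : 2 * δ / (1 - 2 * δ) * Q ≤ ε / 2 := by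
    have : 2 * δ / (1 - 2 * δ) ≤ 4 * δ := by
      rw [div_le_iff₀ (by linarith)]
      nlinarith
    have := mul_le_mul_of_nonneg_right this hQ.le
    linarith
  obtain ⟨K₁, h1⟩ := h.log_upper hlt hδ (by linarith)
  obtain ⟨K₂, h2⟩ := hlow δ hδ (by linarith)
  obtain ⟨N₁, hN₁⟩ := eventually_atTop.1 h2
  obtain ⟨N₂, hN₂⟩ := exists_nat_gt (max (|K₁|) |K₂| / (ε / 2))
  refine ⟨max N₁ N₂, fun n hn => ?_⟩
  obtain ⟨hpos, hl⟩ := hN₁ n (le_of_lt ((le_max_left _ _).trans_lt hn))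
  have hu := h1 n hpos
  have hn2 : N₂ < n := (le_max_right _ _).trans_lt hn
  have hn0 : (0 : ℝ) < n := by exact_mod_cast (Nat.zero_le _).trans_lt hn2
  have hK : max (|K₁|) |K₂| < n * (ε / 2) := by
    rw [div_lt_iff₀ (by positivity)] at hN₂
    have : (N₂ : ℝ) * (ε / 2) ≤ n * (ε / 2) :=
      mul_le_mul_of_nonneg_right (by exact_mod_cast hn2.le) (by positivity)
    linarith
  have hK1 : K₁ < n * (ε / 2) := (le_abs_self _).trans_lt ((le_max_left _ _).trans_lt hK)
  have hK2 : K₂ < n * (ε / 2) := (le_abs_self _).trans_lt ((le_max_right _ _).trans_lt hK)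
  have e1 := mul_le_mul_of_nonneg_left hσ hn0.le
  have e2 := mul_le_mul_of_nonneg_left hδε hn0.le
  rw [Real.dist_eq, abs_sub_lt_iff]
  constructor
  · rw [sub_lt_iff_lt_add, inv_mul_lt_iff₀ hn0]
    linarith
  · rw [sub_lt_comm, lt_inv_mul_iff₀ hn0]
    linarith
end
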